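/- Let G be a 3-connected maximal 1-plane graph on n ≥ 5 vertices that is immovable. Then the crossing number of the underlying graph satisfies cr(G) ≥ (n−2)/3. -/

import Mathlib

open Set

/-- A drawing of a simple graph in the plane: each vertex is assigned a distinct point,
and each edge a continuous arc (an injective continuous curve) joining its endpoints. -/
structure Drawing {V : Type} (G : SimpleGraph V) where
  pos : V → ℝ × ℝ
  pos_inj : Function.Injective pos
  arc : ∀ ⦃u v : V⦄, G.Adj u v → Set (ℝ × ℝ)
  arc_symm : ∀ ⦃u v : V⦄ (h : G.Adj u v), arc h.symm = arc h
  arc_isArc : ∀ ⦃u v : V⦄ (h : G.Adj u v), ∃ γ : ℝ → ℝ × ℝ,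
    ContinuousOn γ (Set.Icc 0 1) ∧ Set.InjOn γ (Set.Icc 0 1) ∧
    γ 0 = pos u ∧ γ 1 = pos v ∧ arc h = γ '' Set.Icc (0 : ℝ) 1

namespace Drawing

variable {V : Type} {G : SimpleGraph V} (D : Drawing G)

/-- The interior of the arc of an edge (the arc minus its endpoints). -/
def arcInt ⦃u v : V⦄ (h : G.Adj u v) : Set (ℝ × ℝ) :=
  D.arc h \ {D.pos u, D.pos v}

/-- The interior of the drawing of an abstract edge `e : Sym2 V`. -/
def edgeInt (e : Sym2 V) : Set (ℝ × ℝ) :=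
  {p | ∃ (u v : V) (h : G.Adj u v), e = s(u, v) ∧ p ∈ D.arcInt h}

/-- Two edges cross if they are distinct and their interiors meet. -/
def Cross (e f : Sym2 V) : Prop :=
  e ≠ f ∧ (D.edgeInt e ∩ D.edgeInt f).Nonempty

/-- The set of crossing points of the drawing. -/
def crossingSet : Set (ℝ × ℝ) :=
  {p | ∃ e f : Sym2 V, e ≠ f ∧ p ∈ D.edgeInt e ∧ p ∈ D.edgeInt f}

/-- A good drawing: no vertex lies on the arc of a non-incident edge, any two distinct
edges meet in at most one interior point, and edges sharing an endpoint do not cross. -/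
def IsGood : Prop :=
  (∀ (w : V) ⦃u v : V⦄ (h : G.Adj u v), D.pos w ∈ D.arc h → w = u ∨ w = v) ∧
  (∀ e f : Sym2 V, e ≠ f → (D.edgeInt e ∩ D.edgeInt f).Subsingleton) ∧
  (∀ ⦃u v w : V⦄ (h₁ : G.Adj u v) (h₂ : G.Adj u w), v ≠ w →
    D.arcInt h₁ ∩ D.arcInt h₂ = ∅)

/-- A drawing is 1-planar if every edge is crossed at most once. -/
def IsOnePlanar : Prop :=
  ∀ e : Sym2 V, {f : Sym2 V | D.Cross e f}.Subsingleton

/-- The number of crossings of the drawing (each unordered pair of crossing edges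
contributes one crossing). -/
noncomputable def crNum : ℕ :=
  Set.ncard {p : Sym2 V × Sym2 V | D.Cross p.1 p.2} / 2

/-- The subset of the plane covered by the drawing. -/
def drawingSet : Set (ℝ × ℝ) :=
  Set.range D.pos ∪ ⋃ (u : V) (v : V) (h : G.Adj u v), D.arc h

/-- A face of the drawing: a connected component of the complement of the drawing. -/
def IsFace (F : Set (ℝ × ℝ)) : Prop :=
  ∃ p ∉ D.drawingSet, F = connectedComponentIn D.drawingSetᶜ p

/-- The set `∂(F)` of vertices on the boundary of a face `F`. -/
def faceVerts (F : Set (ℝ × ℝ)) : Set V :=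
  {v | D.pos v ∈ frontier F}

/-- A true face of the planarization `G^×`: a face of the drawing whose boundary
contains no crossing point (i.e. it is incident with no fake vertex). -/
def IsTrueFace (F : Set (ℝ × ℝ)) : Prop :=
  D.IsFace F ∧ ∀ p ∈ D.crossingSet, p ∉ frontier F

/-- Two faces are adjacent if their boundaries share a common edge of the planarization,
i.e. they share a boundary point that is neither a vertex nor a crossing point. -/
def FaceAdj (F₁ F₂ : Set (ℝ × ℝ)) : Prop :=
  F₁ ≠ F₂ ∧ ∃ p, p ∈ frontier F₁ ∧ p ∈ frontier F₂ ∧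
    p ∉ Set.range D.pos ∧ p ∉ D.crossingSet

/-- The planarization `G^×` (crossings made into vertices of degree `4`) is a
triangulation: every face of the drawing has exactly three vertices of `G^×`
(true vertices or crossing points) on its boundary. -/
def PlanarizationIsTriangulation : Prop :=
  ∀ F : Set (ℝ × ℝ), D.IsFace F →
    ((Set.range D.pos ∪ D.crossingSet) ∩ frontier F).ncard = 3

/-- A maximal 1-plane graph: the drawing is good and 1-planar, and no edge between two
distinct non-adjacent vertices can be added to the drawing so that the result is still
a good 1-planar drawing. -/
def IsMaximalOnePlane : Prop :=
  D.IsGood ∧ D.IsOnePlanar ∧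
  ∀ u v : V, u ≠ v → ¬G.Adj u v →
    ∀ D' : Drawing (G ⊔ SimpleGraph.fromEdgeSet {s(u, v)}),
      D'.pos = D.pos →
      (∀ ⦃x y : V⦄ (h : G.Adj x y),
        D'.arc ((SimpleGraph.sup_adj _ _ _ _).mpr (Or.inl h)) = D.arc h) →
      ¬(D'.IsGood ∧ D'.IsOnePlanar)

/-- A maximal 1-plane graph is immovable if its number of crossings does not exceed that
of any good 1-planar drawing obtained from it by redrawing exactly one edge. -/
def Immovable : Prop :=
  ∀ D' : Drawing G, D'.IsGood → D'.IsOnePlanar → D'.pos = D.pos →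
    (∃ (u v : V) (_ : G.Adj u v), ∀ ⦃x y : V⦄ (h' : G.Adj x y),
      s(x, y) ≠ s(u, v) → D'.arc h' = D.arc h') →
    D.crNum ≤ D'.crNum

/-- The drawing induced on a subgraph. -/
def restrict {H : SimpleGraph V} (hle : H ≤ G) : Drawing H where
  pos := D.pos
  pos_inj := D.pos_inj
  arc := fun _ _ h => D.arc (hle h)
  arc_symm := fun _ _ h => D.arc_symm (hle h)
  arc_isArc := fun _ _ h => D.arc_isArc (hle h)

/-- `H` is a planar skeleton `G_P` of the 1-plane graph `(G, D)`: it is obtained from `G`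
by removing exactly one edge from each pair of crossing edges. -/
def IsPlanarSkeleton {H : SimpleGraph V} (_ : H ≤ G) : Prop :=
  (∀ e f : Sym2 V, D.Cross e f → (e ∈ H.edgeSet ↔ f ∉ H.edgeSet)) ∧
  ∀ e ∈ G.edgeSet, (¬∃ f, D.Cross e f) → e ∈ H.edgeSet

/-- `c_G(v)`: the number of crossing edges of the drawing incident with `v`. -/
noncomputable def cDeg (v : V) : ℕ :=
  Set.ncard {w : V | G.Adj v w ∧ ∃ f, D.Cross s(v, w) f}

end Drawing

/-- The crossing number of a graph: the least number of crossings in a good drawing. -/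
noncomputable def crossingNumber {V : Type} (G : SimpleGraph V) : ℕ :=
  sInf {n | ∃ D : Drawing G, D.IsGood ∧ D.crNum = n}

/-- A graph is `k`-connected if it stays connected after deleting any set of fewer than
`k` vertices. -/
def KConnected {V : Type} (G : SimpleGraph V) (k : ℕ) : Prop :=
  ∀ S : Set V, S.ncard < k → (G.induce Sᶜ).Connected

/-- A graph is 1-planar if it admits a good 1-planar drawing. -/
def Is1Planar {V : Type} (G : SimpleGraph V) : Prop :=
  ∃ D : Drawing G, D.IsGood ∧ D.IsOnePlanar

/-- A maximal 1-planar graph: 1-planar, and adding any edge between distinct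
non-adjacent vertices destroys 1-planarity. -/
def IsMaximal1Planar {V : Type} (G : SimpleGraph V) : Prop :=
  Is1Planar G ∧ ∀ u v : V, u ≠ v → ¬G.Adj u v →
    ¬Is1Planar (G ⊔ SimpleGraph.fromEdgeSet {s(u, v)})

namespace PT
open Complex Topology

/-- `p` and `q` lie in a common connected subset of `O`. -/
def Con {X : Type*} [TopologicalSpace X] (O : Set X) (p q : X) : Prop :=
  ∃ C : Set X, IsPreconnected C ∧ C ⊆ O ∧ p ∈ C ∧ q ∈ C

section ConBasic
variable {X : Type*} [TopologicalSpace X] {O O' : Set X} {p q r : X}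

theorem Con.symm (h : Con O p q) : Con O q p := by
  obtain ⟨C, h1, h2, h3, h4⟩ := h
  exact ⟨C, h1, h2, h4, h3⟩

theorem Con.trans (h : Con O p q) (h' : Con O q r) : Con O p r := by
  obtain ⟨C, h1, h2, h3, h4⟩ := h
  obtain ⟨C', h1', h2', h3', h4'⟩ := h'
  exact ⟨C ∪ C', IsPreconnected.union q h4 h3' h1 h1', union_subset h2 h2', Or.inl h3, Or.inr h4'⟩

theorem Con.refl (h : p ∈ O) : Con O p p :=
  ⟨{p}, isPreconnected_singleton, by simpa using h, rfl, rfl⟩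

theorem Con.mono (h : Con O p q) (hO : O ⊆ O') : Con O' p q := by
  obtain ⟨C, h1, h2, h3, h4⟩ := h
  exact ⟨C, h1, h2.trans hO, h3, h4⟩

theorem Con.mem_left (h : Con O p q) : p ∈ O := by
  obtain ⟨C, h1, h2, h3, h4⟩ := h
  exact h2 h3

theorem Con.mem_right (h : Con O p q) : q ∈ O := h.symm.mem_left

theorem con_iff : Con O p q ↔ p ∈ O ∧ q ∈ connectedComponentIn O p := by
  constructor
  · intro h
    refine ⟨h.mem_left, ?_⟩
    obtain ⟨C, h1, h2, h3, h4⟩ := h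
    exact h1.subset_connectedComponentIn h3 h2 h4
  · rintro ⟨h, h'⟩
    exact ⟨_, isPreconnected_connectedComponentIn, connectedComponentIn_subset _ _,
      mem_connectedComponentIn h, h'⟩

theorem con_image {Y : Type*} [TopologicalSpace Y] (e : X ≃ₜ Y) :
    Con (e '' O) (e p) (e q) ↔ Con O p q := by
  constructor
  · rintro ⟨C, h1, h2, h3, h4⟩
    refine ⟨e.symm '' C, h1.image _ e.symm.continuous.continuousOn, ?_, ⟨_, h3, by simp⟩,
      ⟨_, h4, by simp⟩⟩
    rintro _ ⟨c, hc, rfl⟩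
    obtain ⟨o, ho, h⟩ := h2 hc
    rw [← h]; simpa using ho
  · rintro ⟨C, h1, h2, h3, h4⟩
    exact ⟨e '' C, h1.image _ e.continuous.continuousOn, image_mono h2, ⟨_, h3, rfl⟩, ⟨_, h4, rfl⟩⟩

end ConBasic

/-- `f` has a continuous logarithm on `K`. -/
def LogOn (K : Set ℂ) (f : ℂ → ℂ) : Prop :=
  ∃ g : ℂ → ℂ, ContinuousOn g K ∧ ∀ z ∈ K, f z = exp (g z)

theorem exists_log_global {A : Type*} [TopologicalSpace A] [SimplyConnectedSpace A]
    [LocallyPathConnectedSpace A] (f : A → ℂ) (hf : Continuous f) (h0 : ∀ a, f a ≠ 0) :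
    ∃ g : A → ℂ, Continuous g ∧ ∀ a, f a = exp (g a) := by
  obtain ⟨a₀⟩ : Nonempty A := inferInstance
  obtain ⟨F, ⟨_, h2⟩, _⟩ := Complex.isCoveringMapOn_exp.existsUnique_continuousMap_lifts
    (⟨f, hf⟩ : C(A, ℂ)) (a₀ := a₀) (e₀ := log (f a₀)) (by simpa using exp_log (h0 a₀))
    (fun a => by simpa using h0 a)
  exact ⟨F, F.continuous, fun a => (congrFun h2 a).symm⟩

theorem eq_zero_of_exp_one {w : ℂ} (h : exp w = 1) (hw : ‖w‖ < 1) : w = 0 := by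
  obtain ⟨n, hn⟩ := Complex.exp_eq_one_iff.1 h
  rcases eq_or_ne n 0 with rfl | hne
  · simpa using hn
  · exfalso
    rw [hn] at hw
    have h1 : (1 : ℝ) ≤ |(n : ℝ)| := by
      have : (1 : ℤ) ≤ |n| := Int.one_le_abs hne
      exact_mod_cast this
    have h2 : ‖(n : ℂ) * (2 * Real.pi * I)‖ = |(n : ℝ)| * (2 * Real.pi) := by
      simp [abs_of_pos Real.pi_pos]
    rw [h2] at hw
    nlinarith [Real.pi_gt_three]

theorem log_unique {X : Type*} [TopologicalSpace X] {K : Set X} (hK : IsPreconnected K)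
    {g₁ g₂ : X → ℂ} (h1 : ContinuousOn g₁ K) (h2 : ContinuousOn g₂ K)
    (h : ∀ z ∈ K, exp (g₁ z) = exp (g₂ z)) :
    ∃ n : ℤ, ∀ z ∈ K, g₁ z = g₂ z + n * (2 * Real.pi * I) := by
  rcases K.eq_empty_or_nonempty with rfl | ⟨z₀, hz₀⟩
  · exact ⟨0, by simp⟩
  obtain ⟨n, hn⟩ := Complex.exp_eq_exp_iff_exists_int.1 (h z₀ hz₀)
  refine ⟨n, fun z hz => ?_⟩
  have key : g₁ z₀ - g₂ z₀ = g₁ z - g₂ z := by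
    refine hK.induction₂ (fun x y => g₁ x - g₂ x = g₁ y - g₂ y) ?_ ?_ ?_ hz₀ hz
    · intro x hx
      have hc : ContinuousWithinAt (fun y => (g₁ x - g₂ x) - (g₁ y - g₂ y)) K x :=
        continuousWithinAt_const.sub ((h1 x hx).sub (h2 x hx))
      have : ∀ᶠ y in 𝓝[K] x, ‖(g₁ x - g₂ x) - (g₁ y - g₂ y)‖ < 1 := by
        have := hc.norm
        refine this.eventually_lt continuousWithinAt_const ?_
        simp
      filter_upwards [this, self_mem_nhdsWithin] with y hy hyK
      have := eq_zero_of_exp_one (w := (g₁ x - g₂ x) - (g₁ y - g₂ y)) (by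
        rw [exp_sub, exp_sub, exp_sub, h x hx, h y hyK]
        simp [Complex.exp_ne_zero]) hy
      exact sub_eq_zero.1 this
    · intro x y z _ _ _ hxy hyz
      exact hxy.trans hyz
    · intro x y _ _ hxy
      exact hxy.symm
  rw [hn] at key
  linear_combination -key

/-- Points not separated by `K` give a function with a logarithm on `K`. -/
theorem logOn_of_con {K : Set ℂ} (hK : IsClosed K) {p q : ℂ} (h : Con Kᶜ p q) :
    LogOn K (fun z => (z - p) / (z - q)) := by
  obtain ⟨C, h1, h2, h3, h4⟩ := h
  refine h1.induction₂ (fun p q => LogOn K (fun z => (z - p) / (z - q))) ?_ ?_ ?_ h3 h4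
  · intro x hx
    have hO : Kᶜ ∈ 𝓝 x := hK.isOpen_compl.mem_nhds (h2 hx)
    obtain ⟨ε, hε, hb⟩ := Metric.mem_nhds_iff.1 hO
    have : Metric.ball x (ε / 2) ∈ 𝓝[C] x :=
      mem_nhdsWithin_of_mem_nhds (Metric.ball_mem_nhds x (by positivity))
    filter_upwards [this] with y hy
    have hyd : ‖x - y‖ < ε / 2 := by
      rw [← dist_eq_norm, dist_comm]; exact hy
    have hfar : ∀ z ∈ K, ε / 2 < ‖z - y‖ := by
      intro z hz
      by_contra hlt
      push Not at hlt
      have : z ∈ Metric.ball x ε := by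
        rw [Metric.mem_ball, dist_eq_norm]
        calc ‖z - x‖ = ‖(z - y) - (x - y)‖ := by ring_nf
          _ ≤ ‖z - y‖ + ‖x - y‖ := norm_sub_le _ _
          _ < ε := by linarith
      exact hb this hz
    have hne : ∀ z ∈ K, z - y ≠ 0 := fun z hz h0 => by
      have := hfar z hz
      rw [h0, norm_zero] at this
      linarith
    have hslit : ∀ z ∈ K, (z - x) / (z - y) ∈ slitPlane := by
      intro z hz
      have e : (z - x) / (z - y) = 1 + (-((x - y) / (z - y))) := by
        field_simp [hne z hz]; ring
      rw [e]
      apply Complex.mem_slitPlane_of_norm_lt_one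
      rw [norm_neg, norm_div, div_lt_one (norm_pos_iff.2 (hne z hz))]
      linarith [hfar z hz]
    refine ⟨fun z => log ((z - x) / (z - y)), ?_, fun z hz => ?_⟩
    · apply ContinuousOn.clog
      · exact ContinuousOn.div (by fun_prop) (by fun_prop) hne
      · exact hslit
    · rw [exp_log (slitPlane_ne_zero (hslit z hz))]
  · rintro x y z hx hy hz ⟨g, hg, hg'⟩ ⟨k, hk, hk'⟩
    refine ⟨fun z => g z + k z, hg.add hk, fun w hw => ?_⟩
    have hwy : w - y ≠ 0 := fun h0 => h2 hy (by rw [sub_eq_zero] at h0; exact h0 ▸ hw)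
    have hwz : w - z ≠ 0 := fun h0 => h2 hz (by rw [sub_eq_zero] at h0; exact h0 ▸ hw)
    rw [exp_add, ← hg' w hw, ← hk' w hw]
    field_simp
  · rintro x y hx hy ⟨g, hg, hg'⟩
    refine ⟨fun z => - g z, hg.neg, fun w hw => ?_⟩
    rw [exp_neg, ← hg' w hw, inv_div]

theorem no_log_circle {p : ℂ} {R : ℝ} (hR : ‖p‖ < R) {n : ℤ} (hn : n ≠ 0) {g : ℂ → ℂ}
    (hg : ContinuousOn g (Metric.sphere 0 R))
    (h : ∀ z ∈ Metric.sphere (0 : ℂ) R, (z - p) ^ n = exp (g z)) : False := by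
  have hR0 : 0 < R := (norm_nonneg p).trans_lt hR
  have hRC : (R : ℂ) ≠ 0 := by exact_mod_cast hR0.ne'
  let c : ℝ → ℂ := fun t => R * exp (t * I)
  have hc : Continuous c := by fun_prop
  have hcs : ∀ t, c t ∈ Metric.sphere (0 : ℂ) R := fun t => by
    simp [c, abs_of_pos hR0, Complex.norm_exp_ofReal_mul_I]
  have hc0 : ∀ t, c t ≠ 0 := fun t => by simp [c, hRC, Complex.exp_ne_zero]
  have hslit : ∀ t, 1 + (-(p / c t)) ∈ slitPlane := fun t => by
    apply Complex.mem_slitPlane_of_norm_lt_one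
    have : ‖c t‖ = R := by simpa using hcs t
    rw [norm_neg, norm_div, this, div_lt_one hR0]
    exact hR
  have h1 : Continuous fun t => g (c t) := hg.comp_continuous hc hcs
  have h2 : Continuous fun t : ℝ => (n : ℂ) * (log (1 + (-(p / c t))) + Real.log R + t * I) := by
    refine continuous_const.mul ((Continuous.add ?_ continuous_const).add (by fun_prop))
    apply Continuous.clog
    · exact continuous_const.add (continuous_const.div hc hc0).neg
    · exact hslit
  obtain ⟨k, hk⟩ := log_unique (K := (univ : Set ℝ)) isPreconnected_univ h1.continuousOn
    h2.continuousOn (by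
      intro t _
      rw [← h _ (hcs t), Complex.exp_int_mul, exp_add, exp_add, exp_log (slitPlane_ne_zero (hslit t)),
        ← Complex.ofReal_exp, Real.exp_log hR0]
      congr 1
      have : c t - p = (1 + -(p / c t)) * c t := by field_simp [hc0 t]; ring
      rw [this]; simp only [c]; ring)
  have e0 := hk 0 trivial
  have e1 := hk (2 * Real.pi) trivial
  have hcc : c (2 * Real.pi) = c 0 := by
    simp only [c]; push_cast; rw [Complex.exp_two_pi_mul_I]; simp
  rw [hcc, e0] at e1
  have : (n : ℂ) * (2 * Real.pi * I) = 0 := by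
    push_cast at e1
    linear_combination -e1
  have hpi : (2 * Real.pi * I : ℂ) ≠ 0 := Complex.two_pi_I_ne_zero
  rcases mul_eq_zero.1 this with h | h
  · exact hn (by exact_mod_cast h)
  · exact hpi h

/-- Key nonextension lemma. -/
theorem no_ext {U : Set ℂ} (hU : IsOpen U) (hb : Bornology.IsBounded U) {p : ℂ} (hp : p ∈ U)
    {n : ℤ} (hn : n ≠ 0) {w : ℂ → ℂ} (hw : ContinuousOn w (closure U))
    (hw0 : ∀ z ∈ closure U, w z ≠ 0) (hfr : ∀ z ∈ frontier U, (z - p) ^ n = w z) : False := by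
  classical
  have hcont : Continuous (U.piecewise w (fun z => (z - p) ^ n)) := by
    apply continuous_piecewise
    · intro a ha; exact (hfr a ha).symm
    · exact hw
    · rw [hU.isClosed_compl.closure_eq]
      apply ContinuousOn.zpow₀ (by fun_prop)
      intro a ha
      left
      intro h0
      exact ha (by rw [sub_eq_zero.1 h0]; exact hp)
  obtain ⟨g, hg, hg'⟩ := exists_log_global _ hcont (by
    intro a
    by_cases ha : a ∈ U
    · rw [piecewise_eq_of_mem _ _ _ ha]; exact hw0 a (subset_closure ha)
    · rw [piecewise_eq_of_notMem _ _ _ ha]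
      apply zpow_ne_zero
      intro h0
      exact ha (by rw [sub_eq_zero.1 h0]; exact hp))
  obtain ⟨R, hR⟩ := hb.subset_ball 0
  have hpR : ‖p‖ < R := by simpa using hR hp
  refine no_log_circle hpR hn hg.continuousOn (fun z hz => ?_)
  rw [← hg' z, piecewise_eq_of_notMem]
  intro hzU
  have := hR hzU
  simp at this hz
  linarith

theorem isPreconnected_compl_closedBall (R : ℝ) : IsPreconnected (Metric.closedBall (0 : ℂ) R)ᶜ := by
  rcases lt_or_ge R 0 with h | h
  · have : (Metric.closedBall (0 : ℂ) R)ᶜ = univ := by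
      simp [Metric.closedBall_eq_empty.2 h]
    rw [this]; exact isPreconnected_univ
  have : (Metric.closedBall (0 : ℂ) R)ᶜ = (fun x : ℝ × ℝ => (x.1 : ℂ) * exp (x.2 * I)) ''
      (Ioi R ×ˢ univ) := by
    ext z
    simp only [mem_compl_iff, Metric.mem_closedBall, dist_zero_right, not_le, mem_image, mem_prod,
      mem_Ioi, mem_univ, and_true, Prod.exists]
    constructor
    · intro hz
      exact ⟨‖z‖, z.arg, hz, by exact_mod_cast Complex.norm_mul_exp_arg_mul_I z⟩
    · rintro ⟨r, t, hr, rfl⟩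
      simpa [Complex.norm_exp_ofReal_mul_I] using hr.trans_le (le_abs_self r)
  rw [this]
  apply IsPreconnected.image
  · exact isPreconnected_Ioi.prod isPreconnected_univ
  · fun_prop

theorem con_of_unbounded {K : Set ℂ} (hK : IsCompact K) {p q : ℂ}
    (h1 : ¬ Bornology.IsBounded (connectedComponentIn Kᶜ p))
    (h2 : ¬ Bornology.IsBounded (connectedComponentIn Kᶜ q)) : Con Kᶜ p q := by
  obtain ⟨R, hR⟩ := hK.isBounded.subset_closedBall 0
  have hO : (Metric.closedBall (0 : ℂ) R)ᶜ ⊆ Kᶜ := compl_subset_compl.2 hR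
  have key : ∀ p : ℂ, ¬ Bornology.IsBounded (connectedComponentIn Kᶜ p) →
      p ∈ Kᶜ ∧ ∃ a ∈ (Metric.closedBall (0 : ℂ) R)ᶜ, a ∈ connectedComponentIn Kᶜ p := by
    intro p hp
    constructor
    · by_contra h
      rw [connectedComponentIn_eq_empty h] at hp
      exact hp Bornology.isBounded_empty
    · by_contra h
      push Not at h
      apply hp
      refine Bornology.IsBounded.subset (Metric.isBounded_closedBall (x := (0 : ℂ)) (r := R)) ?_
      intro z hz
      by_contra hzn
      exact h z hzn hz
  obtain ⟨hp, a, ha, ha'⟩ := key p h1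
  obtain ⟨hq, b, hb, hb'⟩ := key q h2
  have : Con Kᶜ a b := ⟨_, isPreconnected_compl_closedBall R, hO, ha, hb⟩
  exact (con_iff.2 ⟨hp, ha'⟩).trans (this.trans (con_iff.2 ⟨hq, hb'⟩).symm)

theorem frontier_component_subset {X : Type*} [TopologicalSpace X] [LocallyConnectedSpace X]
    {K : Set X} (hK : IsClosed K) (p : X) : frontier (connectedComponentIn Kᶜ p) ⊆ K := by
  intro z hz
  by_contra hzK
  have hU : IsOpen (connectedComponentIn Kᶜ p) := hK.isOpen_compl.connectedComponentIn
  rw [hU.frontier_eq] at hz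
  have hz' : connectedComponentIn Kᶜ z ∈ 𝓝 z :=
    connectedComponentIn_mem_nhds (hK.isOpen_compl.mem_nhds hzK)
  obtain ⟨y, hy, hy'⟩ := mem_closure_iff_nhds.1 hz.1 _ hz'
  have e1 := connectedComponentIn_eq hy
  have e2 := connectedComponentIn_eq hy'
  apply hz.2
  rw [e2, ← e1]
  exact mem_connectedComponentIn hzK

theorem exists_ext_log {K : Set ℂ} (hK : IsClosed K) {g : ℂ → ℂ} (hg : ContinuousOn g K) :
    ∃ G : ℂ → ℂ, Continuous G ∧ ∀ z ∈ K, G z = g z := by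
  obtain ⟨G, hG⟩ := ContinuousMap.exists_extension hK.isClosedEmbedding_subtypeVal
    (⟨K.domRestrict g, hg.domRestrict⟩ : C(K, ℂ))
  refine ⟨G, G.continuous, fun z hz => ?_⟩
  have := DFunLike.congr_fun hG ⟨z, hz⟩
  exact this

theorem prod_log_zero {ι : Type*} {K : Set ℂ} (hK : IsCompact K) (s : Finset ι) (p : ι → ℂ)
    (m : ι → ℤ) (hp : ∀ i ∈ s, p i ∉ K) (hsep : ∀ i ∈ s, ∀ j ∈ s, i ≠ j → ¬ Con Kᶜ (p i) (p j))
    (hsum : ∑ i ∈ s, m i = 0) (hlog : LogOn K (fun z => ∏ i ∈ s, (z - p i) ^ (m i))) :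
    ∀ i ∈ s, m i = 0 := by
  classical
  have core : ∀ i ∈ s, m i ≠ 0 → ¬ Bornology.IsBounded (connectedComponentIn Kᶜ (p i)) := by
    intro i hi hmi hbd
    obtain ⟨g, hg, hg'⟩ := hlog
    obtain ⟨G, hG, hG'⟩ := exists_ext_log hK.isClosed hg
    have hsub : closure (connectedComponentIn Kᶜ (p i)) ⊆ connectedComponentIn Kᶜ (p i) ∪ K := by
      intro z hz
      by_cases h : z ∈ connectedComponentIn Kᶜ (p i)
      · exact Or.inl h
      · right
        apply frontier_component_subset hK.isClosed (p i)
        rw [(hK.isClosed.isOpen_compl.connectedComponentIn).frontier_eq]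
        exact ⟨hz, h⟩
    have hne : ∀ z ∈ closure (connectedComponentIn Kᶜ (p i)), ∀ j ∈ s.erase i, z - p j ≠ 0 := by
      intro z hz j hj h0
      rw [sub_eq_zero] at h0
      have hj' := Finset.mem_erase.1 hj
      rcases hsub hz with h | h
      · exact hsep i hi j hj'.2 hj'.1.symm (con_iff.2 ⟨hp i hi, h0 ▸ h⟩)
      · exact hp j hj'.2 (h0 ▸ h)
    refine no_ext (U := connectedComponentIn Kᶜ (p i)) (hK.isClosed.isOpen_compl.connectedComponentIn)
      hbd (mem_connectedComponentIn (hp i hi)) hmi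
      (w := fun z => exp (G z) * ∏ j ∈ s.erase i, (z - p j) ^ (- m j)) ?_ ?_ ?_
    · apply ContinuousOn.mul (by fun_prop)
      apply continuousOn_finsetProd
      intro j hj
      apply ContinuousOn.zpow₀ (by fun_prop)
      intro z hz
      exact Or.inl (hne z hz j hj)
    · intro z hz
      refine mul_ne_zero (exp_ne_zero _) (Finset.prod_ne_zero_iff.2 fun j hj => ?_)
      exact zpow_ne_zero _ (hne z hz j hj)
    · intro z hz
      have hzK := frontier_component_subset hK.isClosed (p i) hz
      beta_reduce
      rw [hG' z hzK, ← hg' z hzK]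
      beta_reduce
      rw [← Finset.mul_prod_erase _ _ hi, mul_assoc, ← Finset.prod_mul_distrib,
        Finset.prod_eq_one, mul_one]
      intro j hj
      rw [← zpow_add₀ (hne z (frontier_subset_closure hz) j hj)]
      simp
  intro i hi
  by_contra hmi
  have : ∃ j ∈ s.erase i, m j ≠ 0 := by
    by_contra hall
    push Not at hall
    rw [← Finset.add_sum_erase _ _ hi, Finset.sum_eq_zero hall] at hsum
    exact hmi (by simpa using hsum)
  obtain ⟨j, hj, hmj⟩ := this
  have hj' := Finset.mem_erase.1 hj
  exact hsep i hi j hj'.2 hj'.1.symm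
    (con_of_unbounded hK (core i hi hmi) (core j hj'.2 hmj))

/-- Converse of `logOn_of_con`. -/
theorem con_of_logOn {K : Set ℂ} (hK : IsCompact K) {p q : ℂ} (hp : p ∉ K) (hq : q ∉ K)
    (h : LogOn K (fun z => (z - p) / (z - q))) : Con Kᶜ p q := by
  by_contra hcon
  have := prod_log_zero hK (Finset.univ : Finset Bool) (fun b => if b then p else q)
    (fun b => if b then 1 else -1) (by simp [hp, hq])
    (by
      intro i _ j _ hij
      cases i <;> cases j <;> simp_all
      exact fun h => hcon h.symm)
    (by simp) (by
      obtain ⟨g, hg, hg'⟩ := h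
      exact ⟨g, hg, fun z hz => by simp [← hg' z hz, div_eq_mul_inv]⟩)
  simpa using this true (Finset.mem_univ _)

theorem glue_continuousOn {X Y : Type*} [TopologicalSpace X] [TopologicalSpace Y] {A B : Set X}
    (hA : IsClosed A) (hB : IsClosed B)
    {f g : X → Y} (hf : ContinuousOn f A) (hg : ContinuousOn g B) (h : ∀ z ∈ A ∩ B, f z = g z) :
    ∃ k : X → Y, ContinuousOn k (A ∪ B) ∧ (∀ z ∈ A, k z = f z) ∧ ∀ z ∈ B, k z = g z := by
  classical
  refine ⟨A.piecewise f g, ?_, fun z hz => piecewise_eq_of_mem _ _ _ hz, fun z hz => ?_⟩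
  · apply ContinuousOn.union_of_isClosed _ _ hA hB
    · exact hf.congr fun z hz => piecewise_eq_of_mem _ _ _ hz
    · refine hg.congr fun z hz => ?_
      by_cases hzA : z ∈ A
      · rw [piecewise_eq_of_mem _ _ _ hzA]; exact h z ⟨hzA, hz⟩
      · rw [piecewise_eq_of_notMem _ _ _ hzA]
  · by_cases hzA : z ∈ A
    · rw [piecewise_eq_of_mem _ _ _ hzA]; exact h z ⟨hzA, hz⟩
    · rw [piecewise_eq_of_notMem _ _ _ hzA]

/-- Janiszewski's first theorem, complex plane. -/
theorem janC {A B : Set ℂ} (hA : IsCompact A) (hB : IsCompact B) (hAB : IsPreconnected (A ∩ B))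
    {p q : ℂ} (h1 : Con Aᶜ p q) (h2 : Con Bᶜ p q) : Con (A ∪ B)ᶜ p q := by
  obtain ⟨f, hf, hf'⟩ := logOn_of_con hA.isClosed h1
  obtain ⟨g, hg, hg'⟩ := logOn_of_con hB.isClosed h2
  obtain ⟨n, hn⟩ := log_unique hAB (hf.mono inter_subset_left) (hg.mono inter_subset_right)
    (fun z hz => by rw [← hf' z hz.1, ← hg' z hz.2])
  obtain ⟨k, hk, hk1, hk2⟩ := glue_continuousOn hA.isClosed hB.isClosed hf
    (hg.add (continuousOn_const (c := (n : ℂ) * (2 * Real.pi * I)))) hn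
  refine con_of_logOn (hA.union hB) (fun h => h.elim h1.mem_left h2.mem_left)
    (fun h => h.elim h1.mem_right h2.mem_right) ⟨k, hk, ?_⟩
  rintro z (hz | hz)
  · rw [hk1 z hz, hf' z hz]
  · rw [hk2 z hz, hg' z hz]
    simp only [Pi.add_apply]
    rw [exp_add, Complex.exp_int_mul_two_pi_mul_I, mul_one]

end PT

namespace PT
open Complex Topology

/-- `S` is (the image of) an arc from `a` to `b`. -/
def IsArc {X : Type*} [TopologicalSpace X] (S : Set X) (a b : X) : Prop :=
  ∃ γ : ℝ → X, ContinuousOn γ (Icc 0 1) ∧ InjOn γ (Icc 0 1) ∧ γ 0 = a ∧ γ 1 = b ∧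
    S = γ '' Icc (0 : ℝ) 1

section arcBasic
variable {X : Type*} [TopologicalSpace X] {S : Set X} {a b : X}

theorem IsArc.isCompact (h : IsArc S a b) : IsCompact S := by
  obtain ⟨γ, h1, h2, h3, h4, rfl⟩ := h
  exact isCompact_Icc.image_of_continuousOn h1

theorem IsArc.isClosed [T2Space X] (h : IsArc S a b) : IsClosed S := h.isCompact.isClosed

theorem IsArc.isPreconnected (h : IsArc S a b) : IsPreconnected S := by
  obtain ⟨γ, h1, h2, h3, h4, rfl⟩ := h
  exact isPreconnected_Icc.image _ h1

theorem IsArc.left_mem (h : IsArc S a b) : a ∈ S := by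
  obtain ⟨γ, h1, h2, h3, h4, rfl⟩ := h
  exact ⟨0, by simp, h3⟩

theorem IsArc.right_mem (h : IsArc S a b) : b ∈ S := by
  obtain ⟨γ, h1, h2, h3, h4, rfl⟩ := h
  exact ⟨1, by simp, h4⟩

theorem IsArc.ne (h : IsArc S a b) : a ≠ b := by
  obtain ⟨γ, h1, h2, rfl, rfl, rfl⟩ := h
  intro h
  have := h2 (by simp) (by simp) h
  norm_num at this

theorem IsArc.symm (h : IsArc S a b) : IsArc S b a := by
  obtain ⟨γ, h1, h2, rfl, rfl, rfl⟩ := h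
  have hm : MapsTo (fun t : ℝ => 1 - t) (Icc 0 1) (Icc 0 1) := by
    intro t ht; constructor <;> simp [ht.1, ht.2]
  refine ⟨fun t => γ (1 - t), h1.comp (by fun_prop) hm, ?_, by simp, by simp, ?_⟩
  · intro s hs t ht hst
    have := h2 (hm hs) (hm ht) hst
    simpa using this
  · ext x
    constructor
    · rintro ⟨t, ht, rfl⟩
      exact ⟨1 - t, hm ht, by simp⟩
    · rintro ⟨t, ht, rfl⟩
      exact ⟨1 - t, hm ht, rfl⟩

/-- Reparametrised piece of an arc. -/
theorem isArc_piece {γ : ℝ → X} (h1 : ContinuousOn γ (Icc 0 1)) (h2 : InjOn γ (Icc 0 1))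
    {s t : ℝ} (hs : 0 ≤ s) (hst : s < t) (ht : t ≤ 1) : IsArc (γ '' Icc s t) (γ s) (γ t) := by
  have hm : MapsTo (fun u : ℝ => s + u * (t - s)) (Icc 0 1) (Icc 0 1) := by
    intro u hu
    constructor <;> nlinarith [hu.1, hu.2]
  have him : (fun u : ℝ => s + u * (t - s)) '' Icc 0 1 = Icc s t := by
    ext x
    constructor
    · rintro ⟨u, hu, rfl⟩
      constructor <;> nlinarith [hu.1, hu.2]
    · intro hx
      refine ⟨(x - s) / (t - s), ⟨div_nonneg (by linarith [hx.1]) (by linarith),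
        (div_le_one (by linarith)).2 (by linarith [hx.2])⟩, ?_⟩
      have : t - s ≠ 0 := by linarith
      field_simp
      ring
  refine ⟨fun u => γ (s + u * (t - s)), h1.comp (by fun_prop) hm, ?_, by simp, by simp, ?_⟩
  · intro u hu v hv huv
    have := h2 (hm hu) (hm hv) huv
    have h3 : t - s ≠ 0 := by linarith
    simpa [h3] using this
  · rw [← him, image_image]

theorem IsArc.image {Y : Type*} [TopologicalSpace Y] (h : IsArc S a b) (e : X ≃ₜ Y) :
    IsArc (e '' S) (e a) (e b) := by
  obtain ⟨γ, h1, h2, rfl, rfl, rfl⟩ := h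
  refine ⟨fun t => e (γ t), e.continuous.comp_continuousOn h1, ?_, rfl, rfl, ?_⟩
  · intro s hs t ht h
    exact h2 hs ht (e.injective h)
  · rw [image_image]

/-- Continuous inverse of a parametrisation. -/
theorem arc_inv [T2Space X] {γ : ℝ → X} (h1 : ContinuousOn γ (Icc 0 1)) (h2 : InjOn γ (Icc 0 1)) :
    ∃ δ : X → ℝ, ContinuousOn δ (γ '' Icc 0 1) ∧ (∀ t ∈ Icc (0:ℝ) 1, δ (γ t) = t) := by
  have hemb : Topology.IsClosedEmbedding (fun t : Icc (0:ℝ) 1 => γ t) := by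
    apply Continuous.isClosedEmbedding
    · exact continuousOn_iff_continuous_domRestrict.1 h1
    · intro s t h
      exact Subtype.ext (h2 s.2 t.2 h)
  refine ⟨Function.invFunOn γ (Icc 0 1), ?_, fun t ht => h2.leftInvOn_invFunOn ht⟩
  rw [continuousOn_iff_continuous_domRestrict]
  have hr : range (fun t : Icc (0:ℝ) 1 => γ t) = γ '' Icc 0 1 := by
    rw [image_eq_range]
  have e := hemb.isEmbedding.toHomeomorph
  have : Continuous fun x : range (fun t : Icc (0:ℝ) 1 => γ t) =>
      ((hemb.isEmbedding.toHomeomorph.symm x : Icc (0:ℝ) 1) : ℝ) :=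
    continuous_subtype_val.comp (Homeomorph.continuous _)
  rw [← hr]
  convert this using 1
  ext x
  obtain ⟨x, t, rfl⟩ := x
  have : (⟨(fun t : Icc (0:ℝ) 1 => γ t) t, mem_range_self t⟩ : range (fun t : Icc (0:ℝ) 1 => γ t)) =
      hemb.isEmbedding.toHomeomorph t := rfl
  rw [this, Homeomorph.symm_apply_apply]
  exact h2.leftInvOn_invFunOn t.2

end arcBasic

theorem logOn_arc {S : Set ℂ} {a b p : ℂ} (h : IsArc S a b) (hp : p ∉ S) :
    LogOn S (fun z => z - p) := by
  obtain ⟨γ, h1, h2, h3, h4, rfl⟩ := h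
  obtain ⟨δ, hδ, hδ'⟩ := arc_inv h1 h2
  have hc : Continuous fun t : ℝ => γ (max 0 (min 1 t)) - p := by
    apply Continuous.sub _ continuous_const
    apply h1.comp_continuous (by fun_prop)
    intro t
    exact ⟨le_max_left _ _, max_le (by norm_num) (min_le_left _ _)⟩
  obtain ⟨g, hg, hg'⟩ := exists_log_global _ hc (by
    intro t h0
    apply hp
    rw [sub_eq_zero] at h0
    exact ⟨_, ⟨le_max_left _ _, max_le (by norm_num) (min_le_left _ _)⟩, h0⟩)
  refine ⟨fun z => g (δ z), hg.comp_continuousOn hδ, ?_⟩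
  rintro _ ⟨t, ht, rfl⟩
  beta_reduce
  rw [hδ' t ht, ← hg', min_eq_right ht.2, max_eq_right ht.1]

theorem con_compl_arcC {S : Set ℂ} {a b p q : ℂ} (h : IsArc S a b) (hp : p ∉ S) (hq : q ∉ S) :
    Con Sᶜ p q := by
  apply con_of_logOn h.isCompact hp hq
  obtain ⟨f, hf, hf'⟩ := logOn_arc h hp
  obtain ⟨g, hg, hg'⟩ := logOn_arc h hq
  refine ⟨fun z => f z - g z, hf.sub hg, fun z hz => ?_⟩
  have e1 := hf' z hz
  have e2 := hg' z hz
  beta_reduce at e1 e2 ⊢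
  rw [exp_sub, ← e1, ← e2]

/-- Gluing logarithms on a compact set and an arc meeting in its two ends. -/
theorem glue_arc {K e : Set ℂ} (hK : IsClosed K) {a b : ℂ} (he : IsArc e a b)
    (hinter : K ∩ e = {a, b}) {f g h : ℂ → ℂ} (hg : ContinuousOn g K) (hh : ContinuousOn h e)
    (hgK : ∀ z ∈ K, f z = exp (g z)) (hhe : ∀ z ∈ e, f z = exp (h z))
    (hab : g a - h a = g b - h b) : LogOn (K ∪ e) f := by
  have haK : a ∈ K ∩ e := by rw [hinter]; simp
  obtain ⟨k, hk, hk1, hk2⟩ := glue_continuousOn hK he.isClosed hg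
    (hh.add (continuousOn_const (c := g a - h a))) (by
      intro z hz
      rw [hinter] at hz
      simp only [Pi.add_apply]
      rcases hz with rfl | hz
      · ring
      · rw [mem_singleton_iff] at hz
        subst hz
        rw [hab]; ring)
  refine ⟨k, hk, ?_⟩
  have e1 : exp (g a - h a) = 1 := by
    rw [exp_sub, ← hgK a haK.1, ← hhe a haK.2, div_self]
    rw [hgK a haK.1]; exact exp_ne_zero _
  rintro z (hz | hz)
  · rw [hk1 z hz, hgK z hz]
  · rw [hk2 z hz, hhe z hz, Pi.add_apply, exp_add, e1, mul_one]

/-- An arc attached at its ends cuts a component in at most two pieces (complex plane). -/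
theorem threeC {K e : Set ℂ} (hK : IsCompact K) {a b : ℂ} (he : IsArc e a b)
    (hinter : K ∩ e ⊆ {a, b}) {p₁ p₂ p₃ : ℂ} (h1 : p₁ ∉ e) (h2 : p₂ ∉ e) (h3 : p₃ ∉ e)
    (h12 : Con Kᶜ p₁ p₂) (h13 : Con Kᶜ p₁ p₃) :
    Con (K ∪ e)ᶜ p₁ p₂ ∨ Con (K ∪ e)ᶜ p₁ p₃ ∨ Con (K ∪ e)ᶜ p₂ p₃ := by
  by_cases hpre : IsPreconnected (K ∩ e)
  · exact Or.inl (janC hK he.isCompact hpre h12 (con_compl_arcC he h1 h2))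
  have hinter' : K ∩ e = {a, b} := by
    apply hinter.antisymm
    by_contra hc
    apply hpre
    apply Set.Subsingleton.isPreconnected
    intro x hx y hy
    have := hinter hx
    have := hinter hy
    by_contra hxy
    apply hc
    simp only [mem_insert_iff, mem_singleton_iff] at *
    rintro z (rfl | rfl)
    · rcases hinter hx with rfl | h
      · exact hx
      · rcases hinter hy with rfl | h'
        · exact hy
        · exact absurd (h.trans h'.symm) hxy
    · rcases hinter hx with h | h
      · rcases hinter hy with h' | h'
        · exact absurd (h.trans h'.symm) hxy
        · rw [mem_singleton_iff] at h'; subst h'; exact hy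
      · rw [mem_singleton_iff] at h; subst h; exact hx
  by_contra hcon
  push Not at hcon
  obtain ⟨n12, n13, n23⟩ := hcon
  have hne : ∀ p, p ∉ K → p ∉ e → p ∉ K ∪ e := fun p h h' h'' => h''.elim h h'
  have q1 := hne p₁ h12.mem_left h1
  have q2 := hne p₂ h12.mem_right h2
  have q3 := hne p₃ h13.mem_right h3
  have haK : a ∈ K ∩ e := by rw [hinter']; simp
  have hbK : b ∈ K ∩ e := by rw [hinter']; simp
  have obs : ∀ p q, p ∉ e → q ∉ e → Con Kᶜ p q → ∃ (g h : ℂ → ℂ) (n : ℤ), ContinuousOn g K ∧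
      ContinuousOn h e ∧ (∀ z ∈ K, (z - p) / (z - q) = exp (g z)) ∧
      (∀ z ∈ e, (z - p) / (z - q) = exp (h z)) ∧
      (g a - h a) - (g b - h b) = n * (2 * Real.pi * I) := by
    intro p q hp hq hpq
    obtain ⟨g, hg, hg'⟩ := logOn_of_con hK.isClosed hpq
    obtain ⟨h, hh, hh'⟩ := logOn_of_con he.isClosed (con_compl_arcC he hp hq)
    obtain ⟨n, hn⟩ := Complex.exp_eq_exp_iff_exists_int.1 ((hg' a haK.1).symm.trans (hh' a haK.2))
    obtain ⟨m, hm⟩ := Complex.exp_eq_exp_iff_exists_int.1 ((hg' b hbK.1).symm.trans (hh' b hbK.2))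
    refine ⟨g, h, n - m, hg, hh, hg', hh', ?_⟩
    rw [hn, hm]; push_cast; ring
  obtain ⟨g, h, n, hg, hh, hg', hh', hn⟩ := obs p₁ p₂ h1 h2 h12
  obtain ⟨g₁, h₁, m, hg₁, hh₁, hg₁', hh₁', hm⟩ := obs p₁ p₃ h1 h3 h13
  have hn0 : n ≠ 0 := by
    rintro rfl
    apply n12
    apply con_of_logOn (hK.union he.isCompact) q1 q2
    exact glue_arc hK.isClosed he hinter' hg hh hg' hh' (by
      rw [← sub_eq_zero, hn]; simp)
  have hlog : LogOn (K ∪ e) (fun z => ((z - p₁) / (z - p₂)) ^ m * ((z - p₁) / (z - p₃)) ^ (-n)) := by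
    refine glue_arc hK.isClosed he hinter' (g := fun z => m * g z + (-n : ℤ) * g₁ z)
      (h := fun z => m * h z + (-n : ℤ) * h₁ z)
      (by fun_prop) (by fun_prop) ?_ ?_ ?_
    · intro z hz
      rw [exp_add, exp_int_mul, exp_int_mul, ← hg' z hz, ← hg₁' z hz]
    · intro z hz
      rw [exp_add, exp_int_mul, exp_int_mul, ← hh' z hz, ← hh₁' z hz]
    · push_cast
      linear_combination (m : ℂ) * hn - (n : ℂ) * hm
  have := prod_log_zero (hK.union he.isCompact) (Finset.univ : Finset (Fin 3)) ![p₁, p₂, p₃]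
    ![m - n, -m, n] (by
      intro i _
      fin_cases i <;> assumption)
    (by
      intro i _ j _ hij
      fin_cases i <;> fin_cases j <;> first | exact absurd rfl hij | skip
      · exact n12
      · exact n13
      · exact fun h => n12 h.symm
      · exact n23
      · exact fun h => n13 h.symm
      · exact fun h => n23 h.symm)
    (by simp [Fin.sum_univ_three]; ring)
    (by
      obtain ⟨k, hk, hk'⟩ := hlog
      refine ⟨k, hk, fun z hz => ?_⟩
      rw [← hk' z hz]
      have r1 : z - p₁ ≠ 0 := fun h0 => q1 (by rw [sub_eq_zero] at h0; exact h0 ▸ hz)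
      have r2 : z - p₂ ≠ 0 := fun h0 => q2 (by rw [sub_eq_zero] at h0; exact h0 ▸ hz)
      have r3 : z - p₃ ≠ 0 := fun h0 => q3 (by rw [sub_eq_zero] at h0; exact h0 ▸ hz)
      simp only [Fin.prod_univ_three, Matrix.cons_val_zero, Matrix.cons_val_one, Matrix.cons_val]
      rw [div_zpow, div_zpow, zpow_sub₀ r1]
      simp only [zpow_neg]
      field_simp)
  exact hn0 (by simpa using this 2 (Finset.mem_univ _))

/-! ### Transfer to `ℝ × ℝ` -/

/-- The plane. -/
abbrev Pl := ℝ × ℝ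

/-- identification of the complex plane with `ℝ × ℝ`. -/
noncomputable def hom : Pl ≃ₜ ℂ := Complex.equivRealProdCLM.toHomeomorph.symm

theorem con_hom {O : Set Pl} {p q : Pl} : Con Oᶜ p q ↔ Con (hom '' O)ᶜ (hom p) (hom q) := by
  rw [← con_image hom, image_compl_eq hom.bijective]

theorem jan {A B : Set Pl} (hA : IsCompact A) (hB : IsCompact B) (hAB : IsPreconnected (A ∩ B))
    {p q : Pl} (h1 : Con Aᶜ p q) (h2 : Con Bᶜ p q) : Con (A ∪ B)ᶜ p q := by
  rw [con_hom] at *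
  rw [image_union]
  refine janC (hA.image hom.continuous) (hB.image hom.continuous) ?_ h1 h2
  rw [← image_inter hom.injective]
  exact hAB.image _ hom.continuous.continuousOn

theorem con_compl_arc {S : Set Pl} {a b p q : Pl} (h : IsArc S a b) (hp : p ∉ S) (hq : q ∉ S) :
    Con Sᶜ p q := by
  rw [con_hom]
  exact con_compl_arcC (h.image hom) (by simpa using hp) (by simpa using hq)

theorem three {K e : Set Pl} (hK : IsCompact K) {a b : Pl} (he : IsArc e a b)
    (hinter : K ∩ e ⊆ {a, b}) {p₁ p₂ p₃ : Pl} (h1 : p₁ ∉ e) (h2 : p₂ ∉ e) (h3 : p₃ ∉ e)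
    (h12 : Con Kᶜ p₁ p₂) (h13 : Con Kᶜ p₁ p₃) :
    Con (K ∪ e)ᶜ p₁ p₂ ∨ Con (K ∪ e)ᶜ p₁ p₃ ∨ Con (K ∪ e)ᶜ p₂ p₃ := by
  simp only [con_hom, image_union] at *
  refine threeC (hK.image hom.continuous) (he.image hom) ?_ (by simpa using h1) (by simpa using h2)
    (by simpa using h3) h12 h13
  rw [← image_inter hom.injective, ← image_pair]
  exact image_mono hinter

theorem con_meets_sphere {C : Set Pl} (hC : IsPreconnected C) {a x y : Pl} {r : ℝ} (hx : x ∈ C)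
    (hy : y ∈ C) (h1 : dist x a ≤ r) (h2 : r ≤ dist y a) : ∃ z ∈ C, dist z a = r := by
  have : IsPreconnected ((fun z => dist z a) '' C) := hC.image _ (by fun_prop)
  obtain ⟨z, hz, h⟩ := this.ordConnected.out (mem_image_of_mem _ hx) (mem_image_of_mem _ hy) ⟨h1, h2⟩
  exact ⟨z, hz, h⟩

theorem one_lt_rank_Pl : 1 < Module.rank ℝ Pl := by
  rw [rank_prod]
  simp only [Module.rank_self, Cardinal.lift_one]
  norm_num

/-- A punctured ball is connected. -/
theorem con_punctured {p x y : Pl} {r : ℝ} (hx : x ∈ Metric.ball p r) (hy : y ∈ Metric.ball p r)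
    (hxp : x ≠ p) (hyp : y ≠ p) : Con (Metric.ball p r \ {p}) x y := by
  have h : Con ({p} ∪ Metric.sphere p r)ᶜ x y := by
    refine jan isCompact_singleton (isCompact_sphere p r) ?_ ?_ ?_
    · apply Set.Subsingleton.isPreconnected
      exact subsingleton_singleton.anti inter_subset_left
    · exact ⟨_, (isConnected_compl_singleton_of_one_lt_rank one_lt_rank_Pl p).isPreconnected,
        subset_rfl, hxp, hyp⟩
    · refine ⟨Metric.ball p r, (convex_ball _ _).isPreconnected, ?_, hx, hy⟩
      intro z hz hz'
      rw [Metric.mem_ball] at hz; rw [Metric.mem_sphere] at hz'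
      linarith
  obtain ⟨C, h1, h2, h3, h4⟩ := h
  refine ⟨C, h1, fun z hz => ⟨?_, fun h => h2 hz (Or.inl h)⟩, h3, h4⟩
  by_contra hzb
  obtain ⟨w, hw, hw'⟩ := con_meets_sphere h1 h3 hz (a := p) (r := r) (by simpa using (Metric.mem_ball.1 hx).le)
    (by simpa using hzb)
  exact h2 hw (Or.inr hw')

theorem interior_arc {S : Set Pl} {a b : Pl} (h : IsArc S a b) : interior S = ∅ := by
  by_contra hne
  obtain ⟨c, hc⟩ := nonempty_iff_ne_empty.2 hne
  obtain ⟨r, hr, hb⟩ := Metric.mem_nhds_iff.1 (mem_interior_iff_mem_nhds.1 hc)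
  obtain ⟨γ, h1, h2, h3, h4, rfl⟩ := h
  obtain ⟨δ, hδ, hδ'⟩ := arc_inv h1 h2
  have hinj : InjOn δ (γ '' Icc 0 1) := by
    rintro _ ⟨s, hs, rfl⟩ _ ⟨t, ht, rfl⟩ hst
    rw [hδ' s hs, hδ' t ht] at hst
    rw [hst]
  -- three points in a small ball
  have key : ∀ x y z : Pl, x ∈ Metric.ball c (r / 2) → y ∈ Metric.ball c (r / 2) →
      z ∈ Metric.ball c (r / 2) → δ x < δ y → δ y < δ z → False := by
    intro x y z hx hy hz hxy hyz
    have hyb : Metric.ball y (r / 2) ⊆ Metric.ball c r := by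
      intro w hw
      simp only [Metric.mem_ball] at *
      linarith [dist_triangle w y c]
    have hyy : Metric.ball c (r / 2) ⊆ Metric.ball c r := Metric.ball_subset_ball (by linarith)
    -- use the large ball punctured at y: connect through the sup over preconnected set
    have hcon : Con (Metric.ball c r \ {y}) x z := by
      have h : Con ({y} ∪ Metric.sphere c r)ᶜ x z := by
        refine jan isCompact_singleton (isCompact_sphere c r) ?_ ?_ ?_
        · exact (subsingleton_singleton.anti inter_subset_left).isPreconnected
        · refine ⟨_, (isConnected_compl_singleton_of_one_lt_rank one_lt_rank_Pl y).isPreconnected,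
            subset_rfl, ?_, ?_⟩
          · rintro rfl; exact lt_irrefl _ hxy
          · rintro rfl; exact lt_irrefl _ hyz
        · refine ⟨Metric.ball c r, (convex_ball _ _).isPreconnected, ?_, hyy hx, hyy hz⟩
          intro z hz hz'
          rw [Metric.mem_ball] at hz; rw [Metric.mem_sphere] at hz'
          linarith
      obtain ⟨C, h1, h2, h3, h4⟩ := h
      refine ⟨C, h1, fun z hz => ⟨?_, fun h => h2 hz (Or.inl h)⟩, h3, h4⟩
      by_contra hzb
      obtain ⟨w, hw, hw'⟩ := con_meets_sphere h1 h3 hz (a := c) (r := r)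
        (by simpa using (Metric.mem_ball.1 (hyy hx)).le) (by simpa using hzb)
      exact h2 hw (Or.inr hw')
    obtain ⟨C, hC, hCs, hxC, hzC⟩ := hcon
    have hCS : C ⊆ γ '' Icc 0 1 := fun w hw => hb (hCs hw).1
    have him : IsPreconnected (δ '' C) := hC.image _ (hδ.mono hCS)
    obtain ⟨w, hw, hw'⟩ := him.ordConnected.out (mem_image_of_mem _ hxC) (mem_image_of_mem _ hzC)
      ⟨hxy.le, hyz.le⟩
    exact (hCs hw).2 (hinj (hCS hw) (hb (hyy hy)) hw')
  have hpt : ∀ s : ℝ, 0 ≤ s → s < r / 2 → c + (s, 0) ∈ Metric.ball c (r / 2) := by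
    intro s hs hs'
    simp [dist_eq_norm, Prod.norm_def, abs_of_nonneg hs, hs', hr]
  have hm : ∀ s : ℝ, 0 ≤ s → s < r / 2 → c + (s, 0) ∈ γ '' Icc 0 1 := fun s hs hs' =>
    hb (Metric.ball_subset_ball (by linarith) (hpt s hs hs'))
  have hd : ∀ s t : ℝ, 0 ≤ s → s < r / 2 → 0 ≤ t → t < r / 2 → s ≠ t →
      δ (c + (s, 0)) ≠ δ (c + (t, 0)) := by
    intro s t hs hs' ht ht' hst h
    have := hinj (hm s hs hs') (hm t ht ht') h
    simp at this
    exact hst this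
  have p0 := hpt 0 le_rfl (by linarith)
  have p1 := hpt (r / 8) (by linarith) (by linarith)
  have p2 := hpt (r / 4) (by linarith) (by linarith)
  have d01 := hd 0 (r / 8) le_rfl (by linarith) (by linarith) (by linarith) (by linarith)
  have d02 := hd 0 (r / 4) le_rfl (by linarith) (by linarith) (by linarith) (by linarith)
  have d12 := hd (r / 8) (r / 4) (by linarith) (by linarith) (by linarith) (by linarith) (by linarith)
  rcases lt_or_gt_of_ne d01 with a | a <;> rcases lt_or_gt_of_ne d02 with b | b <;>
    rcases lt_or_gt_of_ne d12 with d | d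
  · exact key _ _ _ p0 p1 p2 a d
  · exact key _ _ _ p0 p2 p1 b d
  · linarith
  · exact key _ _ _ p2 p0 p1 b a
  · exact key _ _ _ p1 p0 p2 a b
  · linarith
  · exact key _ _ _ p1 p2 p0 d b
  · exact key _ _ _ p2 p1 p0 d a

theorem exists_compact_conn {O T : Set Pl} (hO : IsOpen O) (hOc : IsPreconnected O)
    (hT : IsCompact T) (hTO : T ⊆ O) :
    ∃ Q, IsCompact Q ∧ IsPreconnected Q ∧ Q ⊆ O ∧ T ⊆ Q := by
  rcases O.eq_empty_or_nonempty with rfl | ⟨o, ho⟩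
  · exact ⟨∅, isCompact_empty, isPreconnected_empty, subset_rfl, hTO⟩
  have hpc : IsPathConnected O := (hO.isConnected_iff_isPathConnected).1 ⟨⟨o, ho⟩, hOc⟩
  suffices ∃ Q, IsCompact Q ∧ IsPreconnected Q ∧ Q ⊆ O ∧ o ∈ Q ∧ T ⊆ Q by
    obtain ⟨Q, h1, h2, h3, h4, h5⟩ := this
    exact ⟨Q, h1, h2, h3, h5⟩
  refine hT.induction_on (p := fun s => ∃ Q, IsCompact Q ∧ IsPreconnected Q ∧ Q ⊆ O ∧ o ∈ Q ∧ s ⊆ Q)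
    ?_ ?_ ?_ ?_
  · exact ⟨{o}, isCompact_singleton, isPreconnected_singleton, by simpa using ho, rfl, empty_subset _⟩
  · rintro s t hst ⟨Q, h1, h2, h3, h4, h5⟩
    exact ⟨Q, h1, h2, h3, h4, hst.trans h5⟩
  · rintro s t ⟨Q, h1, h2, h3, h4, h5⟩ ⟨Q', h1', h2', h3', h4', h5'⟩
    exact ⟨Q ∪ Q', h1.union h1', IsPreconnected.union o h4 h4' h2 h2', union_subset h3 h3', Or.inl h4,
      union_subset_union h5 h5'⟩
  · intro x hx
    obtain ⟨r, hr, hb⟩ := Metric.nhds_basis_closedBall.mem_iff.1 (hO.mem_nhds (hTO hx))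
    obtain ⟨γ, hγ⟩ := hpc.joinedIn o ho x (hTO hx)
    refine ⟨Metric.closedBall x r, mem_nhdsWithin_of_mem_nhds (Metric.closedBall_mem_nhds x hr),
      range γ ∪ Metric.closedBall x r, (isCompact_range γ.continuous).union (isCompact_closedBall x r),
      IsPreconnected.union x ⟨1, by simp⟩ (Metric.mem_closedBall_self hr.le)
        (isPreconnected_range γ.continuous) (convex_closedBall _ _).isPreconnected, ?_, Or.inl ⟨0, by simp⟩,
        subset_union_right⟩
    apply union_subset _ hb
    rintro _ ⟨t, rfl⟩
    exact hγ t

/-- Two continua meeting in exactly two points separate the plane. -/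
theorem sep_two {A B : Set Pl} (hA : IsCompact A) (hB : IsCompact B) (hAc : IsPreconnected A)
    (hBc : IsPreconnected B) {a b : Pl} (hab : a ≠ b) (hinter : A ∩ B = {a, b}) :
    ¬ IsPreconnected (A ∪ B)ᶜ := by
  intro hpre
  have haA : a ∈ A ∩ B := by rw [hinter]; simp
  have hbA : b ∈ A ∩ B := by rw [hinter]; simp
  have hO : IsOpen (A ∪ B)ᶜ := (hA.union hB).isClosed.isOpen_compl
  set r := dist b a / 2 with hr
  have hd : 0 < dist b a := dist_pos.2 hab.symm
  set C := Metric.sphere a r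
  have hCA : ∀ z ∈ C, z ∈ A → z ∈ B → False := by
    intro z hz h1 h2
    have : z ∈ A ∩ B := ⟨h1, h2⟩
    rw [hinter] at this
    have hz' : dist z a = r := hz
    rcases this with rfl | h
    · rw [dist_self] at hz'; linarith
    · rw [mem_singleton_iff] at h; subst h; linarith
  set C1 := {z ∈ C | Metric.infDist z B ≤ Metric.infDist z A} with hC1
  set C2 := {z ∈ C | Metric.infDist z A ≤ Metric.infDist z B} with hC2
  have hC : IsCompact C := isCompact_sphere a r
  have c1 : IsCompact C1 := hC.inter_right (isClosed_le (Metric.continuous_infDist_pt B)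
    (Metric.continuous_infDist_pt A))
  have c2 : IsCompact C2 := hC.inter_right (isClosed_le (Metric.continuous_infDist_pt A)
    (Metric.continuous_infDist_pt B))
  have memA : ∀ z, Metric.infDist z A ≤ 0 → z ∈ A := fun z hz =>
    (hA.isClosed.mem_iff_infDist_zero ⟨a, haA.1⟩).2 (le_antisymm hz Metric.infDist_nonneg)
  have memB : ∀ z, Metric.infDist z B ≤ 0 → z ∈ B := fun z hz =>
    (hB.isClosed.mem_iff_infDist_zero ⟨a, haA.2⟩).2 (le_antisymm hz Metric.infDist_nonneg)
  have h1A : ∀ z ∈ C1, z ∉ A := by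
    intro z hz hzA
    refine hCA z hz.1 hzA (memB z ?_)
    rw [← Metric.infDist_zero_of_mem hzA]; exact hz.2
  have h2B : ∀ z ∈ C2, z ∉ B := by
    intro z hz hzB
    refine hCA z hz.1 (memA z ?_) hzB
    rw [← Metric.infDist_zero_of_mem hzB]; exact hz.2
  obtain ⟨Q, hQ1, hQ2, hQ3, hQ4⟩ := exists_compact_conn hO hpre (c1.inter c2) (by
    intro z hz hz'
    rcases hz' with h | h
    · exact h1A z hz.1 h
    · exact h2B z hz.2 h)
  have hj : Con ((C1 ∪ Q) ∪ (C2 ∪ Q))ᶜ a b := by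
    refine jan (c1.union hQ1) (c2.union hQ1) ?_ ?_ ?_
    · rw [← inter_union_distrib_right, union_eq_self_of_subset_left hQ4]
      exact hQ2
    · refine ⟨A, hAc, ?_, haA.1, hbA.1⟩
      rintro z hz (h | h)
      · exact h1A z h hz
      · exact hQ3 h (Or.inl hz)
    · refine ⟨B, hBc, ?_, haA.2, hbA.2⟩
      rintro z hz (h | h)
      · exact h2B z h hz
      · exact hQ3 h (Or.inr hz)
  obtain ⟨D, hD, hDs, haD, hbD⟩ := hj
  obtain ⟨z, hz, hzr⟩ := con_meets_sphere hD haD hbD (a := a) (r := r) (by simp; linarith)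
    (by linarith)
  apply hDs hz
  rcases le_total (Metric.infDist z A) (Metric.infDist z B) with h | h
  · exact Or.inr (Or.inl ⟨hzr, h⟩)
  · exact Or.inl (Or.inl ⟨hzr, h⟩)

end PT

namespace PT
open Topology

section arcs
variable {X : Type*} [TopologicalSpace X] [T2Space X] {S T : Set X} {a b z p q : X}

theorem IsArc.concat (h : IsArc S a z) (h' : IsArc T z b) (hST : S ∩ T ⊆ {z}) : IsArc (S ∪ T) a b := by
  obtain ⟨f, f1, f2, rfl, f4, rfl⟩ := h
  obtain ⟨g, g1, g2, g3, rfl, rfl⟩ := h'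
  have m1 : MapsTo (fun t : ℝ => 2 * t) (Icc 0 (1 / 2)) (Icc 0 1) := by
    intro t ht; constructor <;> linarith [ht.1, ht.2]
  have m2 : MapsTo (fun t : ℝ => 2 * t - 1) (Icc (1 / 2) 1) (Icc 0 1) := by
    intro t ht; constructor <;> linarith [ht.1, ht.2]
  obtain ⟨k, hk, hk1, hk2⟩ := glue_continuousOn (A := Icc (0:ℝ) (1 / 2)) (B := Icc (1 / 2 : ℝ) 1)
    isClosed_Icc isClosed_Icc
    (f1.comp (by fun_prop) m1) (g1.comp (by fun_prop) m2) (by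
      rintro t ⟨⟨h1, h2⟩, h3, h4⟩
      have : t = 1 / 2 := le_antisymm h2 h3
      subst this
      simp [f4, g3])
  have hu : Icc (0:ℝ) (1 / 2) ∪ Icc (1 / 2) 1 = Icc 0 1 :=
    Icc_union_Icc_eq_Icc (by norm_num) (by norm_num)
  rw [hu] at hk
  have key : ∀ s ∈ Icc (0:ℝ) (1 / 2), ∀ t ∈ Icc (1 / 2 : ℝ) 1, k s = k t → s = t := by
    intro s hs t ht hst
    have e1 := hk1 s hs
    have e2 := hk2 t ht
    have hz : k s ∈ f '' Icc 0 1 ∩ g '' Icc 0 1 := ⟨⟨_, m1 hs, e1.symm⟩, ⟨_, m2 ht, by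
      rw [hst, e2]; rfl⟩⟩
    have hz' := hST hz
    rw [mem_singleton_iff] at hz'
    have a1 : 2 * s = 1 := f2 (m1 hs) (by simp) (by rw [f4, ← hz', e1]; rfl)
    have a2 : 2 * t - 1 = 0 := g2 (m2 ht) (by simp) (by rw [g3, ← hz', hst, e2]; rfl)
    linarith
  refine ⟨k, hk, ?_, ?_, ?_, ?_⟩
  · intro s hs t ht hst
    rw [← hu] at hs ht
    rcases hs with hs | hs <;> rcases ht with ht | ht
    · rw [hk1 s hs, hk1 t ht] at hst
      have := f2 (m1 hs) (m1 ht) hst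
      simpa using this
    · exact key s hs t ht hst
    · exact (key t ht s hs hst.symm).symm
    · rw [hk2 s hs, hk2 t ht] at hst
      have := g2 (m2 hs) (m2 ht) hst
      simpa using this
  · rw [hk1 0 (by norm_num)]; simp
  · rw [hk2 1 (by norm_num)]; norm_num
  · have hku : k '' Icc (0:ℝ) 1 = k '' Icc 0 (1 / 2) ∪ k '' Icc (1 / 2) 1 := by
      rw [← image_union, hu]
    rw [hku]
    congr 1
    · ext x; constructor
      · rintro ⟨t, ht, rfl⟩
        exact ⟨t / 2, ⟨by linarith [ht.1], by linarith [ht.2]⟩, by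
          rw [hk1 _ ⟨by linarith [ht.1], by linarith [ht.2]⟩]
          simp only [Function.comp]; congr 1; ring⟩
      · rintro ⟨t, ht, rfl⟩
        exact ⟨_, m1 ht, (hk1 t ht).symm⟩
    · ext x; constructor
      · rintro ⟨t, ht, rfl⟩
        exact ⟨(t + 1) / 2, ⟨by linarith [ht.1], by linarith [ht.2]⟩, by
          rw [hk2 _ ⟨by linarith [ht.1], by linarith [ht.2]⟩]
          simp only [Function.comp]; congr 1; ring⟩
      · rintro ⟨t, ht, rfl⟩
        exact ⟨_, m2 ht, (hk2 t ht).symm⟩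

theorem IsArc.split (h : IsArc S a b) (hz : z ∈ S) (hza : z ≠ a) (hzb : z ≠ b) :
    ∃ S₁ S₂, IsArc S₁ a z ∧ IsArc S₂ z b ∧ S₁ ∪ S₂ = S ∧ S₁ ∩ S₂ = {z} := by
  obtain ⟨f, f1, f2, rfl, rfl, rfl⟩ := h
  obtain ⟨t, ht, rfl⟩ := hz
  have h0 : 0 < t := lt_of_le_of_ne ht.1 (by rintro rfl; exact hza rfl)
  have h1 : t < 1 := lt_of_le_of_ne ht.2 (by rintro rfl; exact hzb rfl)
  refine ⟨_, _, isArc_piece f1 f2 le_rfl h0 h1.le, isArc_piece f1 f2 h0.le h1 le_rfl, ?_, ?_⟩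
  · rw [← image_union, Icc_union_Icc_eq_Icc h0.le h1.le]
  · rw [← f2.image_inter (Icc_subset_Icc_right h1.le) (Icc_subset_Icc_left h0.le)]
    rw [Icc_inter_Icc]
    simp [h0.le, h1.le]

/-- A short initial piece of an arc. -/
theorem IsArc.initial (h : IsArc S a b) {U : Set X} (hU : U ∈ 𝓝 a) :
    ∃ z S₁ S₂, IsArc S₁ a z ∧ IsArc S₂ z b ∧ S₁ ∪ S₂ = S ∧ S₁ ∩ S₂ = {z} ∧ S₁ ⊆ U ∧ z ≠ b := by
  obtain ⟨f, f1, f2, rfl, rfl, rfl⟩ := h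
  have hc : ContinuousWithinAt f (Icc 0 1) 0 := f1 0 (by simp)
  have hmem := hc hU
  rw [Filter.mem_map, mem_nhdsWithin_iff_exists_mem_nhds_inter] at hmem
  obtain ⟨u, hu, hus⟩ := hmem
  obtain ⟨ε, hε, hb⟩ := Metric.mem_nhds_iff.1 hu
  set t := min (ε / 2) (1 / 2) with htdef
  have t0 : 0 < t := by positivity
  have t1 : t < 1 := by
    have : t ≤ 1 / 2 := min_le_right _ _
    linarith
  have te : t < ε := by
    have : t ≤ ε / 2 := min_le_left _ _
    linarith
  refine ⟨f t, _, _, isArc_piece f1 f2 le_rfl t0 t1.le, isArc_piece f1 f2 t0.le t1 le_rfl, ?_, ?_, ?_, ?_⟩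
  · rw [← image_union, Icc_union_Icc_eq_Icc t0.le t1.le]
  · rw [← f2.image_inter (Icc_subset_Icc_right t1.le) (Icc_subset_Icc_left t0.le)]
    rw [Icc_inter_Icc]
    simp [t0.le, t1.le]
  · rintro _ ⟨s, hs, rfl⟩
    refine hus ⟨hb ?_, ⟨hs.1, hs.2.trans t1.le⟩⟩
    rw [Metric.mem_ball, Real.dist_eq, sub_zero, abs_of_nonneg hs.1]
    linarith [hs.2]
  · intro h
    have := f2 ⟨t0.le, t1.le⟩ (by simp) h
    linarith

theorem IsArc.first_hit (h : IsArc S a b) {C : Set X} (hC : IsClosed C) (hne : (S ∩ C).Nonempty)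
    (ha : a ∉ C) : ∃ w S', IsArc S' a w ∧ S' ⊆ S ∧ S' ∩ C = {w} := by
  obtain ⟨f, f1, f2, rfl, rfl, rfl⟩ := h
  have hcomp : IsCompact (Icc (0:ℝ) 1 ∩ f ⁻¹' C) :=
    isCompact_Icc.of_isClosed_subset (f1.preimage_isClosed_of_isClosed isClosed_Icc hC)
      inter_subset_left
  obtain ⟨_, ⟨t', ht', rfl⟩, htC⟩ := hne
  obtain ⟨t, ⟨ht, htC⟩, hmin⟩ := hcomp.exists_isLeast ⟨t', ht', htC⟩
  have t0 : 0 < t := lt_of_le_of_ne ht.1 (by rintro rfl; exact ha htC)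
  refine ⟨f t, _, isArc_piece f1 f2 le_rfl t0 ht.2, image_mono (Icc_subset_Icc_right ht.2), ?_⟩
  apply Subset.antisymm
  · rintro _ ⟨⟨s, hs, rfl⟩, hsC⟩
    have : t ≤ s := hmin ⟨⟨hs.1, hs.2.trans ht.2⟩, hsC⟩
    rw [mem_singleton_iff, le_antisymm hs.2 this]
  · rintro _ rfl
    exact ⟨⟨t, ⟨ht.1, le_rfl⟩, rfl⟩, htC⟩

theorem IsArc.headPart (h : IsArc S a b) (hz : z ∈ S) (hza : z ≠ a) : ∃ S', IsArc S' a z ∧ S' ⊆ S := by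
  by_cases hzb : z = b
  · exact ⟨S, hzb ▸ h, subset_rfl⟩
  · obtain ⟨S₁, S₂, h1, h2, h3, h4⟩ := h.split hz hza hzb
    exact ⟨S₁, h1, h3 ▸ subset_union_left⟩

theorem IsArc.suffix (h : IsArc S a b) (hz : z ∈ S) (hzb : z ≠ b) : ∃ S', IsArc S' z b ∧ S' ⊆ S := by
  obtain ⟨S', h1, h2⟩ := h.symm.headPart hz hzb
  exact ⟨S', h1.symm, h2⟩

theorem IsArc.splice (h : IsArc S p z) (h' : IsArc T z q) (hpq : p ≠ q) :
    ∃ R, IsArc R p q ∧ R ⊆ S ∪ T := by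
  by_cases hpT : p ∈ T
  · obtain ⟨R, h1, h2⟩ := h'.suffix hpT hpq
    exact ⟨R, h1, h2.trans subset_union_right⟩
  obtain ⟨w, S', h1, h2, h3⟩ := h.first_hit h'.isClosed ⟨z, h.right_mem, h'.left_mem⟩ hpT
  have hw : w ∈ S' ∩ T := by rw [h3]; rfl
  by_cases hwq : w = q
  · exact ⟨S', hwq ▸ h1, h2.trans subset_union_left⟩
  obtain ⟨T', g1, g2⟩ := h'.suffix hw.2 hwq
  exact ⟨S' ∪ T', h1.concat g1 (by rw [← h3]; exact inter_subset_inter_right _ g2),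
    union_subset_union h2 g2⟩

end arcs

theorem exists_arc_open {O : Set Pl} (hO : IsOpen O) (hOc : IsPreconnected O) {p q : Pl}
    (hp : p ∈ O) (hq : q ∈ O) (hpq : p ≠ q) : ∃ S, IsArc S p q ∧ S ⊆ O := by
  have : p = q ∨ ∃ S, IsArc S p q ∧ S ⊆ O := by
    refine hOc.induction₂ (fun p q => p = q ∨ ∃ S, IsArc S p q ∧ S ⊆ O) ?_ ?_ ?_ hp hq
    · intro x hx
      obtain ⟨r, hr, hb⟩ := Metric.mem_nhds_iff.1 (hO.mem_nhds hx)
      filter_upwards [mem_nhdsWithin_of_mem_nhds (Metric.ball_mem_nhds x hr)] with y hy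
      by_cases hxy : x = y
      · exact Or.inl hxy
      right
      refine ⟨_, ⟨AffineMap.lineMap (k := ℝ) x y, by fun_prop, ?_, by simp, by simp, rfl⟩, ?_⟩
      · exact (AffineMap.lineMap_injective ℝ hxy).injOn
      · rw [← segment_eq_image_lineMap]
        exact ((convex_ball x r).segment_subset (Metric.mem_ball_self hr) hy).trans hb
    · rintro x y w hx hy hw (rfl | ⟨S, hS, hSO⟩) (rfl | ⟨T, hT, hTO⟩)
      · exact Or.inl rfl
      · exact Or.inr ⟨T, hT, hTO⟩
      · exact Or.inr ⟨S, hS, hSO⟩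
      · by_cases hxw : x = w
        · exact Or.inl hxw
        · obtain ⟨R, h1, h2⟩ := hS.splice hT hxw
          exact Or.inr ⟨R, h1, h2.trans (union_subset hSO hTO)⟩
    · rintro x y hx hy (rfl | ⟨S, hS, hSO⟩)
      · exact Or.inl rfl
      · exact Or.inr ⟨S, hS.symm, hSO⟩
  exact this.resolve_left hpq

/-- Infinite concatenation of arcs converging to a point. -/
theorem arc_infinite {T : ℕ → Set Pl} {q : ℕ → Pl} {p : Pl}
    (hT : ∀ k, IsArc (T k) (q k) (q (k + 1))) (h1 : ∀ k, T k ∩ T (k + 1) ⊆ {q (k + 1)})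
    (h2 : ∀ k j, k + 2 ≤ j → Disjoint (T k) (T j)) (hp : ∀ k, p ∉ T k)
    (hlim : ∀ ε > 0, ∃ k₀, ∀ k ≥ k₀, T k ⊆ Metric.ball p ε) :
    IsArc (insert p (⋃ k, T k)) (q 0) p := by
  choose σ s1 s2 s3 s4 s5 using hT
  let Γ : ℝ → Pl := fun s => σ ⌊s⌋₊ (s - ⌊s⌋₊)
  have hfr : ∀ s : ℝ, 0 ≤ s → s - ⌊s⌋₊ ∈ Ico (0:ℝ) 1 := by
    intro s hs
    constructor
    · linarith [Nat.floor_le hs]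
    · linarith [Nat.lt_floor_add_one s]
  have hΓ : ∀ k : ℕ, ∀ s ∈ Icc (k : ℝ) (k + 1), Γ s = σ k (s - k) := by
    intro k s hs
    rcases eq_or_lt_of_le hs.2 with h | h
    · have : ⌊s⌋₊ = k + 1 := by rw [h]; exact_mod_cast Nat.floor_natCast (k + 1)
      simp only [Γ]
      rw [this, h]
      push_cast
      rw [sub_self, add_sub_cancel_left, s3, s4]
    · have : ⌊s⌋₊ = k := (Nat.floor_eq_iff (by linarith [hs.1, (Nat.cast_nonneg k : (0:ℝ) ≤ k)])).2 ⟨hs.1, h⟩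
      simp only [Γ]
      rw [this]
  have hΓmem : ∀ s : ℝ, 0 ≤ s → Γ s ∈ T ⌊s⌋₊ := by
    intro s hs
    rw [s5]
    exact ⟨_, ⟨(hfr s hs).1, (hfr s hs).2.le⟩, rfl⟩
  have hcont : ∀ k : ℕ, ContinuousOn Γ (Icc (0:ℝ) k) := by
    intro k
    induction k with
    | zero => simp
    | succ k ih =>
      have : Icc (0:ℝ) ((k + 1 : ℕ) : ℝ) = Icc (0:ℝ) k ∪ Icc (k : ℝ) (k + 1) := by
        rw [Icc_union_Icc_eq_Icc (Nat.cast_nonneg k) (by linarith)]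
        push_cast; rfl
      rw [this]
      apply ContinuousOn.union_of_isClosed ih _ isClosed_Icc isClosed_Icc
      refine ContinuousOn.congr ?_ (hΓ k)
      refine (s1 k).comp (by fun_prop) ?_
      intro s hs
      constructor <;> linarith [hs.1, hs.2]
  have hinj : ∀ s t : ℝ, 0 ≤ s → 0 ≤ t → s ≤ t → Γ s = Γ t → s = t := by
    intro s t hs ht hst h
    have hfl : ⌊s⌋₊ ≤ ⌊t⌋₊ := Nat.floor_mono hst
    rcases eq_or_lt_of_le hfl with e | e
    · simp only [Γ] at h
      rw [← e] at h
      have a1 := hfr s hs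
      have a2 := hfr t ht
      rw [← e] at a2
      have := s2 _ ⟨a1.1, a1.2.le⟩ ⟨a2.1, a2.2.le⟩ h
      linarith
    · exfalso
      have m1 := hΓmem s hs
      have m2 := hΓmem t ht
      rw [← h] at m2
      rcases Nat.lt_or_ge ⌊t⌋₊ (⌊s⌋₊ + 2) with e' | e'
      · have : ⌊t⌋₊ = ⌊s⌋₊ + 1 := by omega
        rw [this] at m2
        have hm := h1 _ ⟨m1, m2⟩
        rw [mem_singleton_iff, ← s4] at hm
        have a1 := hfr s hs
        have := s2 _ ⟨a1.1, a1.2.le⟩ (by simp) hm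
        linarith [a1.2]
      · exact disjoint_left.1 (h2 _ _ e') m1 m2
  let γ : ℝ → Pl := fun t => if t < 1 then Γ (t / (1 - t)) else p
  have hγ : ∀ t < 1, γ t = Γ (t / (1 - t)) := fun t ht => if_pos ht
  have hγ1 : γ 1 = p := if_neg (lt_irrefl _)
  have hpos : ∀ t : ℝ, 0 ≤ t → t < 1 → 0 ≤ t / (1 - t) := fun t h h' => div_nonneg h (by linarith)
  refine ⟨γ, ?_, ?_, ?_, hγ1, ?_⟩
  · intro t ht
    rcases eq_or_lt_of_le ht.2 with h | h
    · subst h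
      rw [ContinuousWithinAt, hγ1, Metric.nhds_basis_ball.tendsto_right_iff]
      intro ε hε
      obtain ⟨k₀, hk₀⟩ := hlim ε hε
      have hk1 : (0:ℝ) < (k₀ : ℝ) + 1 := by positivity
      have : Ioi (1 - 1 / ((k₀ : ℝ) + 1)) ∈ 𝓝 (1:ℝ) := Ioi_mem_nhds (by
        have : (0:ℝ) < 1 / ((k₀ : ℝ) + 1) := by positivity
        linarith)
      filter_upwards [mem_nhdsWithin_of_mem_nhds this, self_mem_nhdsWithin] with s hs hs'
      rcases eq_or_lt_of_le hs'.2 with h | h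
      · rw [h, hγ1]; exact Metric.mem_ball_self hε
      · rw [hγ s h]
        refine hk₀ _ ?_ (hΓmem _ (hpos s hs'.1 h))
        apply Nat.le_floor
        rw [le_div_iff₀ (by linarith)]
        have h3 : 1 - s < 1 / ((k₀ : ℝ) + 1) := by linarith [mem_Ioi.1 hs]
        rw [lt_div_iff₀ hk1] at h3
        nlinarith
    · obtain ⟨k, hk⟩ := exists_nat_gt (t / (1 - t))
      have hc : ContinuousOn (fun t : ℝ => t / (1 - t)) (Iio 1) :=
        ContinuousOn.div (by fun_prop) (by fun_prop) (fun x hx => by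
          have := mem_Iio.1 hx; linarith)
      have hca : ContinuousAt (fun t : ℝ => t / (1 - t)) t := hc.continuousAt (Iio_mem_nhds h)
      have hev : ∀ᶠ s : ℝ in 𝓝[Icc (0:ℝ) 1] t, s < 1 ∧ s / (1 - s) < (k : ℝ) ∧ 0 ≤ s := by
        filter_upwards [mem_nhdsWithin_of_mem_nhds (Iio_mem_nhds h),
          mem_nhdsWithin_of_mem_nhds (hca (Iio_mem_nhds hk)), self_mem_nhdsWithin] with s a1 a2 a3
        exact ⟨a1, a2, a3.1⟩
      have hΓc : ContinuousWithinAt Γ (Icc 0 k) (t / (1 - t)) := hcont k _ ⟨hpos t ht.1 h, hk.le⟩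
      have : Filter.Tendsto (fun s : ℝ => s / (1 - s)) (𝓝[Icc (0:ℝ) 1] t) (𝓝[Icc (0:ℝ) k] (t / (1 - t))) := by
        apply tendsto_nhdsWithin_of_tendsto_nhds_of_eventually_within
        · exact hca.continuousWithinAt
        · filter_upwards [hev] with s hs
          exact ⟨hpos s hs.2.2 hs.1, hs.2.1.le⟩
      have h4 := hΓc.tendsto.comp this
      rw [ContinuousWithinAt, hγ t h]
      refine h4.congr' ?_
      filter_upwards [hev] with s hs
      rw [hγ s hs.1]; rfl
  · have key : ∀ s t : ℝ, 0 ≤ s → s < 1 → 0 ≤ t → t < 1 → Γ (s / (1 - s)) = Γ (t / (1 - t)) → s = t := by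
      intro s t hs hs' ht ht' h
      have : s / (1 - s) = t / (1 - t) := by
        rcases le_total (s / (1 - s)) (t / (1 - t)) with h' | h'
        · exact hinj _ _ (hpos s hs hs') (hpos t ht ht') h' h
        · exact (hinj _ _ (hpos t ht ht') (hpos s hs hs') h' h.symm).symm
      have e1 : 1 - s ≠ 0 := by linarith
      have e2 : 1 - t ≠ 0 := by linarith
      field_simp at this
      linarith
    intro s hs t ht hst
    rcases eq_or_lt_of_le hs.2 with h | h <;> rcases eq_or_lt_of_le ht.2 with h' | h'
    · rw [h, h']
    · exfalso
      rw [h, hγ1, hγ t h'] at hst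
      exact hp _ (hst ▸ hΓmem _ (hpos t ht.1 h'))
    · exfalso
      rw [h', hγ1, hγ s h] at hst
      exact hp _ (hst ▸ hΓmem _ (hpos s hs.1 h))
    · rw [hγ s h, hγ t h'] at hst
      exact key s t hs.1 h ht.1 h' hst
  · rw [hγ 0 one_pos]
    have := hΓ 0 0 (by simp)
    simp only [zero_div, CharP.cast_eq_zero, sub_self, s3] at this ⊢
    exact this
  · ext x
    constructor
    · rintro (rfl | hx)
      · exact ⟨1, by simp, hγ1⟩
      · obtain ⟨k, hk⟩ := mem_iUnion.1 hx
        rw [s5] at hk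
        obtain ⟨u, hu, rfl⟩ := hk
        have hku : (0:ℝ) ≤ k + u := by
          have := (Nat.cast_nonneg k : (0:ℝ) ≤ k); linarith [hu.1]
        have hd : (0:ℝ) < 1 + (k + u) := by linarith
        refine ⟨(k + u) / (1 + (k + u)), ⟨by positivity, by rw [div_le_one hd]; linarith⟩, ?_⟩
        rw [hγ _ (by rw [div_lt_one hd]; linarith)]
        have : (k + u) / (1 + (k + u)) / (1 - (k + u) / (1 + (k + u))) = k + u := by
          have : 1 - (k + u) / (1 + (k + u)) = 1 / (1 + (k + u)) := by field_simp; ring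
          rw [this]; field_simp
        rw [this, hΓ k _ ⟨by linarith [hu.1], by linarith [hu.2]⟩]
        simp
    · rintro ⟨t, ht, rfl⟩
      rcases eq_or_lt_of_le ht.2 with h | h
      · rw [h, hγ1]; exact Or.inl rfl
      · rw [hγ t h]
        exact Or.inr (mem_iUnion.2 ⟨_, hΓmem _ (hpos t ht.1 h)⟩)

end PT

namespace PT
open Topology

/-- At most `M` classes of points of `B` in the complement of `K`. -/
def NC (K B : Set Pl) (M : ℕ) : Prop :=
  ∀ s : Finset Pl, (↑s : Set Pl) ⊆ B \ K → M < s.card → ∃ x ∈ s, ∃ y ∈ s, x ≠ y ∧ Con Kᶜ x y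

theorem NC.add_arc {K B e : Set Pl} {M : ℕ} (h : NC K B M) (hK : IsCompact K) {a b : Pl}
    (he : IsArc e a b) (hinter : K ∩ e ⊆ {a, b}) : NC (K ∪ e) B (M * 2) := by
  classical
  intro s hs hM
  let c : Pl → Set Pl := fun x => connectedComponentIn Kᶜ x
  have hsK : ∀ x ∈ s, x ∈ B ∧ x ∉ K ∧ x ∉ e := by
    intro x hx
    have := hs hx
    simp only [mem_sdiff, mem_union, not_or] at this
    exact this
  have hcard : (s.image c).card ≤ M := by
    by_contra hlt
    push Not at hlt
    obtain ⟨t, hts, hinj, himg⟩ : ∃ t ⊆ s, InjOn c t ∧ t.image c = s.image c := by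
      obtain ⟨t, h1, h2, h3⟩ := Finset.exists_subset_injOn_image_eq_of_surjOn (f := c) (↑s : Set Pl)
        (s.image c) (by rw [Finset.coe_image]; exact surjOn_image _ _)
      exact ⟨t, by exact_mod_cast h1, h2, h3⟩
    rw [← himg, Finset.card_image_of_injOn hinj] at hlt
    obtain ⟨x, hx, y, hy, hxy, hc⟩ := h t (fun x hx => ⟨(hsK x (hts hx)).1, (hsK x (hts hx)).2.1⟩) hlt
    exact hxy (hinj hx hy (connectedComponentIn_eq (con_iff.1 hc).2))
  have hlt : (s.image c).card * 2 < s.card := lt_of_le_of_lt (Nat.mul_le_mul_right _ hcard) hM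
  obtain ⟨y, hy, hfib⟩ := Finset.exists_lt_card_fiber_of_mul_lt_card_of_maps_to
    (f := c) (s := s) (t := s.image c) (fun x hx => Finset.mem_image_of_mem c hx) hlt
  obtain ⟨x₁, x₂, x₃, h1, h2, h3, h12, h13, h23⟩ := Finset.two_lt_card_iff.1 hfib
  simp only [Finset.mem_filter] at h1 h2 h3
  have hcon : ∀ x x', x ∈ s → x' ∈ s → c x = y → c x' = y → Con Kᶜ x x' := by
    intro x x' hx hx' e e'
    rw [con_iff]
    refine ⟨(hsK x hx).2.1, ?_⟩
    change x' ∈ c x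
    rw [e, ← e']
    exact mem_connectedComponentIn (hsK x' hx').2.1
  rcases three hK he hinter (hsK _ h1.1).2.2 (hsK _ h2.1).2.2 (hsK _ h3.1).2.2
    (hcon _ _ h1.1 h2.1 h1.2 h2.2) (hcon _ _ h1.1 h3.1 h1.2 h3.2) with h | h | h
  · exact ⟨_, h1.1, _, h2.1, h12, h⟩
  · exact ⟨_, h1.1, _, h3.1, h13, h⟩
  · exact ⟨_, h2.1, _, h3.1, h23, h⟩

/-- Local finiteness of the complement of `K` at `p`. -/
def LF (K : Set Pl) (p : Pl) : Prop :=
  ∀ r > 0, ∃ δ > 0, ∃ M : ℕ, ∀ s : Finset Pl, (↑s : Set Pl) ⊆ Metric.ball p δ \ K → M < s.card →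
    ∃ x ∈ s, ∃ y ∈ s, x ≠ y ∧ Con (Metric.ball p r \ K) x y

theorem lf_of_star {ι : Type*} [Finite ι] {R : Set Pl} {S : ι → Set Pl} {p : Pl} {q : ι → Pl}
    (hR : IsCompact R) (hp : p ∉ R) (hS : ∀ i, IsArc (S i) p (q i))
    (hSS : ∀ i j, i ≠ j → S i ∩ S j ⊆ {p}) (hSR : ∀ i, S i ∩ R ⊆ {q i}) :
    LF (R ∪ ⋃ i, S i) p := by
  classical
  intro r hr
  have := Fintype.ofFinite ι
  choose z A B hA hB hAB hABi hAr hzq using fun i => (hS i).initial (Metric.ball_mem_nhds p hr)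
  have hpB : ∀ i, p ∉ B i := by
    intro i hpB
    have : p ∈ A i ∩ B i := ⟨(hA i).left_mem, hpB⟩
    rw [hABi] at this
    exact (hA i).ne this
  let L : Set Pl := R ∪ (⋃ i, B i) ∪ Metric.sphere p r
  have hL : IsCompact L :=
    (hR.union (isCompact_iUnion fun i => (hB i).isCompact)).union (isCompact_sphere p r)
  have hpL : p ∉ L := by
    rintro ((h | h) | h)
    · exact hp h
    · obtain ⟨i, hi⟩ := mem_iUnion.1 h
      exact hpB i hi
    · rw [Metric.mem_sphere, dist_self] at h
      exact hr.ne h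
  obtain ⟨δ, hδ, hδL⟩ := Metric.mem_nhds_iff.1 (hL.isClosed.isOpen_compl.mem_nhds hpL)
  have hLi : ∀ t : Finset ι, IsCompact (L ∪ ⋃ i ∈ t, A i) := fun t =>
    hL.union (t.isCompact_biUnion fun i _ => (hA i).isCompact)
  have key : ∀ t : Finset ι, ∃ M, NC (L ∪ ⋃ i ∈ t, A i) (Metric.ball p δ) M := by
    intro t
    induction t using Finset.induction_on with
    | empty =>
      refine ⟨1, ?_⟩
      intro s hs hM
      obtain ⟨x, hx, y, hy, hxy⟩ := Finset.one_lt_card.1 hM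
      refine ⟨x, hx, y, hy, hxy, Metric.ball p δ, (convex_ball _ _).isPreconnected, ?_, (hs hx).1, (hs hy).1⟩
      simpa using hδL
    | insert i t hit ih =>
      obtain ⟨M, ih⟩ := ih
      refine ⟨M * 2, ?_⟩
      have := ih.add_arc (hLi t) (hA i) ?_
      · convert this using 1
        rw [Finset.set_biUnion_insert, union_comm (A i), ← union_assoc]
      · rintro x ⟨((( hx | hx) | hx) | hx), hxA⟩
        · exfalso
          have h1 : x ∈ S i ∩ R := ⟨by rw [← hAB]; exact Or.inl hxA, hx⟩
          have h2 := hSR i h1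
          rw [mem_singleton_iff] at h2
          have h3 : x ∈ A i ∩ B i := ⟨hxA, h2 ▸ (hB i).right_mem⟩
          rw [hABi, mem_singleton_iff] at h3
          exact hzq i (h3.symm.trans h2)
        · obtain ⟨j, hj⟩ := mem_iUnion.1 hx
          by_cases hji : i = j
          · subst hji
            have h3 : x ∈ A i ∩ B i := ⟨hxA, hj⟩
            rw [hABi] at h3
            exact Or.inr h3
          · left
            exact hSS i j hji ⟨by rw [← hAB]; exact Or.inl hxA, by rw [← hAB]; exact Or.inr hj⟩
        · exfalso
          have h1 := hAr i hxA
          rw [Metric.mem_ball] at h1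
          rw [Metric.mem_sphere] at hx
          exact h1.ne hx
        · simp only [mem_iUnion] at hx
          obtain ⟨j, hjt, hj⟩ := hx
          have hji : i ≠ j := by rintro rfl; exact hit hjt
          left
          exact hSS i j hji ⟨by rw [← hAB]; exact Or.inl hxA, by rw [← hAB]; exact Or.inl hj⟩
  obtain ⟨M, hM⟩ := key Finset.univ
  have hK : L ∪ ⋃ i ∈ (Finset.univ : Finset ι), A i = (R ∪ ⋃ i, S i) ∪ Metric.sphere p r := by
    ext x
    simp only [L, ← hAB, mem_union, mem_iUnion, Finset.mem_univ, exists_true_left]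
    constructor
    · rintro (((h | ⟨i, h⟩) | h) | ⟨i, h⟩)
      · tauto
      · exact Or.inl (Or.inr ⟨i, Or.inr h⟩)
      · tauto
      · exact Or.inl (Or.inr ⟨i, Or.inl h⟩)
    · rintro ((h | ⟨i, h | h⟩) | h)
      · tauto
      · exact Or.inr ⟨i, by simpa using h⟩
      · exact Or.inl (Or.inl (Or.inr ⟨i, h⟩))
      · tauto
  rw [hK] at hM
  refine ⟨min δ r, lt_min hδ hr, M, fun s hs hsM => ?_⟩
  have hs' : (↑s : Set Pl) ⊆ Metric.ball p δ \ ((R ∪ ⋃ i, S i) ∪ Metric.sphere p r) := by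
    intro x hx
    have h1 := hs hx
    refine ⟨Metric.ball_subset_ball (min_le_left _ _) h1.1, ?_⟩
    rintro (h | h)
    · exact h1.2 h
    · have := Metric.mem_ball.1 h1.1
      rw [Metric.mem_sphere] at h
      linarith [min_le_right δ r]
  obtain ⟨x, hx, y, hy, hxy, C, hC1, hC2, hC3, hC4⟩ := hM s hs' hsM
  refine ⟨x, hx, y, hy, hxy, C, hC1, ?_, hC3, hC4⟩
  intro w hw
  refine ⟨?_, fun h => hC2 hw (Or.inl h)⟩
  by_contra hwr
  rw [Metric.mem_ball, not_lt] at hwr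
  have hxr : dist x p ≤ r := by
    have := Metric.mem_ball.1 (hs hx).1
    linarith [min_le_right δ r]
  obtain ⟨v, hv, hvr⟩ := con_meets_sphere hC1 hC3 hw hxr hwr
  exact hC2 hv (Or.inr hvr)

/-- A connected open set accumulating at `p`, saturated near `p`. -/
structure Sat (K : Set Pl) (p : Pl) (W : Set Pl) : Prop where
  isOpen : IsOpen W
  conn : IsPreconnected W
  clos : p ∈ closure W
  disj : W ⊆ Kᶜ
  sat : ∃ ρ > 0, ∀ C : Set Pl, IsPreconnected C → C ⊆ Metric.ball p ρ \ K → (C ∩ W).Nonempty → C ⊆ W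

theorem Sat.step {K : Set Pl} {p : Pl} (hK : IsClosed K) (hlf : LF K p) {W : Set Pl} (h : Sat K p W)
    {ε : ℝ} (hε : 0 < ε) : ∃ W' ⊆ W, Sat K p W' ∧ W' ⊆ Metric.ball p ε := by
  classical
  obtain ⟨ρ, hρ, hsat⟩ := h.sat
  set r := min ρ ε with hr
  have hr0 : 0 < r := lt_min hρ hε
  obtain ⟨δ, hδ, M, hM⟩ := hlf r hr0
  have hOo : IsOpen (Metric.ball p r \ K) := Metric.isOpen_ball.sdiff hK
  let c : Pl → Set Pl := fun x => connectedComponentIn (Metric.ball p r \ K) x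
  by_cases hex : ∃ x ∈ W ∩ Metric.ball p r, p ∈ closure (c x)
  · obtain ⟨x, ⟨hxW, hxr⟩, hx⟩ := hex
    have hxO : x ∈ Metric.ball p r \ K := ⟨hxr, h.disj hxW⟩
    have hcs : c x ⊆ Metric.ball p r \ K := connectedComponentIn_subset _ _
    refine ⟨c x, ?_, ⟨hOo.connectedComponentIn, isPreconnected_connectedComponentIn, hx,
      fun y hy => (hcs hy).2, r, hr0, ?_⟩, fun y hy => Metric.ball_subset_ball (min_le_right _ _) (hcs hy).1⟩
    · refine hsat _ isPreconnected_connectedComponentIn ?_ ⟨x, mem_connectedComponentIn hxO, hxW⟩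
      exact hcs.trans (sdiff_subset_sdiff_left (Metric.ball_subset_ball (min_le_left _ _)))
    · rintro C hC hC' ⟨y, hyC, hyc⟩
      have : c x = c y := connectedComponentIn_eq hyc
      rw [this]
      exact hC.subset_connectedComponentIn hyC hC'
  · exfalso
    push Not at hex
    have build : ∀ k : ℕ, ∃ s : Finset Pl, s.card = k ∧ (↑s : Set Pl) ⊆ W ∩ Metric.ball p (min δ r) ∧
        ∀ x ∈ s, ∀ y ∈ s, x ≠ y → ¬ Con (Metric.ball p r \ K) x y := by
      intro k
      induction k with
      | zero => exact ⟨∅, by simp⟩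
      | succ k ih =>
        obtain ⟨s, hs1, hs2, hs3⟩ := ih
        have hcl : IsClosed (⋃ x ∈ s, closure (c x)) :=
          s.finite_toSet.isClosed_biUnion fun _ _ => isClosed_closure
        have hpn : p ∉ ⋃ x ∈ s, closure (c x) := by
          simp only [mem_iUnion, not_exists]
          intro x hx
          exact hex x ⟨(hs2 hx).1, Metric.ball_subset_ball (min_le_right _ _) (hs2 hx).2⟩
        have hnb : (⋃ x ∈ s, closure (c x))ᶜ ∩ Metric.ball p (min δ r) ∈ 𝓝 p :=
          Filter.inter_mem (hcl.isOpen_compl.mem_nhds hpn) (Metric.ball_mem_nhds p (lt_min hδ hr0))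
        obtain ⟨y, ⟨hy1, hy2⟩, hyW⟩ := mem_closure_iff_nhds.1 h.clos _ hnb
        have hyc : ∀ x ∈ s, ¬ Con (Metric.ball p r \ K) x y := by
          intro x hx hcon
          apply hy1
          simp only [mem_iUnion]
          exact ⟨x, hx, subset_closure (con_iff.1 hcon).2⟩
        have hys : y ∉ s := by
          intro hys
          exact hyc y hys (Con.refl ⟨Metric.ball_subset_ball (min_le_right _ _) hy2, h.disj hyW⟩)
        refine ⟨insert y s, by rw [Finset.card_insert_of_notMem hys, hs1], ?_, ?_⟩
        · rw [Finset.coe_insert]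
          exact insert_subset ⟨hyW, hy2⟩ hs2
        · intro x hx x' hx' hne hcon
          rw [Finset.mem_insert] at hx hx'
          rcases hx with rfl | hx <;> rcases hx' with rfl | hx'
          · exact hne rfl
          · exact hyc _ hx' hcon.symm
          · exact hyc _ hx hcon
          · exact hs3 _ hx _ hx' hne hcon
    obtain ⟨s, hs1, hs2, hs3⟩ := build (M + 1)
    obtain ⟨x, hx, y, hy, hxy, hcon⟩ := hM s (fun x hx =>
      ⟨Metric.ball_subset_ball (min_le_left _ _) (hs2 hx).2, h.disj (hs2 hx).1⟩) (by omega)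
    exact hs3 x hx y hy hxy hcon

theorem inf_arc {W : ℕ → Set Pl} {p z₀ : Pl} (ho : ∀ k, IsOpen (W k)) (hc : ∀ k, IsPreconnected (W k))
    (hanti : Antitone W) (hne : ∀ k, (W k).Nonempty) (hp : p ∉ W 0)
    (hsm : ∀ ε > 0, ∃ k, W k ⊆ Metric.ball p ε) (hz₀ : z₀ ∈ W 0) :
    ∃ S, IsArc S z₀ p ∧ S ⊆ insert p (W 0) := by
  have hpk : ∀ k, p ∉ W k := fun k h => hp (hanti (Nat.zero_le k) h)
  have small : ∀ T : Set Pl, IsClosed T → p ∉ T → ∀ j, ∃ j' > j, Disjoint (W j') T := by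
    intro T hT hpT j
    obtain ⟨ε, hε, hb⟩ := Metric.mem_nhds_iff.1 (hT.isOpen_compl.mem_nhds hpT)
    obtain ⟨k, hk⟩ := hsm ε hε
    refine ⟨max k (j + 1), lt_of_lt_of_le (Nat.lt_succ_self j) (le_max_right _ _), ?_⟩
    rw [disjoint_left]
    intro x hx hxT
    exact hb (hk (hanti (le_max_left _ _) hx)) hxT
  let St := {s : Set Pl × Pl × Pl × ℕ // IsArc s.1 s.2.1 s.2.2.1 ∧ s.2.2.1 ∈ W s.2.2.2 ∧
    s.2.1 ∉ W s.2.2.2 ∧ s.1 ⊆ W 0}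
  have step : ∀ s : St, ∃ (s' : St) (T : Set Pl), IsArc T s.1.2.1 s'.1.2.1 ∧ T ⊆ s.1.1 ∧
      s.1.1 ∩ s'.1.1 ⊆ {s'.1.2.1} ∧ s'.1.1 ⊆ W s.1.2.2.2 ∧ Disjoint (W s'.1.2.2.2) s.1.1 ∧
      s.1.2.2.2 < s'.1.2.2.2 := by
    rintro ⟨⟨T, q, z, j⟩, hT, hz, hq, hT0⟩
    simp only at hT hz hq hT0 ⊢
    obtain ⟨j', hj', hdis⟩ := small T hT.isClosed (fun h => hp (hT0 h)) j
    obtain ⟨z', hz'⟩ := hne j'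
    have hz'T : z' ∉ T := disjoint_left.1 hdis hz'
    obtain ⟨β, hβ, hβW⟩ := exists_arc_open (ho j) (hc j) hz (hanti hj'.le hz')
      (by rintro rfl; exact hz'T hT.right_mem)
    obtain ⟨q', β', hβ', hβ'β, hβ'T⟩ := hβ.symm.first_hit hT.isClosed ⟨z, hβ.left_mem, hT.right_mem⟩ hz'T
    have hq' : q' ∈ β' ∩ T := by rw [hβ'T]; rfl
    have hqq' : q' ≠ q := by
      rintro rfl
      exact hq (hβW (hβ'β hq'.1))
    obtain ⟨T', hT', hT'T⟩ := hT.headPart hq'.2 hqq'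
    refine ⟨⟨⟨β', q', z', j'⟩, hβ'.symm, hz', disjoint_right.1 hdis hq'.2, ?_⟩, T', hT', hT'T, ?_, ?_, hdis, hj'⟩
    · exact (hβ'β.trans hβW).trans (hanti (Nat.zero_le _))
    · simp only
      rw [inter_comm, hβ'T]
    · exact hβ'β.trans hβW
  choose nx T hT hTs hcap hsub hdis hlt using step
  obtain ⟨j₀, -, hj₀⟩ := small {z₀} isClosed_singleton (by rintro rfl; exact hp hz₀) 0
  obtain ⟨z, hz⟩ := hne j₀
  obtain ⟨T₀, hT₀, hT₀W⟩ := exists_arc_open (ho 0) (hc 0) hz₀ (hanti (Nat.zero_le _) hz)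
    (by rintro rfl; exact disjoint_left.1 hj₀ hz rfl)
  let s₀ : St := ⟨⟨T₀, z₀, z, j₀⟩, hT₀, hz, disjoint_right.1 hj₀ rfl, hT₀W⟩
  let sq : ℕ → St := fun k => Nat.rec s₀ (fun _ s => nx s) k
  have hsq : ∀ k, sq (k + 1) = nx (sq k) := fun k => rfl
  let J : ℕ → ℕ := fun k => (sq k).1.2.2.2
  have hJ : StrictMono J := strictMono_nat_of_lt_succ fun k => hlt (sq k)
  have hWsub : ∀ k, (sq (k + 1)).1.1 ⊆ W (J k) := fun k => hsub (sq k)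
  have hres := arc_infinite (T := fun k => T (sq k)) (q := fun k => (sq k).1.2.1) (p := p)
    (fun k => hT (sq k)) ?_ ?_ ?_ ?_
  · refine ⟨_, hres, ?_⟩
    apply insert_subset_insert
    apply iUnion_subset
    intro k
    exact (hTs (sq k)).trans (sq k).2.2.2.2
  · intro k
    exact (inter_subset_inter (hTs (sq k)) (hTs (sq (k + 1)))).trans (hcap (sq k))
  · intro k j hkj
    obtain ⟨i, rfl⟩ : ∃ i, j = i + 1 := ⟨j - 1, by omega⟩
    have h1 : T (sq (i + 1)) ⊆ W (J (k + 1)) :=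
      ((hTs _).trans (hWsub i)).trans (hanti (hJ.monotone (show k + 1 ≤ i by omega)))
    exact ((hdis (sq k)).symm.mono_left (hTs _)).mono_right h1
  · intro k h
    exact hp ((sq k).2.2.2.2 (hTs _ h))
  · intro ε hε
    obtain ⟨k, hk⟩ := hsm ε hε
    refine ⟨k + 1, fun j hj => ?_⟩
    obtain ⟨i, rfl⟩ : ∃ i, j = i + 1 := ⟨j - 1, by omega⟩
    refine ((hTs _).trans (hWsub i)).trans ((hanti ?_).trans hk)
    exact (by omega : k ≤ i).trans hJ.le_apply

/-- Accessibility of locally finite boundary points. -/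
theorem access {K : Set Pl} (hK : IsClosed K) {p z x : Pl} (hlf : LF K p) (hpK : p ∈ K)
    (hzF : z ∈ connectedComponentIn Kᶜ x) (hp : p ∈ closure (connectedComponentIn Kᶜ x)) :
    ∃ S, IsArc S p z ∧ S ⊆ insert p (connectedComponentIn Kᶜ x) := by
  have h0 : Sat K p (connectedComponentIn Kᶜ x) := by
    refine ⟨hK.isOpen_compl.connectedComponentIn, isPreconnected_connectedComponentIn, hp,
      connectedComponentIn_subset _ _, 1, one_pos, ?_⟩
    rintro C hC hC' ⟨y, hyC, hyc⟩
    rw [connectedComponentIn_eq hyc]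
    exact hC.subset_connectedComponentIn hyC (fun w hw => (hC' hw).2)
  let St := {W : Set Pl // Sat K p W}
  have step : ∀ (s : St) (k : ℕ), ∃ s' : St, s'.1 ⊆ s.1 ∧ s'.1 ⊆ Metric.ball p (1 / ((k : ℝ) + 1)) := by
    intro s k
    obtain ⟨W', h1, h2, h3⟩ := s.2.step hK hlf (ε := 1 / ((k : ℝ) + 1)) (by positivity)
    exact ⟨⟨W', h2⟩, h1, h3⟩
  choose nx hnx1 hnx2 using step
  let sq : ℕ → St := fun k => Nat.rec ⟨_, h0⟩ (fun k s => nx s k) k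
  obtain ⟨S, hS, hS'⟩ := inf_arc (W := fun k => (sq k).1) (p := p) (z₀ := z) (fun k => (sq k).2.isOpen)
    (fun k => (sq k).2.conn) (antitone_nat_of_succ_le fun k => hnx1 (sq k) k)
    (fun k => by
      have := (sq k).2.clos
      exact closure_nonempty_iff.1 ⟨p, this⟩)
    (fun h => (h0.disj h) hpK) (by
      intro ε hε
      obtain ⟨k, hk⟩ := exists_nat_one_div_lt hε
      exact ⟨k + 1, (hnx2 (sq k) k).trans (Metric.ball_subset_ball hk.le)⟩) hzF
  exact ⟨S, hS.symm, hS'⟩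

theorem access_two {K : Set Pl} (hK : IsClosed K) {p q x : Pl} (hlf : LF K p) (hlf' : LF K q) (hpK : p ∈ K)
    (hqK : q ∈ K) (hpq : p ≠ q) (hp : p ∈ closure (connectedComponentIn Kᶜ x))
    (hq : q ∈ closure (connectedComponentIn Kᶜ x)) :
    ∃ S, IsArc S p q ∧ S ⊆ insert p (insert q (connectedComponentIn Kᶜ x)) := by
  obtain ⟨z, hz⟩ := closure_nonempty_iff.1 ⟨p, hp⟩
  obtain ⟨S, hS, hS'⟩ := access hK hlf hpK hz hp
  obtain ⟨T, hT, hT'⟩ := access hK hlf' hqK hz hq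
  obtain ⟨R, hR, hR'⟩ := hS.splice hT.symm hpq
  refine ⟨R, hR, hR'.trans (union_subset (hS'.trans ?_) (hT'.trans ?_))⟩
  · exact insert_subset_insert (subset_insert _ _)
  · exact subset_insert _ _

end PT

namespace PT
open Topology

theorem sub_of_frontier {C F : Set Pl} (hC : IsPreconnected C) (hF : IsOpen F) (hne : (C ∩ F).Nonempty)
    (hfr : ∀ x ∈ C, x ∉ frontier F) : C ⊆ F := by
  refine hC.subset_left_of_subset_union hF (isClosed_closure (s := F)).isOpen_compl ?_ ?_ hne
  · exact disjoint_compl_right.mono_right (compl_subset_compl.2 subset_closure)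
  · intro x hx
    by_cases h : x ∈ F
    · exact Or.inl h
    · right
      intro hcl
      exact hfr x hx (by rw [hF.frontier_eq]; exact ⟨hcl, h⟩)

def Faces (K : Set Pl) : Set (Set Pl) := {F | ∃ x ∉ K, F = connectedComponentIn Kᶜ x}

section faces
variable {K K₁ F F' C : Set Pl} {x : Pl}

theorem exists_face (hx : x ∉ K) : ∃ F ∈ Faces K, x ∈ F :=
  ⟨_, ⟨x, hx, rfl⟩, mem_connectedComponentIn hx⟩

theorem face_sub (hF : F ∈ Faces K) : F ⊆ Kᶜ := by
  obtain ⟨x, hx, rfl⟩ := hF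
  exact connectedComponentIn_subset _ _

theorem face_conn (hF : F ∈ Faces K) : IsPreconnected F := by
  obtain ⟨x, hx, rfl⟩ := hF
  exact isPreconnected_connectedComponentIn

theorem face_nonempty (hF : F ∈ Faces K) : F.Nonempty := by
  obtain ⟨x, hx, rfl⟩ := hF
  exact ⟨x, mem_connectedComponentIn hx⟩

theorem face_open (hK : IsClosed K) (hF : F ∈ Faces K) : IsOpen F := by
  obtain ⟨x, hx, rfl⟩ := hF
  exact hK.isOpen_compl.connectedComponentIn

theorem face_frontier (hK : IsClosed K) (hF : F ∈ Faces K) : frontier F ⊆ K := by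
  obtain ⟨x, hx, rfl⟩ := hF
  exact frontier_component_subset hK x

theorem face_max (hF : F ∈ Faces K) (hC : IsPreconnected C) (hCK : C ⊆ Kᶜ) (hne : (C ∩ F).Nonempty) :
    C ⊆ F := by
  obtain ⟨x, hx, rfl⟩ := hF
  obtain ⟨y, hyC, hy⟩ := hne
  rw [connectedComponentIn_eq hy]
  exact hC.subset_connectedComponentIn hyC hCK

theorem face_eq (hF : F ∈ Faces K) (hF' : F' ∈ Faces K) (h1 : x ∈ F) (h2 : x ∈ F') : F = F' :=
  (face_max hF' (face_conn hF) (face_sub hF) ⟨x, h1, h2⟩).antisymm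
    (face_max hF (face_conn hF') (face_sub hF') ⟨x, h2, h1⟩)

theorem face_con {y : Pl} (hF : F ∈ Faces K) (h : Con Kᶜ x y) (hx : x ∈ F) : y ∈ F := by
  obtain ⟨C, h1, h2, h3, h4⟩ := h
  exact face_max hF h1 h2 ⟨x, h3, hx⟩ h4

theorem face_con' {y : Pl} (hF : F ∈ Faces K) (hx : x ∈ F) (hy : y ∈ F) : Con Kᶜ x y :=
  ⟨F, face_conn hF, face_sub hF, hx, hy⟩

theorem face_closure (hK : IsClosed K) (hF : F ∈ Faces K) (hx : x ∈ closure F) (hxK : x ∉ K) : x ∈ F := by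
  by_contra h
  apply hxK
  apply face_frontier hK hF
  rw [(face_open hK hF).frontier_eq]
  exact ⟨hx, h⟩

/-- A face stays a face when only parts of `K` off its frontier are removed. -/
theorem face_shrink (hK : IsClosed K) (hF : F ∈ Faces K) (hsub : K₁ ⊆ K) (hfr : frontier F ⊆ K₁) :
    F ∈ Faces K₁ := by
  obtain ⟨x, hx⟩ := face_nonempty hF
  have hxK : x ∉ K₁ := fun h => face_sub hF hx (hsub h)
  refine ⟨x, hxK, ?_⟩
  apply Subset.antisymm
  · exact (face_conn hF).subset_connectedComponentIn hx ((face_sub hF).trans (compl_subset_compl.2 hsub))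
  · refine sub_of_frontier isPreconnected_connectedComponentIn (face_open hK hF)
      ⟨x, mem_connectedComponentIn hxK, hx⟩ ?_
    intro y hy hyf
    exact connectedComponentIn_subset _ _ hy (hfr hyf)

end faces

section arc
variable {K e : Set Pl} {a b : Pl}

/-- arc interior -/
theorem IsArc.int_conn (he : IsArc e a b) : IsPreconnected (e \ {a, b}) := by
  obtain ⟨γ, h1, h2, rfl, rfl, rfl⟩ := he
  have : γ '' Icc 0 1 \ {γ 0, γ 1} = γ '' Ioo 0 1 := by
    ext x
    constructor
    · rintro ⟨⟨t, ht, rfl⟩, hn⟩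
      simp only [mem_insert_iff, mem_singleton_iff, not_or] at hn
      exact ⟨t, ⟨lt_of_le_of_ne ht.1 (by rintro rfl; exact hn.1 rfl),
        lt_of_le_of_ne ht.2 (by rintro rfl; exact hn.2 rfl)⟩, rfl⟩
    · rintro ⟨t, ht, rfl⟩
      refine ⟨⟨t, Ioo_subset_Icc_self ht, rfl⟩, ?_⟩
      rintro (h | h)
      · exact ht.1.ne' (h2 (Ioo_subset_Icc_self ht) (by simp) h)
      · exact ht.2.ne (h2 (Ioo_subset_Icc_self ht) (by simp) h)
  rw [this]
  exact isPreconnected_Ioo.image _ (h1.mono Ioo_subset_Icc_self)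

/-- Points of the interior near any point of the arc. -/
theorem IsArc.int_dense (he : IsArc e a b) {y : Pl} (hy : y ∈ e) {U : Set Pl} (hU : U ∈ 𝓝 y) :
    ∃ z ∈ e \ {a, b}, z ∈ U := by
  by_cases hyi : y ∈ ({a, b} : Set Pl)
  · have : ∀ c d, IsArc e c d → U ∈ 𝓝 c → ∃ z ∈ e \ {c, d}, z ∈ U := by
      intro c d h hU
      obtain ⟨z, S₁, S₂, h1, h2, h3, h4, h5, h6⟩ := h.initial hU
      refine ⟨z, ⟨h3 ▸ Or.inl h1.right_mem, ?_⟩, h5 h1.right_mem⟩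
      rintro (h | h)
      · exact h1.ne h.symm
      · exact h6 h
    rcases hyi with rfl | hyi
    · exact this _ _ he hU
    · rw [mem_singleton_iff] at hyi
      subst hyi
      obtain ⟨z, hz, hz'⟩ := this _ _ he.symm hU
      exact ⟨z, by rwa [pair_comm], hz'⟩
  · exact ⟨y, ⟨hy, hyi⟩, mem_of_mem_nhds hU⟩

theorem IsArc.int_nonempty (he : IsArc e a b) : (e \ {a, b}).Nonempty := by
  obtain ⟨z, hz, -⟩ := he.int_dense he.left_mem Filter.univ_mem
  exact ⟨z, hz⟩

/-- Adding an arc `e` to `K`. -/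
structure AddArc (K e : Set Pl) (a b : Pl) : Prop where
  cpt : IsCompact K
  arc : IsArc e a b
  inter : K ∩ e = {a, b}


theorem AddArc.aK (h : AddArc K e a b) : a ∈ K := by
  have : a ∈ K ∩ e := by rw [h.inter]; simp
  exact this.1

theorem AddArc.bK (h : AddArc K e a b) : b ∈ K := by
  have : b ∈ K ∩ e := by rw [h.inter]; simp
  exact this.1

theorem AddArc.symm (h : AddArc K e a b) : AddArc K e b a := ⟨h.cpt, h.arc.symm, by rw [h.inter, pair_comm]⟩

theorem AddArc.cpt' (h : AddArc K e a b) : IsCompact (K ∪ e) := h.cpt.union h.arc.isCompact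

theorem AddArc.int_sub (h : AddArc K e a b) : e \ {a, b} ⊆ Kᶜ := by
  intro x hx hxK
  have : x ∈ K ∩ e := ⟨hxK, hx.1⟩
  rw [h.inter] at this
  exact hx.2 this

theorem AddArc.face_sub_of_meet (h : AddArc K e a b) {U F : Set Pl} (hU : U ∈ Faces K) (hF : F ∈ Faces (K ∪ e))
    (hne : (F ∩ U).Nonempty) : F ⊆ U :=
  face_max hU (face_conn hF) ((face_sub hF).trans (compl_subset_compl.2 subset_union_left)) hne

theorem AddArc.exists_U (h : AddArc K e a b) : ∃ U ∈ Faces K, e \ {a, b} ⊆ U := by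
  obtain ⟨y, hy⟩ := h.arc.int_nonempty
  obtain ⟨U, hU, hyU⟩ := exists_face (h.int_sub hy)
  exact ⟨U, hU, face_max hU h.arc.int_conn h.int_sub ⟨y, hy, hyU⟩⟩

theorem AddArc.face_sub_U (h : AddArc K e a b) {U F : Set Pl} (hU : U ∈ Faces K) (hUe : e \ {a, b} ⊆ U) (hF : F ∈ Faces (K ∪ e))
    (hadj : ((e \ {a, b}) ∩ closure F).Nonempty) : F ⊆ U := by
  obtain ⟨y, hy, hyF⟩ := hadj
  obtain ⟨z, hz1, hz2⟩ := mem_closure_iff_nhds.1 hyF U ((face_open h.cpt.isClosed hU).mem_nhds (hUe hy))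
  exact h.face_sub_of_meet hU hF ⟨z, hz2, hz1⟩

theorem AddArc.spread (h : AddArc K e a b) {F : Set Pl} (hF : F ∈ Faces (K ∪ e))
    (hadj : ((e \ {a, b}) ∩ closure F).Nonempty) : e ⊆ closure F := by
  intro y' hy'
  by_contra hcl
  obtain ⟨y, hy, hyn⟩ := h.arc.int_dense hy' ((isClosed_closure (s := F)).isOpen_compl.mem_nhds hcl)
  obtain ⟨U, hU, hUe⟩ := h.exists_U
  have hFU := h.face_sub_U hU hUe hF hadj
  have hya : y ≠ a := fun h => hy.2 (Or.inl h)
  have hyb : y ≠ b := fun h => hy.2 (Or.inr h)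
  obtain ⟨S₁, S₂, s1, s2, s3, s4⟩ := h.arc.split hy.1 hya hyb
  have hnb : (closure F)ᶜ ∈ 𝓝 y := (isClosed_closure (s := F)).isOpen_compl.mem_nhds hyn
  obtain ⟨z₁, T₁, A₁, t1, a1, u1, i1, v1, w1⟩ := s1.symm.initial hnb
  obtain ⟨z₂, T₂, A₂, t2, a2, u2, i2, v2, w2⟩ := s2.initial hnb
  have hA₁ : A₁ ⊆ S₁ := by rw [← u1]; exact subset_union_right
  have hA₂ : A₂ ⊆ S₂ := by rw [← u2]; exact subset_union_right
  have hyA₁ : y ∉ A₁ := by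
    intro hh
    have : y ∈ T₁ ∩ A₁ := ⟨t1.left_mem, hh⟩
    rw [i1] at this
    exact t1.ne this
  have hyA₂ : y ∉ A₂ := by
    intro hh
    have : y ∈ T₂ ∩ A₂ := ⟨t2.left_mem, hh⟩
    rw [i2] at this
    exact t2.ne this
  have he1 : S₁ ⊆ e := by rw [← s3]; exact subset_union_left
  have he2 : S₂ ⊆ e := by rw [← s3]; exact subset_union_right
  obtain ⟨x, hx⟩ := face_nonempty hF
  have hxe : x ∉ e := fun hh => face_sub hF hx (Or.inr hh)
  have hc0 : Con Kᶜ x y := face_con' hU (hFU hx) (hUe hy)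
  have hc1 : Con (K ∪ A₁)ᶜ x y := by
    refine jan h.cpt a1.isCompact ?_ hc0 (con_compl_arc a1 (fun hh => hxe (he1 (hA₁ hh))) hyA₁)
    apply Set.Subsingleton.isPreconnected
    refine (subsingleton_singleton (a := a)).anti ?_
    rintro w ⟨hwK, hwA⟩
    have : w ∈ K ∩ e := ⟨hwK, he1 (hA₁ hwA)⟩
    rw [h.inter] at this
    rcases this with hw | hw
    · exact hw
    · exfalso
      rw [mem_singleton_iff] at hw
      subst hw
      have : w ∈ S₁ ∩ S₂ := ⟨hA₁ hwA, s2.right_mem⟩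
      rw [s4] at this
      exact hyb this.symm
  have hc2 : Con (K ∪ A₁ ∪ A₂)ᶜ x y := by
    refine jan (h.cpt.union a1.isCompact) a2.isCompact ?_ hc1
      (con_compl_arc a2 (fun hh => hxe (he2 (hA₂ hh))) hyA₂)
    apply Set.Subsingleton.isPreconnected
    refine (subsingleton_singleton (a := b)).anti ?_
    rintro w ⟨hwK | hwK, hwA⟩
    · have : w ∈ K ∩ e := ⟨hwK, he2 (hA₂ hwA)⟩
      rw [h.inter] at this
      rcases this with hw | hw
      · exfalso
        subst hw
        have : w ∈ S₁ ∩ S₂ := ⟨s1.left_mem, hA₂ hwA⟩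
        rw [s4] at this
        exact hya this.symm
      · exact hw
    · exfalso
      have : w ∈ S₁ ∩ S₂ := ⟨hA₁ hwK, hA₂ hwA⟩
      rw [s4, mem_singleton_iff] at this
      exact hyA₁ (this ▸ hwK)
  obtain ⟨C, C1, C2, C3, C4⟩ := hc2
  have hKc := h.cpt'.isClosed
  have : C ⊆ F := by
    refine sub_of_frontier C1 (face_open hKc hF) ⟨x, C3, hx⟩ ?_
    intro w hw hwf
    have hwn := C2 hw
    have hwcl : w ∈ closure F := frontier_subset_closure hwf
    rcases face_frontier hKc hF hwf with hwK | hwe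
    · exact hwn (Or.inl (Or.inl hwK))
    · rw [← s3, ← u1, ← u2] at hwe
      rcases hwe with (hw1 | hw1) | (hw1 | hw1)
      · exact v1 hw1 hwcl
      · exact hwn (Or.inl (Or.inr hw1))
      · exact v2 hw1 hwcl
      · exact hwn (Or.inr hw1)
  exact hyn (subset_closure (this C4))

/-- faces not touching the interior of `e` -/
theorem AddArc.face_of_not_adj (h : AddArc K e a b) {F : Set Pl} (hF : F ∈ Faces (K ∪ e))
    (hadj : ¬ ((e \ {a, b}) ∩ closure F).Nonempty) : F ∈ Faces K := by
  refine face_shrink h.cpt'.isClosed hF subset_union_left ?_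
  intro y hy
  rcases face_frontier h.cpt'.isClosed hF hy with hh | hh
  · exact hh
  · by_contra hyK
    apply hadj
    refine ⟨y, ⟨hh, ?_⟩, frontier_subset_closure hy⟩
    rintro (e | e)
    · exact hyK (e ▸ h.aK)
    · exact hyK (e ▸ h.bK)

theorem AddArc.face_adj (h : AddArc K e a b) {U F : Set Pl} (hU : U ∈ Faces K) (hUe : e \ {a, b} ⊆ U) (hF : F ∈ Faces (K ∪ e))
    (hFU : (F ∩ U).Nonempty) : e ⊆ closure F := by
  apply h.spread hF
  by_contra hadj
  obtain ⟨x, hx1, hx2⟩ := hFU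
  have := face_eq (h.face_of_not_adj hF hadj) hU hx1 hx2
  obtain ⟨y, hy⟩ := h.arc.int_nonempty
  have h1 := hUe hy
  rw [← this] at h1
  exact face_sub hF h1 (Or.inr hy.1)

theorem AddArc.adj_iff (h : AddArc K e a b) {U F : Set Pl} (hU : U ∈ Faces K) (hUe : e \ {a, b} ⊆ U) (hF : F ∈ Faces (K ∪ e)) :
    ((e \ {a, b}) ∩ closure F).Nonempty ↔ F ⊆ U := by
  constructor
  · exact h.face_sub_U hU hUe hF
  · intro hFU
    obtain ⟨x, hx⟩ := face_nonempty hF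
    obtain ⟨y, hy⟩ := h.arc.int_nonempty
    exact ⟨y, hy, h.face_adj hU hUe hF ⟨x, hx, hFU hx⟩ hy.1⟩

theorem AddArc.face_of_old (h : AddArc K e a b) {U G : Set Pl} (hU : U ∈ Faces K) (hUe : e \ {a, b} ⊆ U) (hG : G ∈ Faces K)
    (hne : G ≠ U) : G ∈ Faces (K ∪ e) ∧ ¬ G ⊆ U := by
  obtain ⟨x, hx⟩ := face_nonempty hG
  have hxU : x ∉ U := fun hh => hne (face_eq hG hU hx hh)
  have hGe : G ⊆ (K ∪ e)ᶜ := by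
    rintro y hy (hh | hh)
    · exact face_sub hG hy hh
    · by_cases hyi : y ∈ ({a, b} : Set Pl)
      · rcases hyi with hh | hh
        · exact face_sub hG hy (hh ▸ h.aK)
        · exact face_sub hG hy (hh ▸ h.bK)
      · exact hne (face_eq hG hU hy (hUe ⟨hh, hyi⟩))
  refine ⟨⟨x, hGe hx, ?_⟩, fun hh => hxU (hh hx)⟩
  apply Subset.antisymm
  · exact (face_conn hG).subset_connectedComponentIn hx hGe
  · refine face_max hG isPreconnected_connectedComponentIn ?_ ⟨x, mem_connectedComponentIn (hGe hx), hx⟩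
    exact (connectedComponentIn_subset _ _).trans (compl_subset_compl.2 subset_union_left)

theorem AddArc.faces_eq (h : AddArc K e a b) {U : Set Pl} (hU : U ∈ Faces K) (hUe : e \ {a, b} ⊆ U) :
    Faces (K ∪ e) = (Faces K \ {U}) ∪ {F ∈ Faces (K ∪ e) | F ⊆ U} := by
  ext F
  constructor
  · intro hF
    by_cases hFU : F ⊆ U
    · exact Or.inr ⟨hF, hFU⟩
    · left
      refine ⟨h.face_of_not_adj hF fun hh => hFU ((h.adj_iff hU hUe hF).1 hh), ?_⟩
      rintro rfl
      exact hFU subset_rfl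
  · rintro (⟨h1, h2⟩ | ⟨h1, h2⟩)
    · exact (h.face_of_old hU hUe h1 h2).1
    · exact h1

theorem AddArc.adj_nonempty (h : AddArc K e a b) {U : Set Pl} (hU : U ∈ Faces K) :
    ∃ F ∈ Faces (K ∪ e), F ⊆ U := by
  obtain ⟨q, hq, hqe⟩ : ∃ q ∈ U, q ∉ e := by
    by_contra hcon
    push Not at hcon
    have : U ⊆ interior e := interior_maximal hcon (face_open h.cpt.isClosed hU)
    rw [interior_arc h.arc] at this
    obtain ⟨x, hx⟩ := face_nonempty hU
    exact this hx
  obtain ⟨F, hF, hqF⟩ := exists_face (K := K ∪ e) (x := q) (by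
    rintro (hh | hh)
    · exact face_sub hU hq hh
    · exact hqe hh)
  exact ⟨F, hF, h.face_sub_of_meet hU hF ⟨q, hqF, hq⟩⟩

theorem AddArc.adj_le_two (h : AddArc K e a b) {U : Set Pl} (hU : U ∈ Faces K) {F₁ F₂ F₃ : Set Pl} (h1 : F₁ ∈ Faces (K ∪ e))
    (h2 : F₂ ∈ Faces (K ∪ e)) (h3 : F₃ ∈ Faces (K ∪ e)) (s1 : F₁ ⊆ U) (s2 : F₂ ⊆ U) (s3 : F₃ ⊆ U) :
    F₁ = F₂ ∨ F₁ = F₃ ∨ F₂ = F₃ := by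
  obtain ⟨x₁, hx₁⟩ := face_nonempty h1
  obtain ⟨x₂, hx₂⟩ := face_nonempty h2
  obtain ⟨x₃, hx₃⟩ := face_nonempty h3
  rcases three h.cpt h.arc h.inter.subset (fun hh => face_sub h1 hx₁ (Or.inr hh))
    (fun hh => face_sub h2 hx₂ (Or.inr hh)) (fun hh => face_sub h3 hx₃ (Or.inr hh))
    (face_con' hU (s1 hx₁) (s2 hx₂)) (face_con' hU (s1 hx₁) (s3 hx₃)) with hc | hc | hc
  · exact Or.inl (face_eq h1 h2 (face_con h1 hc hx₁) hx₂)
  · exact Or.inr (Or.inl (face_eq h1 h3 (face_con h1 hc hx₁) hx₃))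
  · exact Or.inr (Or.inr (face_eq h2 h3 (face_con h2 hc hx₂) hx₃))

/-- non-bridge -/
theorem AddArc.adj_two (h : AddArc K e a b) {U A : Set Pl} (hU : U ∈ Faces K) (hUe : e \ {a, b} ⊆ U) (hA : IsArc A a b)
    (hAK : A ⊆ K) : ∃ F₁ ∈ Faces (K ∪ e), ∃ F₂ ∈ Faces (K ∪ e), F₁ ⊆ U ∧ F₂ ⊆ U ∧ F₁ ≠ F₂ := by
  have hAe : AddArc A e a b := by
    refine ⟨hA.isCompact, h.arc, ?_⟩
    apply Subset.antisymm
    · rw [← h.inter]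
      exact inter_subset_inter_left _ hAK
    · rintro x (rfl | rfl)
      · exact ⟨hA.left_mem, h.arc.left_mem⟩
      · exact ⟨hA.right_mem, h.arc.right_mem⟩
  have hsep := sep_two hA.isCompact h.arc.isCompact hA.isPreconnected h.arc.isPreconnected hA.ne hAe.inter
  obtain ⟨p₁, p₂, hp₁, hp₂, hp⟩ : ∃ p₁ p₂, p₁ ∉ A ∪ e ∧ p₂ ∉ A ∪ e ∧ ¬ Con (A ∪ e)ᶜ p₁ p₂ := by
    by_contra hcon
    push Not at hcon
    apply hsep
    apply isPreconnected_of_forall_pair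
    intro x hx y hy
    obtain ⟨C, h1, h2, h3, h4⟩ := hcon x y hx hy
    exact ⟨C, h2, h3, h4, h1⟩
  obtain ⟨y, hy⟩ := h.arc.int_nonempty
  obtain ⟨UA, hUA, hUAe⟩ := hAe.exists_U
  have key : ∀ p, p ∉ A ∪ e → ∃ p', Con (A ∪ e)ᶜ p p' ∧ ∃ F ∈ Faces (K ∪ e), p' ∈ F ∧ F ⊆ U := by
    intro p hp
    obtain ⟨G, hG, hpG⟩ := exists_face hp
    have hGU : p ∈ UA := by
      refine face_con hUA (con_compl_arc hA ?_ ?_) (hUAe hy)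
      · exact hAe.int_sub hy
      · exact fun hh => hp (Or.inl hh)
    have hyG : y ∈ closure G := hAe.face_adj hUA hUAe hG ⟨p, hpG, hGU⟩ hy.1
    obtain ⟨p', hp'U, hp'G⟩ := mem_closure_iff_nhds.1 hyG U ((face_open h.cpt.isClosed hU).mem_nhds (hUe hy))
    have hp'K : p' ∉ K ∪ e := by
      rintro (hh | hh)
      · exact face_sub hU hp'U hh
      · exact face_sub hG hp'G (Or.inr hh)
    obtain ⟨F, hF, hp'F⟩ := exists_face hp'K
    exact ⟨p', face_con' hG hpG hp'G, F, hF, hp'F, h.face_sub_of_meet hU hF ⟨p', hp'F, hp'U⟩⟩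
  obtain ⟨q₁, hq₁, F₁, hF₁, hqF₁, hFU₁⟩ := key p₁ hp₁
  obtain ⟨q₂, hq₂, F₂, hF₂, hqF₂, hFU₂⟩ := key p₂ hp₂
  refine ⟨F₁, hF₁, F₂, hF₂, hFU₁, hFU₂, ?_⟩
  rintro rfl
  apply hp
  refine hq₁.trans (Con.trans ?_ hq₂.symm)
  exact (face_con' hF₁ hqF₁ hqF₂).mono (compl_subset_compl.2 (union_subset_union_left _ hAK))

/-- bridge -/
theorem AddArc.adj_one (h : AddArc K e a b) {U K₁ K₂ : Set Pl} (hU : U ∈ Faces K) (hK : K = K₁ ∪ K₂) (h1 : IsCompact K₁)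
    (h2 : IsCompact K₂) (hd : Disjoint K₁ K₂) (ha : a ∈ K₁) (hb : b ∈ K₂) {F₁ F₂ : Set Pl}
    (hF₁ : F₁ ∈ Faces (K ∪ e)) (hF₂ : F₂ ∈ Faces (K ∪ e)) (s1 : F₁ ⊆ U) (s2 : F₂ ⊆ U) : F₁ = F₂ := by
  obtain ⟨x₁, hx₁⟩ := face_nonempty hF₁
  obtain ⟨x₂, hx₂⟩ := face_nonempty hF₂
  have hc : Con Kᶜ x₁ x₂ := face_con' hU (s1 hx₁) (s2 hx₂)
  have hc1 : Con K₁ᶜ x₁ x₂ := hc.mono (compl_subset_compl.2 (by rw [hK]; exact subset_union_left))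
  have hc2 : Con K₂ᶜ x₁ x₂ := hc.mono (compl_subset_compl.2 (by rw [hK]; exact subset_union_right))
  have hi1 : K₁ ∩ e ⊆ {a} := by
    rintro w ⟨hw1, hw2⟩
    have : w ∈ K ∩ e := ⟨by rw [hK]; exact Or.inl hw1, hw2⟩
    rw [h.inter] at this
    rcases this with hw | hw
    · exact hw
    · exfalso
      rw [mem_singleton_iff] at hw
      exact disjoint_left.1 hd hw1 (hw ▸ hb)
  have hi2 : K₂ ∩ e ⊆ {b} := by
    rintro w ⟨hw1, hw2⟩
    have : w ∈ K ∩ e := ⟨by rw [hK]; exact Or.inr hw1, hw2⟩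
    rw [h.inter] at this
    rcases this with hw | hw
    · exfalso
      exact disjoint_left.1 hd (hw ▸ ha) hw1
    · exact hw
  have hc3 : Con (K₁ ∪ e)ᶜ x₁ x₂ :=
    jan h1 h.arc.isCompact (subsingleton_singleton.anti hi1).isPreconnected hc1
      (con_compl_arc h.arc (fun hh => face_sub hF₁ hx₁ (Or.inr hh)) (fun hh => face_sub hF₂ hx₂ (Or.inr hh)))
  have hc4 : Con (K₂ ∪ (K₁ ∪ e))ᶜ x₁ x₂ := by
    refine jan h2 (h1.union h.arc.isCompact) ?_ hc2 hc3
    refine ((subsingleton_singleton (a := b)).anti ?_).isPreconnected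
    rintro w ⟨hw, hw1 | hw1⟩
    · exact absurd hw (disjoint_left.1 hd hw1)
    · exact hi2 ⟨hw, hw1⟩
  have : K₂ ∪ (K₁ ∪ e) = K ∪ e := by
    rw [hK, ← union_assoc, union_comm K₂]
  rw [this] at hc4
  exact face_eq hF₁ hF₂ (face_con hF₁ hc4 hx₁) hx₂

end arc

end PT

namespace PT
open Topology

/-- Data of a plane graph: node positions and arcs. -/
structure PD (N : Type*) where
  pos : N → Pl
  arc : Sym2 N → Set Pl

namespace PD
variable {N : Type*} (P : PD N)

def K (E : Set (Sym2 N)) : Set Pl := range P.pos ∪ ⋃ e ∈ E, P.arc e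

structure IsPlane (E : Set (Sym2 N)) : Prop where
  inj : Function.Injective P.pos
  isArc : ∀ u v, s(u, v) ∈ E → IsArc (P.arc s(u, v)) (P.pos u) (P.pos v)
  inc : ∀ e ∈ E, ∀ n, P.pos n ∈ P.arc e → n ∈ e
  disj : ∀ e ∈ E, ∀ f ∈ E, e ≠ f → P.arc e ∩ P.arc f ⊆ range P.pos

/-- interior of an edge -/
def int (e : Sym2 N) : Set Pl := P.arc e \ range P.pos

/-- incidence of an edge with a face -/
def Inc (e : Sym2 N) (F : Set Pl) : Prop := (P.int e ∩ closure F).Nonempty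

def fc (E : Set (Sym2 N)) : Set (Set Pl) := Faces (P.K E)

def adjF (E : Set (Sym2 N)) (e : Sym2 N) : Set (Set Pl) := {F ∈ P.fc E | P.Inc e F}

def bd (E : Set (Sym2 N)) (F : Set Pl) : Set (Sym2 N) := {e ∈ E | P.Inc e F}

def NonBridge (E : Set (Sym2 N)) (a b : N) : Prop :=
  (SimpleGraph.fromEdgeSet (E \ {s(a, b)})).Reachable a b

variable {P} {E E' : Set (Sym2 N)} {a b n : N} {e f : Sym2 N} {F F' : Set Pl}

theorem IsPlane.mono (h : P.IsPlane E) (hE : E' ⊆ E) : P.IsPlane E' :=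
  ⟨h.inj, fun u v huv => h.isArc u v (hE huv), fun e he => h.inc e (hE he),
    fun e he f hf => h.disj e (hE he) f (hE hf)⟩

theorem K_mono (hE : E' ⊆ E) : P.K E' ⊆ P.K E :=
  union_subset_union_right _ (biUnion_mono hE fun _ _ => subset_rfl)

theorem pos_mem_K : P.pos n ∈ P.K E := Or.inl ⟨n, rfl⟩

theorem arc_sub_K (he : e ∈ E) : P.arc e ⊆ P.K E := fun _ hx => Or.inr (mem_biUnion he hx)

theorem IsPlane.ne (h : P.IsPlane E) (hab : s(a, b) ∈ E) : a ≠ b := by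
  rintro rfl
  exact (h.isArc a a hab).ne rfl

theorem IsPlane.compact_arc (h : P.IsPlane E) (he : e ∈ E) : IsCompact (P.arc e) := by
  induction e using Sym2.ind with
  | _ u v => exact (h.isArc u v he).isCompact

variable [Finite N]

theorem IsPlane.compact (h : P.IsPlane E) : IsCompact (P.K E) :=
  (finite_range P.pos).isCompact.union ((toFinite E).isCompact_biUnion fun _ he => h.compact_arc he)

theorem IsPlane.closed (h : P.IsPlane E) : IsClosed (P.K E) := h.compact.isClosed

theorem IsPlane.int_eq (h : P.IsPlane E) (hab : s(a, b) ∈ E) :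
    P.int s(a, b) = P.arc s(a, b) \ {P.pos a, P.pos b} := by
  ext x
  constructor
  · rintro ⟨h1, h2⟩
    refine ⟨h1, ?_⟩
    rintro (rfl | rfl)
    · exact h2 ⟨_, rfl⟩
    · exact h2 ⟨_, rfl⟩
  · rintro ⟨h1, h2⟩
    refine ⟨h1, ?_⟩
    rintro ⟨n, rfl⟩
    have := h.inc _ hab n h1
    rw [Sym2.mem_iff] at this
    rcases this with rfl | rfl
    · exact h2 (Or.inl rfl)
    · exact h2 (Or.inr rfl)

theorem IsPlane.addArc (h : P.IsPlane E) (hab : s(a, b) ∈ E) :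
    AddArc (P.K (E \ {s(a, b)})) (P.arc s(a, b)) (P.pos a) (P.pos b) := by
  refine ⟨(h.mono sdiff_subset).compact, h.isArc a b hab, ?_⟩
  apply Subset.antisymm
  · have key : P.K (E \ {s(a, b)}) ∩ P.arc s(a, b) ⊆ range P.pos := by
      rintro x ⟨hx | hx, hx'⟩
      · exact hx
      · simp only [mem_iUnion] at hx
        obtain ⟨f, hf, hxf⟩ := hx
        exact h.disj f hf.1 _ hab hf.2 ⟨hxf, hx'⟩
    intro x hx
    obtain ⟨n, rfl⟩ := key hx
    have := h.inc _ hab n hx.2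
    rw [Sym2.mem_iff] at this
    rcases this with rfl | rfl
    · exact Or.inl rfl
    · exact Or.inr rfl
  · rintro x (rfl | rfl)
    · exact ⟨pos_mem_K, (h.isArc a b hab).left_mem⟩
    · exact ⟨pos_mem_K, (h.isArc a b hab).right_mem⟩

theorem K_insert (he : e ∈ E) : P.K (E \ {e}) ∪ P.arc e = P.K E := by
  rw [K, K, union_assoc]
  congr 1
  ext x
  simp only [mem_union, mem_iUnion, exists_prop, mem_sdiff, mem_singleton_iff]
  constructor
  · rintro (⟨f, hf, hx⟩ | hx)
    · exact ⟨f, hf.1, hx⟩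
    · exact ⟨e, he, hx⟩
  · rintro ⟨f, hf, hx⟩
    by_cases hfe : f = e
    · subst hfe; exact Or.inr hx
    · exact Or.inl ⟨f, ⟨hf, hfe⟩, hx⟩

theorem IsPlane.exists_ends (h : P.IsPlane E) (he : e ∈ E) : ∃ a b, a ≠ b ∧ e = s(a, b) := by
  induction e using Sym2.ind with
  | _ u v => exact ⟨u, v, h.ne he, rfl⟩

theorem IsPlane.int_nonempty (h : P.IsPlane E) (he : e ∈ E) : (P.int e).Nonempty := by
  obtain ⟨a, b, -, rfl⟩ := h.exists_ends he
  rw [h.int_eq he]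
  exact (h.isArc a b he).int_nonempty

theorem IsPlane.spread (h : P.IsPlane E) (he : e ∈ E) (hF : F ∈ P.fc E) (hi : P.Inc e F) :
    P.arc e ⊆ closure F := by
  obtain ⟨a, b, -, rfl⟩ := h.exists_ends he
  have := (h.addArc he).spread (F := F) (by rw [K_insert he]; exact hF) (by
    rw [← h.int_eq he]; exact hi)
  exact this

/-- The face of `E \ {e}` containing the interior of `e`. -/
theorem IsPlane.exists_U (h : P.IsPlane E) (he : e ∈ E) :
    ∃ U ∈ P.fc (E \ {e}), P.int e ⊆ U ∧ (∀ F ∈ P.fc E, P.Inc e F ↔ F ⊆ U) ∧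
      (∀ F ∈ P.fc E, (F ∩ U).Nonempty → F ⊆ U) ∧ ∃ F ∈ P.fc E, F ⊆ U := by
  obtain ⟨a, b, -, rfl⟩ := h.exists_ends he
  obtain ⟨U, hU, hUe⟩ := (h.addArc he).exists_U
  refine ⟨U, hU, ?_, ?_, ?_, ?_⟩
  · rw [h.int_eq he]; exact hUe
  · intro F hF
    rw [Inc, h.int_eq he]
    exact (h.addArc he).adj_iff hU hUe (by rw [K_insert he]; exact hF)
  · intro F hF
    exact (h.addArc he).face_sub_of_meet hU (by rw [K_insert he]; exact hF)
  · have := (h.addArc he).adj_nonempty hU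
    rw [K_insert he] at this
    exact this

theorem reach_arc (h : P.IsPlane E) (hr : (SimpleGraph.fromEdgeSet E).Reachable a b) (hab : a ≠ b) :
    ∃ A, IsArc A (P.pos a) (P.pos b) ∧ A ⊆ P.K E := by
  obtain ⟨w⟩ := hr
  have : a = b ∨ ∃ A, IsArc A (P.pos a) (P.pos b) ∧ A ⊆ P.K E := by
    clear hab
    induction w with
    | nil => exact Or.inl rfl
    | @cons u v w huv _ ih =>
      rw [SimpleGraph.fromEdgeSet_adj] at huv
      by_cases huw : u = w
      · exact Or.inl huw
      right
      have h1 := h.isArc u v huv.1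
      have h2 := arc_sub_K (P := P) huv.1
      rcases ih with rfl | ⟨A, hA, hAK⟩
      · exact ⟨_, h1, h2⟩
      · obtain ⟨R, hR, hR'⟩ := h1.splice hA (h.inj.ne huw)
        exact ⟨R, hR, hR'.trans (union_subset h2 hAK)⟩
  exact this.resolve_left hab

theorem IsPlane.adj_two (h : P.IsPlane E) (he : s(a, b) ∈ E) (hnb : NonBridge E a b) :
    ∃ F₁ F₂, F₁ ≠ F₂ ∧ P.adjF E s(a, b) = {F₁, F₂} := by
  obtain ⟨U, hU, hUe⟩ := (h.addArc he).exists_U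
  obtain ⟨A, hA, hAK⟩ := reach_arc (h.mono sdiff_subset) hnb (h.ne he)
  obtain ⟨F₁, hF₁, F₂, hF₂, s1, s2, hne⟩ := (h.addArc he).adj_two hU hUe hA hAK
  refine ⟨F₁, F₂, hne, ?_⟩
  have hiff := fun F => (h.addArc he).adj_iff (F := F) hU hUe
  have hle := fun F => (h.addArc he).adj_le_two hU (F₃ := F) hF₁ hF₂
  rw [K_insert he] at hF₁ hF₂ hiff hle
  ext F
  simp only [adjF, Inc, mem_ofPred_eq, fc, mem_insert_iff, mem_singleton_iff, h.int_eq he]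
  constructor
  · rintro ⟨hF, hi⟩
    rw [hiff F hF] at hi
    rcases hle F hF s1 s2 hi with hh | hh | hh
    · exact absurd hh hne
    · exact Or.inl hh.symm
    · exact Or.inr hh.symm
  · rintro (rfl | rfl)
    · exact ⟨hF₁, (hiff _ hF₁).2 s1⟩
    · exact ⟨hF₂, (hiff _ hF₂).2 s2⟩

theorem IsPlane.adj_one (h : P.IsPlane E) (he : s(a, b) ∈ E) (hnb : ¬ NonBridge E a b) :
    ∃ F₁, P.adjF E s(a, b) = {F₁} := by
  obtain ⟨U, hU, hUe⟩ := (h.addArc he).exists_U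
  obtain ⟨F₁, hF₁, s1⟩ := (h.addArc he).adj_nonempty hU
  refine ⟨F₁, ?_⟩
  have hiff := fun F => (h.addArc he).adj_iff (F := F) hU hUe
  set E' := E \ {s(a, b)} with hE'
  have h' : P.IsPlane E' := h.mono sdiff_subset
  let C : Set N := {n | (SimpleGraph.fromEdgeSet E').Reachable a n}
  have hC : ∀ u v, s(u, v) ∈ E' → (u ∈ C ↔ v ∈ C) := by
    intro u v huv
    have hadj : (SimpleGraph.fromEdgeSet E').Adj u v := by
      rw [SimpleGraph.fromEdgeSet_adj]; exact ⟨huv, h'.ne huv⟩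
    exact ⟨fun hu => SimpleGraph.Reachable.trans hu hadj.reachable,
      fun hu => SimpleGraph.Reachable.trans hu hadj.symm.reachable⟩
  let G : Set N → Set Pl := fun D => P.pos '' D ∪ ⋃ f ∈ {f ∈ E' | ∀ x ∈ f, x ∈ D}, P.arc f
  have hGc : ∀ D, IsCompact (G D) := fun D =>
    ((toFinite D).image _).isCompact.union ((toFinite _).isCompact_biUnion fun _ he => h'.compact_arc he.1)
  have hKG : P.K E' = G C ∪ G Cᶜ := by
    apply Subset.antisymm
    · rintro x (⟨n, rfl⟩ | hx)
      · by_cases hn : n ∈ C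
        · exact Or.inl (Or.inl ⟨n, hn, rfl⟩)
        · exact Or.inr (Or.inl ⟨n, hn, rfl⟩)
      · simp only [mem_iUnion] at hx
        obtain ⟨f, hf, hx⟩ := hx
        induction f using Sym2.ind with
        | _ u v =>
          by_cases hu : u ∈ C
          · refine Or.inl (Or.inr (mem_biUnion ⟨hf, ?_⟩ hx))
            intro y hy
            rw [Sym2.mem_iff] at hy
            rcases hy with rfl | rfl
            · exact hu
            · exact (hC _ _ hf).1 hu
          · refine Or.inr (Or.inr (mem_biUnion ⟨hf, ?_⟩ hx))
            intro y hy
            rw [Sym2.mem_iff] at hy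
            rcases hy with rfl | rfl
            · exact hu
            · exact fun hh => hu ((hC _ _ hf).2 hh)
    · have : ∀ D, G D ⊆ P.K E' := by
        intro D
        refine union_subset_union (image_subset_range _ _) (biUnion_mono ?_ fun _ _ => subset_rfl)
        exact fun f hf => hf.1
      exact union_subset (this _) (this _)
  have hd : Disjoint (G C) (G Cᶜ) := by
    have key : ∀ D n, P.pos n ∈ G D → n ∈ D := by
      rintro D n (⟨m, hm, hmn⟩ | hx)
      · rwa [← h.inj hmn]
      · simp only [mem_iUnion] at hx
        obtain ⟨f, hf, hx⟩ := hx
        exact hf.2 n (h'.inc f hf.1 n hx)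
    rw [disjoint_left]
    intro x hx1 hx2
    have hxr : x ∈ range P.pos := by
      rcases hx1 with ⟨n, -, rfl⟩ | hx1
      · exact ⟨n, rfl⟩
      rcases hx2 with ⟨n, -, rfl⟩ | hx2
      · exact ⟨n, rfl⟩
      simp only [mem_iUnion] at hx1 hx2
      obtain ⟨f, hf, hxf⟩ := hx1
      obtain ⟨g, hg, hxg⟩ := hx2
      refine h'.disj f hf.1 g hg.1 ?_ ⟨hxf, hxg⟩
      rintro rfl
      obtain ⟨u, v, -, rfl⟩ := h'.exists_ends hf.1
      exact hg.2 u (Sym2.mem_mk_left _ _) (hf.2 u (Sym2.mem_mk_left _ _))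
    obtain ⟨n, rfl⟩ := hxr
    exact key _ n hx2 (key _ n hx1)
  have haC : a ∈ C := SimpleGraph.Reachable.refl a
  have hbC : b ∈ Cᶜ := hnb
  have hone := fun F => (h.addArc he).adj_one (F₂ := F) hU hKG (hGc _) (hGc _) hd (Or.inl ⟨a, haC, rfl⟩)
    (Or.inl ⟨b, hbC, rfl⟩) hF₁
  rw [K_insert he] at hF₁ hiff hone
  ext F
  simp only [adjF, Inc, mem_ofPred_eq, fc, mem_singleton_iff, h.int_eq he]
  constructor
  · rintro ⟨hF, hi⟩
    rw [hiff F hF] at hi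
    exact (hone F hF s1 hi).symm
  · rintro rfl
    exact ⟨hF₁, (hiff _ hF₁).2 s1⟩

theorem IsPlane.adj_finite (h : P.IsPlane E) (he : e ∈ E) : (P.adjF E e).Finite := by
  obtain ⟨a, b, -, rfl⟩ := h.exists_ends he
  by_cases hnb : NonBridge E a b
  · obtain ⟨F₁, F₂, -, hh⟩ := h.adj_two he hnb
    rw [hh]; simp
  · obtain ⟨F₁, hh⟩ := h.adj_one he hnb
    rw [hh]; simp

theorem IsPlane.adj_card_le (h : P.IsPlane E) (he : e ∈ E) : (P.adjF E e).ncard ≤ 2 := by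
  obtain ⟨a, b, -, rfl⟩ := h.exists_ends he
  by_cases hnb : NonBridge E a b
  · obtain ⟨F₁, F₂, hne, hh⟩ := h.adj_two he hnb
    rw [hh, ncard_pair hne]
  · obtain ⟨F₁, hh⟩ := h.adj_one he hnb
    rw [hh, ncard_singleton]; norm_num

theorem IsPlane.faces_step (h : P.IsPlane E) (he : e ∈ E) : ∃ U ∈ P.fc (E \ {e}),
    P.fc E = (P.fc (E \ {e}) \ {U}) ∪ P.adjF E e ∧ Disjoint (P.fc (E \ {e}) \ {U}) (P.adjF E e) := by
  obtain ⟨a, b, -, rfl⟩ := h.exists_ends he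
  obtain ⟨U, hU, hUe⟩ := (h.addArc he).exists_U
  have hiff := fun F => (h.addArc he).adj_iff (F := F) hU hUe
  have heq := (h.addArc he).faces_eq hU hUe
  have hold := fun G => (h.addArc he).face_of_old (G := G) hU hUe
  rw [K_insert he] at hiff heq
  have hset : P.adjF E s(a, b) = {F ∈ Faces (P.K E) | F ⊆ U} := by
    ext F
    simp only [adjF, Inc, mem_ofPred_eq, fc, h.int_eq he]
    constructor
    · rintro ⟨hF, hi⟩
      exact ⟨hF, (hiff F hF).1 hi⟩
    · rintro ⟨hF, hi⟩
      exact ⟨hF, (hiff F hF).2 hi⟩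
  refine ⟨U, hU, ?_, ?_⟩
  · rw [hset]; exact heq
  · rw [hset, disjoint_left]
    rintro G ⟨hG, hGU⟩ ⟨-, hs⟩
    exact (hold G hG hGU).2 hs

theorem fc_empty : P.fc ∅ = {(range P.pos)ᶜ} := by
  have hK : P.K ∅ = range P.pos := by simp [K]
  have hc : IsConnected (range P.pos)ᶜ :=
    (finite_range P.pos).countable.isConnected_compl_of_one_lt_rank one_lt_rank_Pl
  have key : ∀ x ∉ range P.pos, connectedComponentIn (range P.pos)ᶜ x = (range P.pos)ᶜ := fun x hx =>
    (connectedComponentIn_subset _ _).antisymm (hc.isPreconnected.subset_connectedComponentIn hx subset_rfl)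
  ext F
  simp only [fc, Faces, hK, mem_ofPred_eq, mem_singleton_iff]
  constructor
  · rintro ⟨x, hx, rfl⟩
    exact key x hx
  · rintro rfl
    obtain ⟨x, hx⟩ := hc.nonempty
    exact ⟨x, hx, (key x hx).symm⟩

theorem IsPlane.faces_finite (h : P.IsPlane E) : (P.fc E).Finite := by
  have hE := toFinite E
  induction E, hE using Set.Finite.induction_on with
  | empty => rw [fc_empty]; simp
  | @insert e S he hS ih =>
    obtain ⟨U, hU, heq, -⟩ := h.faces_step (mem_insert e S)
    have : insert e S \ {e} = S := by simp [he]
    rw [this] at heq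
    rw [heq]
    exact ((ih (h.mono (subset_insert _ _))).subset sdiff_subset).union (h.adj_finite (mem_insert e S))

theorem IsPlane.nf_step (h : P.IsPlane E) (he : e ∈ E) :
    (P.fc E).ncard + 1 = (P.fc (E \ {e})).ncard + (P.adjF E e).ncard := by
  obtain ⟨U, hU, heq, hd⟩ := h.faces_step he
  have hfin := (h.mono (sdiff_subset : E \ {e} ⊆ E)).faces_finite
  rw [heq, ncard_union_eq hd (hfin.subset sdiff_subset) (h.adj_finite he)]
  have := ncard_sdiff_singleton_add_one hU hfin
  omega

theorem IsPlane.nf_nonbridge (h : P.IsPlane E) (he : s(a, b) ∈ E) (hnb : NonBridge E a b) :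
    (P.fc E).ncard = (P.fc (E \ {s(a, b)})).ncard + 1 := by
  have := h.nf_step he
  obtain ⟨F₁, F₂, hne, hh⟩ := h.adj_two he hnb
  rw [hh, ncard_pair hne] at this
  omega

theorem IsPlane.nf_bridge (h : P.IsPlane E) (he : s(a, b) ∈ E) (hnb : ¬ NonBridge E a b) :
    (P.fc E).ncard = (P.fc (E \ {s(a, b)})).ncard := by
  have := h.nf_step he
  obtain ⟨F₁, hh⟩ := h.adj_one he hnb
  rw [hh, ncard_singleton] at this
  omega

end PD
end PT

namespace PT
open Topology

namespace PD
variable {N : Type*} {P : PD N} {E E' : Set (Sym2 N)} {a b n : N} {e f : Sym2 N} {F F' : Set Pl}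

theorem isBridge_iff' : (SimpleGraph.fromEdgeSet E).IsBridge s(a, b) ↔ ¬ NonBridge E a b := by
  rw [SimpleGraph.isBridge_iff, NonBridge, SimpleGraph.deleteEdges, SimpleGraph.fromEdgeSet_sdiff]

theorem IsPlane.edgeSet [Finite N] (h : P.IsPlane E) : (SimpleGraph.fromEdgeSet E).edgeSet = E := by
  rw [SimpleGraph.edgeSet_fromEdgeSet]
  refine sdiff_eq_left.2 ?_
  rw [disjoint_left]
  intro e he hd
  obtain ⟨a, b, hab, rfl⟩ := h.exists_ends he
  exact hab (by simpa using hd)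

theorem IsPlane.acyclic [Finite N] (h : P.IsPlane E) (hb : ∀ a b, s(a, b) ∈ E → ¬ NonBridge E a b) :
    (SimpleGraph.fromEdgeSet E).IsAcyclic := by
  rw [SimpleGraph.isAcyclic_iff_forall_isBridge]
  intro e he
  rw [h.edgeSet] at he
  induction e using Sym2.ind with
  | _ u v => exact isBridge_iff'.2 (hb u v he)

variable [Finite N]

theorem IsPlane.nf_acyclic (h : P.IsPlane E) (ha : (SimpleGraph.fromEdgeSet E).IsAcyclic) :
    (P.fc E).ncard = 1 := by
  have hE := toFinite E
  induction E, hE using Set.Finite.induction_on with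
  | empty => rw [fc_empty]; simp
  | @insert e S he hS ih =>
    have h' := h.mono (subset_insert e S)
    obtain ⟨a, b, -, rfl⟩ := h.exists_ends (mem_insert e S)
    rw [h.nf_bridge (mem_insert _ S)]
    · rw [insert_sdiff_self_of_notMem he]
      exact ih h' (ha.anti (SimpleGraph.fromEdgeSet_mono (subset_insert _ _)))
    · rw [← isBridge_iff']
      apply (SimpleGraph.isAcyclic_iff_forall_isBridge.1 ha)
      rw [h.edgeSet]; exact mem_insert _ _

theorem card_acyclic [Nonempty N] {G : SimpleGraph N} (hG : G.IsAcyclic) :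
    G.edgeSet.ncard + 1 ≤ Nat.card N := by
  classical
  have := Fintype.ofFinite N
  obtain ⟨T, -, hGT, hT⟩ : ∃ T, T ≤ (⊤ : SimpleGraph N) ∧ G ≤ T ∧ T.IsTree := by
    have := SimpleGraph.Connected.exists_isTree_le_of_le_of_isAcyclic (G := (⊤ : SimpleGraph N)) (H := G)
      SimpleGraph.connected_top le_top hG
    grind
  have h1 := hT.card_edgeFinset
  have h2 : G.edgeSet.ncard ≤ T.edgeSet.ncard :=
    ncard_le_ncard (SimpleGraph.edgeSet_mono hGT) (toFinite _)
  rw [Nat.card_eq_fintype_card, ← h1, ← SimpleGraph.coe_edgeFinset T, ncard_coe_finset] at *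
  omega

theorem card_tree {G : SimpleGraph N} (hG : G.IsTree) :
    G.edgeSet.ncard + 1 = Nat.card N := by
  classical
  have := Fintype.ofFinite N
  have h1 := hG.card_edgeFinset
  rw [Nat.card_eq_fintype_card, ← h1, ← SimpleGraph.coe_edgeFinset G, ncard_coe_finset]

theorem reach_remove (hnb : NonBridge E a b) {u v : N} (h : (SimpleGraph.fromEdgeSet E).Reachable u v) :
    (SimpleGraph.fromEdgeSet (E \ {s(a, b)})).Reachable u v := by
  obtain ⟨w⟩ := h
  induction w with
  | nil => exact SimpleGraph.Reachable.refl _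
  | @cons x y z hxy _ ih =>
    refine SimpleGraph.Reachable.trans ?_ ih
    by_cases hh : s(x, y) = s(a, b)
    · rw [Sym2.eq_iff] at hh
      rcases hh with ⟨rfl, rfl⟩ | ⟨rfl, rfl⟩
      · exact hnb
      · exact hnb.symm
    · rw [SimpleGraph.fromEdgeSet_adj] at hxy
      apply SimpleGraph.Adj.reachable
      rw [SimpleGraph.fromEdgeSet_adj]
      exact ⟨⟨hxy.1, hh⟩, hxy.2⟩

theorem IsPlane.euler_le [Nonempty N] (h : P.IsPlane E) : E.ncard + 2 ≤ (P.fc E).ncard + Nat.card N := by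
  induction hk : E.ncard using Nat.strong_induction_on generalizing E with
  | _ k ih =>
    by_cases hb : ∀ a b, s(a, b) ∈ E → ¬ NonBridge E a b
    · have ha := h.acyclic hb
      have h1 := h.nf_acyclic ha
      have h2 := card_acyclic ha
      rw [h.edgeSet] at h2
      omega
    · push Not at hb
      obtain ⟨a, b, he, hnb⟩ := hb
      have h1 := h.nf_nonbridge he hnb
      have h2 := ncard_sdiff_singleton_add_one he
      have h3 := ih (E \ {s(a, b)}).ncard (by omega) (h.mono sdiff_subset) rfl
      omega

theorem IsPlane.euler_eq (h : P.IsPlane E) (hc : (SimpleGraph.fromEdgeSet E).Connected) :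
    E.ncard + 2 = (P.fc E).ncard + Nat.card N := by
  induction hk : E.ncard using Nat.strong_induction_on generalizing E with
  | _ k ih =>
    by_cases hb : ∀ a b, s(a, b) ∈ E → ¬ NonBridge E a b
    · have ha := h.acyclic hb
      have h1 := h.nf_acyclic ha
      have h2 := card_tree (SimpleGraph.IsTree.mk hc ha)
      rw [h.edgeSet] at h2
      omega
    · push Not at hb
      obtain ⟨a, b, he, hnb⟩ := hb
      have h1 := h.nf_nonbridge he hnb
      have h2 := ncard_sdiff_singleton_add_one he
      have h3 := ih (E \ {s(a, b)}).ncard (by omega) (h.mono sdiff_subset)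
        ((SimpleGraph.connected_iff _).2 ⟨fun u v => reach_remove hnb (hc.preconnected u v), hc.nonempty⟩) rfl
      omega

/-- A face is a face of its own boundary. -/
theorem IsPlane.face_bd (h : P.IsPlane E) (hF : F ∈ P.fc E) : F ∈ P.fc (P.bd E F) := by
  refine face_shrink h.closed hF (K_mono (sep_subset _ _)) ?_
  intro x hx
  have hxc := frontier_subset_closure hx
  have hxK := face_frontier h.closed hF hx
  by_cases hxr : x ∈ range P.pos
  · exact Or.inl hxr
  rcases hxK with hxK | hxK
  · exact Or.inl hxK
  simp only [mem_iUnion] at hxK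
  obtain ⟨e, he, hxe⟩ := hxK
  exact Or.inr (mem_biUnion ⟨he, x, ⟨hxe, hxr⟩, hxc⟩ hxe)

theorem IsPlane.mem_fc_of_bd (h : P.IsPlane E) (hF : F ∈ P.fc E) (hE : E' ⊆ E) (hb : P.bd E F ⊆ E') :
    F ∈ P.fc E' := by
  refine face_shrink h.closed hF (K_mono hE) ?_
  refine Subset.trans ?_ (K_mono hb)
  have := h.face_bd hF
  exact face_frontier (h.mono (sep_subset _ _)).closed this

/-- two distinct faces at an edge: removing the nonbridge -/
theorem IsPlane.D2 (h : P.IsPlane E) (hF : F ∈ P.fc E) (he : s(a, b) ∈ P.bd E F) (hnb : NonBridge E a b) :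
    ∃ c, c ≠ b ∧ s(a, c) ∈ P.bd E F := by
  by_contra hcon
  push Not at hcon
  have hbE : P.bd E F ⊆ E := sep_subset _ _
  have hB := h.mono hbE
  have hab := hB.ne he
  have hbr : ¬ NonBridge (P.bd E F) a b := by
    rintro ⟨w⟩
    cases w with
    | nil => exact hab rfl
    | @cons _ c _ hc _ =>
      rw [SimpleGraph.fromEdgeSet_adj] at hc
      have : c = b := by
        by_contra hcb
        exact hcon c hcb hc.1.1
      subst this
      exact hc.1.2 rfl
  obtain ⟨F₁, F₂, hne, hadj⟩ := h.adj_two he.1 hnb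
  obtain ⟨F₀, hF₀⟩ := hB.adj_one he hbr
  have hFa : F ∈ P.adjF E s(a, b) := ⟨hF, he.2⟩
  obtain ⟨G, hG, hGF⟩ : ∃ G ∈ P.adjF E s(a, b), G ≠ F := by
    rw [hadj] at hFa ⊢
    rcases hFa with rfl | rfl
    · exact ⟨F₂, Or.inr rfl, hne.symm⟩
    · exact ⟨F₁, Or.inl rfl, hne⟩
  -- the face of bd containing G
  obtain ⟨x, hx⟩ := face_nonempty hG.1
  have hxK : x ∉ P.K (P.bd E F) := fun hh => face_sub hG.1 hx (K_mono hbE hh)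
  obtain ⟨H, hH, hxH⟩ := exists_face hxK
  have hGH : G ⊆ H := face_max hH (face_conn hG.1)
    ((face_sub hG.1).trans (compl_subset_compl.2 (K_mono hbE))) ⟨x, hx, hxH⟩
  have hHa : H ∈ P.adjF (P.bd E F) s(a, b) := by
    refine ⟨hH, ?_⟩
    obtain ⟨y, hy1, hy2⟩ := hG.2
    exact ⟨y, hy1, closure_mono hGH hy2⟩
  have hFa' : F ∈ P.adjF (P.bd E F) s(a, b) := ⟨h.face_bd hF, he.2⟩
  rw [hF₀] at hHa hFa'
  have : H = F := hHa.trans hFa'.symm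
  subst this
  exact hGF (face_eq hG.1 hF hx hxH)

end PD
end PT

namespace PT
open Topology

namespace PD
variable {N : Type*} {P : PD N} {E E' : Set (Sym2 N)} {a b n : N} {e f : Sym2 N} {F F' : Set Pl}
variable [Finite N]

theorem IsPlane.adj_nonempty (h : P.IsPlane E) (he : e ∈ E) : (P.adjF E e).Nonempty := by
  obtain ⟨U, hU, hUe, hiff, -, F, hF, hFU⟩ := h.exists_U he
  exact ⟨F, hF, (hiff F hF).2 hFU⟩

/-- nice neighbourhoods of open edges -/
theorem IsPlane.exists_V (h : P.IsPlane E) (he : e ∈ E) :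
    ∃ U, IsOpen U ∧ P.int e ⊆ U ∧ ∀ x ∈ U, x ∈ P.int e ∨ ∃ F ∈ P.adjF E e, x ∈ F := by
  obtain ⟨U, hU, hUe, hiff, hmeet, -⟩ := h.exists_U he
  refine ⟨U, face_open (h.mono sdiff_subset).closed hU, hUe, ?_⟩
  intro x hx
  by_cases hxK : x ∈ P.K E
  · left
    rw [← K_insert he] at hxK
    have hx' := face_sub hU hx
    rcases hxK with hxK | hxK
    · exact absurd hxK hx'
    · exact ⟨hxK, fun hh => hx' (Or.inl hh)⟩
  · right
    obtain ⟨F, hF, hxF⟩ := exists_face hxK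
    exact ⟨F, ⟨hF, (hiff F hF).2 (hmeet F hF ⟨x, hxF, hx⟩)⟩, hxF⟩

/-- the part of the drawing not incident to the node `n` -/
def far (P : PD N) (E : Set (Sym2 N)) (n : N) : Set Pl :=
  P.pos '' {m | m ≠ n} ∪ ⋃ e ∈ {e ∈ E | n ∉ e}, P.arc e

theorem IsPlane.far_compact (h : P.IsPlane E) : IsCompact (P.far E n) :=
  ((toFinite _).image _).isCompact.union
    ((toFinite _).isCompact_biUnion fun _ he => h.compact_arc he.1)

theorem IsPlane.notMem_far (h : P.IsPlane E) : P.pos n ∉ P.far E n := by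
  rintro (⟨m, hm, hmn⟩ | hx)
  · exact hm (h.inj hmn)
  · simp only [mem_iUnion] at hx
    obtain ⟨f, hf, hx⟩ := hx
    exact hf.2 (h.inc f hf.1 n hx)

/-- Corner lemma. -/
theorem IsPlane.corner (h : P.IsPlane E) {𝓕 : Set (Set Pl)} (h𝓕 : 𝓕 ⊆ P.fc E)
    (hdich : ∀ e ∈ E, n ∈ e → P.adjF E e ⊆ 𝓕 ∨ Disjoint (P.adjF E e) 𝓕)
    (hF : F ∈ 𝓕) (hn : P.pos n ∈ closure F) (he : e ∈ E) (hne : n ∈ e) : P.adjF E e ⊆ 𝓕 := by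
  obtain ⟨r, hr, hB⟩ := Metric.isOpen_iff.1 (h.far_compact (n := n)).isClosed.isOpen_compl _ h.notMem_far
  set p := P.pos n with hp
  choose! U hUo hUe hUx using fun e (he : e ∈ E) => h.exists_V he
  let X : Set Pl := (⋃ F ∈ 𝓕, F) ∪ ⋃ e ∈ {e ∈ E | P.adjF E e ⊆ 𝓕}, U e
  let Y : Set Pl := (⋃ F ∈ P.fc E \ 𝓕, F) ∪ ⋃ e ∈ {e ∈ E | Disjoint (P.adjF E e) 𝓕}, U e
  have hXo : IsOpen X := (isOpen_biUnion fun F hF => face_open h.closed (h𝓕 hF)).union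
    (isOpen_biUnion fun e he => hUo e he.1)
  have hYo : IsOpen Y := (isOpen_biUnion fun F hF => face_open h.closed hF.1).union
    (isOpen_biUnion fun e he => hUo e he.1)
  have hXY : Disjoint X Y := by
    have key1 : ∀ x ∈ X, (∃ F ∈ 𝓕, x ∈ F) ∨ ∃ e ∈ E, P.adjF E e ⊆ 𝓕 ∧ x ∈ P.int e := by
      rintro x (hx | hx)
      · simp only [mem_iUnion] at hx
        obtain ⟨F, hF, hx⟩ := hx
        exact Or.inl ⟨F, hF, hx⟩
      · simp only [mem_iUnion] at hx
        obtain ⟨e, he, hx⟩ := hx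
        rcases hUx e he.1 x hx with hx | ⟨F, hF, hx⟩
        · exact Or.inr ⟨e, he.1, he.2, hx⟩
        · exact Or.inl ⟨F, he.2 hF, hx⟩
    have key2 : ∀ x ∈ Y, (∃ F ∈ P.fc E \ 𝓕, x ∈ F) ∨ ∃ e ∈ E, Disjoint (P.adjF E e) 𝓕 ∧ x ∈ P.int e := by
      rintro x (hx | hx)
      · simp only [mem_iUnion] at hx
        obtain ⟨F, hF, hx⟩ := hx
        exact Or.inl ⟨F, hF, hx⟩
      · simp only [mem_iUnion] at hx
        obtain ⟨e, he, hx⟩ := hx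
        rcases hUx e he.1 x hx with hx | ⟨F, hF, hx⟩
        · exact Or.inr ⟨e, he.1, he.2, hx⟩
        · exact Or.inl ⟨F, ⟨hF.1, fun hh => disjoint_left.1 he.2 hF hh⟩, hx⟩
    have keyF : ∀ G ∈ P.fc E, ∀ e ∈ E, ∀ x ∈ G, x ∉ P.int e := by
      intro G hG e he x hx hxe
      exact face_sub hG hx (arc_sub_K he hxe.1)
    rw [disjoint_left]
    intro x hx hy
    rcases key1 x hx with ⟨F, hF, hxF⟩ | ⟨e, he, hea, hxe⟩
    · rcases key2 x hy with ⟨G, hG, hxG⟩ | ⟨g, hg, hga, hxg⟩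
      · exact hG.2 (face_eq (h𝓕 hF) hG.1 hxF hxG ▸ hF)
      · exact keyF F (h𝓕 hF) g hg x hxF hxg
    · rcases key2 x hy with ⟨G, hG, hxG⟩ | ⟨g, hg, hga, hxg⟩
      · exact keyF G hG.1 e he x hxG hxe
      · by_cases heg : e = g
        · subst heg
          obtain ⟨G, hG⟩ := h.adj_nonempty he
          exact disjoint_left.1 hga hG (hea hG)
        · exact hxe.2 (h.disj e he g hg heg ⟨hxe.1, hxg.1⟩)
  have hcov : Metric.ball p r \ {p} ⊆ X ∪ Y := by
    rintro x ⟨hx, hxp⟩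
    by_cases hxK : x ∈ P.K E
    · have hxf := hB hx
      have hxr : x ∉ range P.pos := by
        rintro ⟨m, rfl⟩
        by_cases hmn : m = n
        · subst hmn; exact hxp rfl
        · exact hxf (Or.inl ⟨m, hmn, rfl⟩)
      rcases hxK with hxK | hxK
      · exact absurd hxK hxr
      simp only [mem_iUnion] at hxK
      obtain ⟨g, hg, hxg⟩ := hxK
      have hng : n ∈ g := by
        by_contra hng
        exact hxf (Or.inr (mem_biUnion ⟨hg, hng⟩ hxg))
      rcases hdich g hg hng with hd | hd
      · exact Or.inl (Or.inr (mem_biUnion ⟨hg, hd⟩ (hUe g hg ⟨hxg, hxr⟩)))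
      · exact Or.inr (Or.inr (mem_biUnion ⟨hg, hd⟩ (hUe g hg ⟨hxg, hxr⟩)))
    · obtain ⟨G, hG, hxG⟩ := exists_face hxK
      by_cases hG𝓕 : G ∈ 𝓕
      · exact Or.inl (Or.inl (mem_biUnion hG𝓕 hxG))
      · exact Or.inr (Or.inl (mem_biUnion ⟨hG, hG𝓕⟩ hxG))
  have hconn : IsPreconnected (Metric.ball p r \ {p}) := by
    apply isPreconnected_of_forall_pair
    intro x hx y hy
    obtain ⟨C, hC⟩ := con_punctured hx.1 hy.1 hx.2 hy.2
    exact ⟨C, by tauto⟩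
  have hmeetX : ((Metric.ball p r \ {p}) ∩ X).Nonempty := by
    obtain ⟨x, hxb, hxF⟩ := mem_closure_iff_nhds.1 hn _ (Metric.ball_mem_nhds p hr)
    refine ⟨x, ⟨hxb, ?_⟩, Or.inl (mem_biUnion hF hxF)⟩
    rintro rfl
    exact face_sub (h𝓕 hF) hxF pos_mem_K
  have hsub : Metric.ball p r \ {p} ⊆ X := hconn.subset_left_of_subset_union hXo hYo hXY hcov hmeetX
  rcases hdich e he hne with hd | hd
  · exact hd
  exfalso
  obtain ⟨c, rfl⟩ := hne
  obtain ⟨y, hyB, hy⟩ : ∃ y ∈ Metric.ball p r, y ∈ P.int s(n, c) := by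
    rw [h.int_eq he]
    obtain ⟨y, hy⟩ := (h.isArc n c he).int_dense (h.isArc n c he).left_mem (Metric.ball_mem_nhds p hr)
    grind
  have hyp : y ∉ ({p} : Set Pl) := by
    rintro rfl
    exact hy.2 ⟨n, rfl⟩
  exact disjoint_left.1 hXY (hsub ⟨hyB, hyp⟩) (Or.inr (mem_biUnion ⟨he, hd⟩ (hUe _ he hy)))

theorem IsPlane.touch (h : P.IsPlane E) (hF : F ∈ P.fc E) (hn : P.pos n ∈ closure F) (he : e ∈ E)
    (hne : n ∈ e) : ∃ c, s(n, c) ∈ P.bd E F := by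
  by_contra hcon
  push Not at hcon
  have hnot : ∀ g ∈ E, n ∈ g → F ∉ P.adjF E g := by
    rintro g hg ⟨c, rfl⟩ hF'
    exact hcon c ⟨hg, hF'.2⟩
  have := h.corner (n := n) (𝓕 := {F}) (by simpa using hF) (fun g hg hng => Or.inr (by
    rw [disjoint_singleton_right]; exact hnot g hg hng)) rfl hn he hne
  obtain ⟨G, hG⟩ := h.adj_nonempty he
  have hGF : G = F := this hG
  subst hGF
  exact hnot e he hne hG

theorem IsPlane.bd_pos (h : P.IsPlane E) (hF : F ∈ P.fc E) (he : s(a, b) ∈ P.bd E F) :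
    P.pos a ∈ closure F :=
  h.spread he.1 hF he.2 (h.isArc a b he.1).left_mem

end PD
end PT

namespace PT
open Topology

namespace PD
variable {N : Type*} {P : PD N} {E E' : Set (Sym2 N)} {a b n : N} {e f : Sym2 N} {F F' : Set Pl}

def BF (E : Set (Sym2 N)) : Prop := ∀ a b, s(a, b) ∈ E → NonBridge E a b

def MinDeg (S : Set (Sym2 N)) : Prop := S.Nonempty ∧ ∀ a b, s(a, b) ∈ S → ∃ c, c ≠ b ∧ s(a, c) ∈ S

variable [Finite N]

theorem IsPlane.double (h : P.IsPlane E) :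
    ∑ F ∈ h.faces_finite.toFinset, (P.bd E F).ncard = ∑ e ∈ (toFinite E).toFinset, (P.adjF E e).ncard := by
  classical
  have := Finset.sum_card_bipartiteAbove_eq_sum_card_bipartiteBelow
    (s := h.faces_finite.toFinset) (t := (toFinite E).toFinset) (fun F e => P.Inc e F)
  convert this using 2 with F hF e he
  · rw [← ncard_coe_finset]
    congr 1
    ext e
    simp [Finset.bipartiteAbove, bd]
  · rw [← ncard_coe_finset]
    congr 1
    ext e
    simp [Finset.bipartiteBelow, adjF]

theorem IsPlane.double_le (h : P.IsPlane E) :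
    ∑ F ∈ h.faces_finite.toFinset, (P.bd E F).ncard ≤ 2 * E.ncard := by
  rw [h.double]
  refine (Finset.sum_le_card_nsmul _ _ 2 ?_).trans ?_
  · intro e he
    exact h.adj_card_le (by simpa using he)
  · rw [smul_eq_mul, mul_comm, ← ncard_eq_toFinset_card]

theorem IsPlane.double_eq (h : P.IsPlane E) (hb : BF E) :
    ∑ F ∈ h.faces_finite.toFinset, (P.bd E F).ncard = 2 * E.ncard := by
  rw [h.double, Finset.sum_const_nat (m := 2), mul_comm, ← ncard_eq_toFinset_card]
  intro e he
  simp only [Finite.mem_toFinset] at he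
  induction e using Sym2.ind with
  | _ u v =>
    obtain ⟨F₁, F₂, hne, hh⟩ := h.adj_two he (hb u v he)
    rw [hh, ncard_pair hne]

theorem IsPlane.exists_bf (h : P.IsPlane E) : ∃ E₀ ⊆ E, BF E₀ ∧ (P.fc E₀).ncard = (P.fc E).ncard := by
  induction hk : E.ncard using Nat.strong_induction_on generalizing E with
  | _ k ih =>
    by_cases hb : BF E
    · exact ⟨E, subset_rfl, hb, rfl⟩
    · unfold BF at hb
      push Not at hb
      obtain ⟨a, b, he, hnb⟩ := hb
      have h2 := ncard_sdiff_singleton_add_one he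
      obtain ⟨E₀, h3, h4, h5⟩ := ih (E \ {s(a, b)}).ncard (by omega) (h.mono sdiff_subset) rfl
      exact ⟨E₀, h3.trans sdiff_subset, h4, h5.trans (h.nf_bridge he hnb).symm⟩

theorem IsPlane.bd_minDeg (h : P.IsPlane E) (hb : BF E) (hF : F ∈ P.fc E) (h2 : 2 ≤ (P.fc E).ncard) :
    MinDeg (P.bd E F) := by
  refine ⟨?_, fun a b hab => h.D2 hF hab (hb a b hab.1)⟩
  by_contra hne
  rw [not_nonempty_iff_eq_empty] at hne
  have h1 := h.face_bd hF
  rw [hne, fc_empty] at h1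
  obtain ⟨G, hG, hGF⟩ := exists_ne_of_one_lt_ncard h2 F
  obtain ⟨x, hx⟩ := face_nonempty hG
  have hxF : x ∈ F := by
    rw [mem_singleton_iff.1 h1]
    intro hh
    exact face_sub hG hx (Or.inl hh)
  exact hGF (face_eq hG hF hx hxF)

theorem IsPlane.girth (h : P.IsPlane E) {g : ℕ} (hg : ∀ S ⊆ E, MinDeg S → g ≤ S.ncard)
    (h2 : 2 ≤ (P.fc E).ncard) : g * (P.fc E).ncard ≤ 2 * E.ncard := by
  obtain ⟨E₀, hE₀, hb, hf⟩ := h.exists_bf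
  have h₀ := h.mono hE₀
  have h1 := h₀.double_le
  have h3 : E₀.ncard ≤ E.ncard := ncard_le_ncard hE₀ (toFinite _)
  have h4 := Finset.card_nsmul_le_sum h₀.faces_finite.toFinset (fun F => (P.bd E₀ F).ncard) g (by
    intro F hF
    exact hg _ ((sep_subset _ _).trans hE₀) (h₀.bd_minDeg hb (by simpa using hF) (by omega)))
  rw [← ncard_eq_toFinset_card _ h₀.faces_finite, smul_eq_mul, mul_comm] at h4
  rw [← hf]
  omega

theorem three_of_minDeg {S : Set (Sym2 N)} (hl : ∀ a, s(a, a) ∉ S) (hS : MinDeg S) : 3 ≤ S.ncard := by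
  obtain ⟨⟨e, he⟩, hd⟩ := hS
  induction e using Sym2.ind with
  | _ a b =>
    obtain ⟨c, hc, hac⟩ := hd a b he
    obtain ⟨d, hd', hbd⟩ := hd b a (Sym2.eq_swap ▸ he)
    have hab : a ≠ b := by rintro rfl; exact hl _ he
    have : ({s(a, b), s(a, c), s(b, d)} : Set (Sym2 N)).ncard = 3 := by
      rw [ncard_eq_three]
      refine ⟨_, _, _, ?_, ?_, ?_, rfl⟩ <;> grind
    rw [← this]
    apply ncard_le_ncard _ (toFinite _)
    rintro x (rfl | rfl | rfl) <;> assumption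

theorem four_of_minDeg {S : Set (Sym2 N)} (col : N → Bool) (hl : ∀ a b, s(a, b) ∈ S → col a ≠ col b)
    (hS : MinDeg S) : 4 ≤ S.ncard := by
  classical
  obtain ⟨⟨e, he⟩, hd⟩ := hS
  induction e using Sym2.ind with
  | _ a b =>
    obtain ⟨c, hc, hac⟩ := hd a b he
    obtain ⟨d, hd', hbd⟩ := hd b a (Sym2.eq_swap ▸ he)
    obtain ⟨d', hd'', hcd⟩ := hd c a (Sym2.eq_swap ▸ hac)
    have h1 := hl _ _ he
    have h2 := hl _ _ hac
    have h3 := hl _ _ hbd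
    have h4 := hl _ _ hcd
    have n1 : a ≠ b := fun hh => h1 (hh ▸ rfl)
    have n2 : a ≠ c := fun hh => h2 (hh ▸ rfl)
    have n3 : c ≠ d := by
      rintro rfl
      revert h1 h2 h3
      cases col a <;> cases col b <;> cases col c <;> simp
    have : ({s(a, b), s(a, c), s(b, d), s(c, d')} : Finset (Sym2 N)).card = 4 := by
      rw [Finset.card_insert_of_notMem, Finset.card_insert_of_notMem, Finset.card_insert_of_notMem,
        Finset.card_singleton] <;>
        simp only [Finset.mem_insert, Finset.mem_singleton, Sym2.eq_iff] <;> clear h1 h2 h3 h4 hl <;> tauto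
    rw [← this, ← ncard_coe_finset]
    apply ncard_le_ncard _ (toFinite _)
    intro x hx
    simp at hx
    rcases hx with rfl | rfl | rfl | rfl <;> assumption

theorem IsPlane.le_3n (h : P.IsPlane E) (hn : 3 ≤ Nat.card N) : E.ncard + 6 ≤ 3 * Nat.card N := by
  have : Nonempty N := (Nat.card_pos_iff.1 (by omega)).1
  have h1 := h.euler_le
  by_cases h2 : 2 ≤ (P.fc E).ncard
  · have := h.girth (g := 3) (fun S hS => three_of_minDeg fun a ha => h.ne (hS ha) rfl) h2
    omega
  · omega

/-- pulling back along an injection of nodes -/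
def comap {M : Type*} (P : PD N) (φ : M → N) : PD M := ⟨P.pos ∘ φ, fun e => P.arc (e.map φ)⟩

theorem IsPlane.comap {M : Type*} (h : P.IsPlane E) {φ : M → N} (hφ : Function.Injective φ)
    {E' : Set (Sym2 M)} (hE : ∀ e ∈ E', e.map φ ∈ E) : (P.comap φ).IsPlane E' := by
  have hinc : ∀ e ∈ E', ∀ n, P.pos n ∈ P.arc (e.map φ) → ∃ m ∈ e, φ m = n := by
    intro e he n hn
    have := h.inc _ (hE e he) n hn
    rwa [Sym2.mem_map] at this
  refine ⟨h.inj.comp hφ, fun u v huv => h.isArc _ _ (hE _ huv), ?_, ?_⟩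
  · intro e he n hn
    obtain ⟨m, hm, hmn⟩ := hinc e he _ hn
    rwa [← hφ hmn]
  · intro e he f hf hef x hx
    have := h.disj _ (hE e he) _ (hE f hf) (fun hh => hef (Sym2.map.injective hφ hh)) hx
    obtain ⟨n, rfl⟩ := this
    obtain ⟨m, hm, hmn⟩ := hinc e he _ hx.1
    exact ⟨m, by simp [PD.comap, hmn]⟩

end PD

theorem no_K33 {p q : Fin 3 → Pl} {A : Fin 3 → Fin 3 → Set Pl} (hA : ∀ i j, IsArc (A i j) (p i) (q j))
    (hp : Function.Injective p) (hq : Function.Injective q)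
    (hpA : ∀ k i j, p k ∈ A i j → k = i) (hqA : ∀ k i j, q k ∈ A i j → k = j)
    (hd : ∀ i j i' j', (i, j) ≠ (i', j') → A i j ∩ A i' j' ⊆ range p ∪ range q) : False := by
  have hpq : ∀ i j, p i ≠ q j := fun i j => (hA i j).ne
  let P : PD (Fin 3 ⊕ Fin 3) := ⟨Sum.elim p q, fun e => {x | ∃ i j, e = s(Sum.inl i, Sum.inr j) ∧ x ∈ A i j}⟩
  let φ : Fin 3 × Fin 3 → Sym2 (Fin 3 ⊕ Fin 3) := fun ij => s(Sum.inl ij.1, Sum.inr ij.2)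
  have hφ : Function.Injective φ := by
    rintro ⟨i, j⟩ ⟨i', j'⟩ hh
    simpa [φ] using hh
  have hPA : ∀ i j, P.arc s(Sum.inl i, Sum.inr j) = A i j := by
    intro i j
    ext x
    simp only [P, mem_ofPred_eq]
    constructor
    · rintro ⟨i', j', h1, h2⟩
      have := @hφ (i, j) (i', j') h1
      grind
    · intro hx
      exact ⟨i, j, rfl, hx⟩
  have hpl : P.IsPlane (range φ) := by
    refine ⟨?_, ?_, ?_, ?_⟩
    · exact hp.sumElim hq hpq
    · rintro u v ⟨⟨i, j⟩, hij⟩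
      simp only [φ, Sym2.eq_iff] at hij
      rcases hij with ⟨rfl, rfl⟩ | ⟨rfl, rfl⟩
      · rw [hPA]; exact hA i j
      · rw [Sym2.eq_swap, hPA]; exact (hA i j).symm
    · rintro _ ⟨⟨i, j⟩, rfl⟩ n hn
      simp only [φ, hPA] at hn
      rcases n with n | n
      · rw [hpA n i j hn]; simp [φ]
      · rw [hqA n i j hn]; simp [φ]
    · rintro _ ⟨⟨i, j⟩, rfl⟩ _ ⟨⟨i', j'⟩, rfl⟩ hne
      simp only [φ, hPA]
      refine (hd i j i' j' (fun hh => hne (by rw [hh]))).trans ?_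
      rintro x (⟨k, rfl⟩ | ⟨k, rfl⟩)
      · exact ⟨Sum.inl k, rfl⟩
      · exact ⟨Sum.inr k, rfl⟩
  have hcard : (range φ).ncard = 9 := by
    rw [← image_univ, ncard_image_of_injective _ hφ, ncard_univ]
    simp
  have h1 := hpl.euler_le
  rw [hcard] at h1
  have h2 : Nat.card (Fin 3 ⊕ Fin 3) = 6 := by simp
  have h3 := hpl.girth (g := 4) (by
    intro S hS
    refine PD.four_of_minDeg (fun x => x.isLeft) ?_
    intro a b hab
    obtain ⟨⟨i, j⟩, hij⟩ := hS hab
    simp only [φ, Sym2.eq_iff] at hij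
    rcases hij with ⟨rfl, rfl⟩ | ⟨rfl, rfl⟩ <;> simp) (by omega)
  omega

end PT

namespace PT
open Topology

namespace PD
variable {N : Type*} {P : PD N} {E E' : Set (Sym2 N)} {a b n : N} {e f : Sym2 N} {F F' : Set Pl}
variable [Finite N]

theorem four_le_of_touch {S : Set (Sym2 (Fin 4))} (hl : ∀ i, s(i, i) ∉ S)
    (ht : ∀ i, ∃ c d, c ≠ d ∧ s(i, c) ∈ S ∧ s(i, d) ∈ S) : 4 ≤ S.ncard := by
  classical
  set G := SimpleGraph.fromEdgeSet S with hG
  have h1 := G.sum_degrees_eq_twice_card_edges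
  have h2 : ∀ i, 2 ≤ G.degree i := by
    intro i
    obtain ⟨c, d, hcd, hc, hd⟩ := ht i
    rw [← G.card_neighborFinset_eq_degree, ← Finset.card_pair hcd]
    apply Finset.card_le_card
    intro x hx
    simp only [Finset.mem_insert, Finset.mem_singleton] at hx
    rw [SimpleGraph.mem_neighborFinset, hG, SimpleGraph.fromEdgeSet_adj]
    rcases hx with rfl | rfl
    · exact ⟨hc, fun hh => hl i (by rw [← hh] at hc; exact hc)⟩
    · exact ⟨hd, fun hh => hl i (by rw [← hh] at hd; exact hd)⟩
  have h3 := Finset.card_nsmul_le_sum Finset.univ (fun i => G.degree i) 2 (fun i _ => h2 i)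
  rw [← ncard_coe_finset, SimpleGraph.coe_edgeFinset] at h1
  have h4 : G.edgeSet.ncard ≤ S.ncard := by
    apply ncard_le_ncard _ (toFinite _)
    rw [hG, SimpleGraph.edgeSet_fromEdgeSet]
    exact sdiff_subset
  simp at h3
  omega

theorem IsPlane.no_K4 (h : P.IsPlane E) {φ : Fin 4 → N} (hφ : Function.Injective φ)
    (hE : ∀ i j, i ≠ j → s(φ i, φ j) ∈ E) (hF : F ∈ P.fc E) (hcl : ∀ i, P.pos (φ i) ∈ closure F) :
    False := by
  set E' : Set (Sym2 (Fin 4)) := {e | ¬ e.IsDiag} with hE'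
  have hm : ∀ e ∈ E', e.map φ ∈ E := by
    intro e he
    induction e using Sym2.ind with
    | _ i j => exact hE i j (by simpa [hE'] using he)
  have hQ := h.comap hφ hm
  set Q := P.comap φ with hQdef
  have hKK : Q.K E' ⊆ P.K E := by
    rintro x (⟨i, rfl⟩ | hx)
    · exact Or.inl ⟨φ i, rfl⟩
    · simp only [mem_iUnion] at hx
      obtain ⟨f, hf, hx⟩ := hx
      exact arc_sub_K (hm f hf) hx
  obtain ⟨x, hx⟩ := face_nonempty hF
  obtain ⟨Φ, hΦ, hxΦ⟩ := exists_face (K := Q.K E') (fun hh => face_sub hF hx (hKK hh))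
  replace hΦ : Φ ∈ Q.fc E' := hΦ
  have hFΦ : F ⊆ Φ := face_max hΦ (face_conn hF)
    ((face_sub hF).trans (compl_subset_compl.2 hKK)) ⟨x, hx, hxΦ⟩
  have hcl' : ∀ i, Q.pos i ∈ closure Φ := fun i => closure_mono hFΦ (hcl i)
  have hbf : BF E' := by
    intro i j hij
    have hij' : i ≠ j := by simpa [hE'] using hij
    obtain ⟨k, hki, hkj⟩ : ∃ k : Fin 4, k ≠ i ∧ k ≠ j := by
      revert i j; decide
    have e1 : (SimpleGraph.fromEdgeSet (E' \ {s(i, j)})).Adj i k := by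
      rw [SimpleGraph.fromEdgeSet_adj]
      refine ⟨⟨by simpa [hE'] using hki.symm, ?_⟩, hki.symm⟩
      simp [Sym2.eq_iff]; tauto
    have e2 : (SimpleGraph.fromEdgeSet (E' \ {s(i, j)})).Adj k j := by
      rw [SimpleGraph.fromEdgeSet_adj]
      refine ⟨⟨by simpa [hE'] using hkj, ?_⟩, hkj⟩
      simp [Sym2.eq_iff]; tauto
    exact e1.reachable.trans e2.reachable
  have hcard : E'.ncard = 6 := by
    have : E' = ((Finset.univ.filter fun e : Sym2 (Fin 4) => ¬ e.IsDiag : Finset _) : Set (Sym2 (Fin 4))) := by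
      ext e; simp [hE']
    rw [this, ncard_coe_finset]
    decide
  have heul := hQ.euler_le
  have hc4 : Nat.card (Fin 4) = 4 := by simp
  have hf4 : 4 ≤ (Q.fc E').ncard := by omega
  have hloop : ∀ G, ∀ i, s(i, i) ∉ Q.bd E' G := by
    intro G i hi
    simpa [hE'] using hi.1
  have hsum := hQ.double_eq hbf
  have hlt : ∑ G ∈ hQ.faces_finite.toFinset, 3 < ∑ G ∈ hQ.faces_finite.toFinset, (Q.bd E' G).ncard := by
    apply Finset.sum_lt_sum
    · intro G hG
      exact three_of_minDeg (hloop G) (hQ.bd_minDeg hbf (by simpa using hG) (by omega))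
    · refine ⟨Φ, by simpa using hΦ, ?_⟩
      apply four_le_of_touch (hloop Φ)
      intro i
      obtain ⟨j, hj⟩ : ∃ j : Fin 4, i ≠ j := by revert i; decide
      obtain ⟨c, hc⟩ := hQ.touch hΦ (hcl' i) (e := s(i, j)) (by simpa [hE'] using hj) (by simp)
      obtain ⟨d, hd, hd'⟩ := hQ.D2 hΦ hc (hbf _ _ hc.1)
      exact ⟨c, d, hd.symm, hc, hd'⟩
  rw [hsum, Finset.sum_const, smul_eq_mul, ← ncard_eq_toFinset_card _ hQ.faces_finite, hcard] at hlt
  omega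

theorem IsPlane.lf_node (h : P.IsPlane E) (he : e ∈ E) (hn : n ∈ e) : LF (P.K E) (P.pos n) := by
  classical
  let ι := {f // f ∈ E ∧ n ∈ f}
  have key := lf_of_star (ι := ι) (R := P.far E n) (S := fun f => P.arc f.1) (p := P.pos n)
    (q := fun f => P.pos (Sym2.Mem.other f.2.2)) h.far_compact h.notMem_far ?_ ?_ ?_
  · convert key using 1
    apply Subset.antisymm
    · rintro x (⟨m, rfl⟩ | hx)
      · by_cases hmn : m = n
        · subst hmn
          refine Or.inr (mem_iUnion.2 ⟨⟨e, he, hn⟩, ?_⟩)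
          obtain ⟨c, rfl⟩ := hn
          exact (h.isArc _ _ he).left_mem
        · exact Or.inl (Or.inl ⟨m, hmn, rfl⟩)
      · simp only [mem_iUnion] at hx
        obtain ⟨f, hf, hx⟩ := hx
        by_cases hnf : n ∈ f
        · exact Or.inr (mem_iUnion.2 ⟨⟨f, hf, hnf⟩, hx⟩)
        · exact Or.inl (Or.inr (mem_biUnion ⟨hf, hnf⟩ hx))
    · rintro x ((⟨m, -, rfl⟩ | hx) | hx)
      · exact pos_mem_K
      · simp only [mem_iUnion] at hx
        obtain ⟨f, hf, hx⟩ := hx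
        exact arc_sub_K hf.1 hx
      · simp only [mem_iUnion] at hx
        obtain ⟨f, hx⟩ := hx
        exact arc_sub_K f.2.1 hx
  · rintro ⟨f, hf, hnf⟩
    have h1 := Sym2.other_spec hnf
    have h2 := h.isArc n (Sym2.Mem.other hnf) (by rw [h1]; exact hf)
    rw [h1] at h2
    exact h2
  · rintro ⟨f, hf, hnf⟩ ⟨g, hg, hng⟩ hfg x ⟨hx1, hx2⟩
    have hfg' : f ≠ g := fun hh => hfg (Subtype.ext hh)
    obtain ⟨m, rfl⟩ := h.disj f hf g hg hfg' ⟨hx1, hx2⟩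
    have m1 := h.inc f hf m hx1
    have m2 := h.inc g hg m hx2
    by_contra hmn
    have hmn' : n ≠ m := fun hh => hmn (by rw [hh]; rfl)
    exact hfg' (((Sym2.mem_and_mem_iff hmn').1 ⟨hnf, m1⟩).trans ((Sym2.mem_and_mem_iff hmn').1 ⟨hng, m2⟩).symm)
  · rintro ⟨f, hf, hnf⟩ x ⟨hx1, hx2⟩
    have h1 := Sym2.other_spec hnf
    have key : ∀ m, m ≠ n → P.pos m ∈ P.arc f → P.pos m ∈ ({P.pos (Sym2.Mem.other hnf)} : Set Pl) := by
      intro m hm hx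
      have := h.inc f hf m hx
      rw [← h1, Sym2.mem_iff] at this
      rcases this with rfl | hm'
      · exact absurd rfl hm
      · rw [hm']; rfl
    rcases hx2 with ⟨m, hm, rfl⟩ | hx2
    · exact key m hm hx1
    · simp only [mem_iUnion] at hx2
      obtain ⟨g, ⟨hg, hng⟩, hx2⟩ := hx2
      have hfg : f ≠ g := by rintro rfl; exact hng hnf
      obtain ⟨m, rfl⟩ := h.disj f hf g hg hfg ⟨hx1, hx2⟩
      refine key m ?_ hx1
      rintro rfl
      exact hng (h.inc g hg _ hx2)

theorem IsPlane.lf_int (h : P.IsPlane E) (he : e ∈ E) {y : Pl} (hy : y ∈ P.int e) : LF (P.K E) y := by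
  obtain ⟨a, b, hab, rfl⟩ := h.exists_ends he
  have hA := h.addArc he
  have hya : y ≠ P.pos a := by rintro rfl; exact hy.2 ⟨_, rfl⟩
  have hyb : y ≠ P.pos b := by rintro rfl; exact hy.2 ⟨_, rfl⟩
  have hyK : y ∉ P.K (E \ {s(a, b)}) := by
    intro hh
    have : y ∈ P.K (E \ {s(a, b)}) ∩ P.arc s(a, b) := ⟨hh, hy.1⟩
    rw [hA.inter] at this
    rcases this with hh | hh
    · exact hya hh
    · exact hyb hh
  obtain ⟨S₁, S₂, hS₁, hS₂, hu, hi⟩ := (h.isArc a b he).split hy.1 hya hyb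
  have hb1 : P.pos b ∉ S₁ := fun hh => hyb (by
    have : P.pos b ∈ S₁ ∩ S₂ := ⟨hh, hS₂.right_mem⟩
    rw [hi] at this; exact this.symm)
  have ha2 : P.pos a ∉ S₂ := fun hh => hya (by
    have : P.pos a ∈ S₁ ∩ S₂ := ⟨hS₁.left_mem, hh⟩
    rw [hi] at this; exact this.symm)
  have key := lf_of_star (ι := Bool) (R := P.K (E \ {s(a, b)})) (S := fun i => cond i S₁ S₂) (p := y)
    (q := fun i => cond i (P.pos a) (P.pos b)) hA.cpt hyK ?_ ?_ ?_
  · convert key using 1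
    rw [← K_insert he]
    congr 1
    rw [← hu, union_eq_iUnion]
  · rintro (_ | _)
    · exact hS₂
    · exact hS₁.symm
  · rintro (_ | _) (_ | _) hij
    · exact absurd rfl hij
    · simp only [cond_true, cond_false]
      rw [inter_comm, hi]
    · simp only [cond_true, cond_false]
      rw [hi]
    · exact absurd rfl hij
  · have : ∀ x ∈ P.arc s(a, b), x ∈ P.K (E \ {s(a, b)}) → x = P.pos a ∨ x = P.pos b := by
      intro x hx hx'
      have : x ∈ P.K (E \ {s(a, b)}) ∩ P.arc s(a, b) := ⟨hx', hx⟩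
      rw [hA.inter] at this
      exact this
    rintro (_ | _)
    · rintro x ⟨hx, hxK⟩
      rcases this x (hu ▸ Or.inr hx) hxK with rfl | rfl
      · exact absurd hx ha2
      · rfl
    · rintro x ⟨hx, hxK⟩
      rcases this x (hu ▸ Or.inl hx) hxK with rfl | rfl
      · rfl
      · exact absurd hx hb1

theorem IsPlane.join (h : P.IsPlane E) (hF : F ∈ P.fc E) {p q : Pl} (hp : LF (P.K E) p) (hq : LF (P.K E) q)
    (hpK : p ∈ P.K E) (hqK : q ∈ P.K E) (hpq : p ≠ q) (hpF : p ∈ closure F) (hqF : q ∈ closure F) :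
    ∃ S, IsArc S p q ∧ S ⊆ insert p (insert q F) := by
  obtain ⟨x, hx, rfl⟩ := hF
  exact access_two h.closed hp hq hpK hqK hpq hpF hqF

end PD
end PT

namespace PT
open Topology

section
variable {V : Type} {G : SimpleGraph V} (D : Drawing G) {u v w : V} {e f : Sym2 V}

def arcS (e : Sym2 V) : Set Pl := {p | ∃ (u v : V) (h : G.Adj u v), e = s(u, v) ∧ p ∈ D.arc h}

variable {D}

theorem arc_congr {u v u' v' : V} (h : G.Adj u v) (h' : G.Adj u' v') (hh : s(u, v) = s(u', v')) :
    D.arc h = D.arc h' := by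
  rw [Sym2.eq_iff] at hh
  rcases hh with ⟨rfl, rfl⟩ | ⟨rfl, rfl⟩
  · rfl
  · exact D.arc_symm h'

theorem arcS_eq (h : G.Adj u v) : arcS D s(u, v) = D.arc h := by
  ext x
  constructor
  · rintro ⟨u', v', h', hh, hx⟩
    rwa [arc_congr h h' hh]
  · intro hx
    exact ⟨u, v, h, rfl, hx⟩

theorem edgeInt_eq (h : G.Adj u v) : D.edgeInt s(u, v) = D.arc h \ {D.pos u, D.pos v} := by
  ext x
  constructor
  · rintro ⟨u', v', h', hh, hx⟩
    rw [Drawing.arcInt] at hx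
    rw [arc_congr h h' hh]
    rw [Sym2.eq_iff] at hh
    rcases hh with ⟨rfl, rfl⟩ | ⟨rfl, rfl⟩
    · exact hx
    · rwa [pair_comm]
  · intro hx
    exact ⟨u, v, h, rfl, hx⟩

theorem arc_isArc' (h : G.Adj u v) : IsArc (D.arc h) (D.pos u) (D.pos v) := by
  obtain ⟨γ, h1, h2, h3, h4, h5⟩ := D.arc_isArc h
  exact ⟨γ, h1, h2, h3, h4, h5⟩

theorem edgeInt_mem (hx : (D.edgeInt e).Nonempty) : e ∈ G.edgeSet := by
  obtain ⟨x, u, v, h, rfl, -⟩ := hx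
  exact h

theorem edgeInt_good (hg : D.IsGood) : D.edgeInt e = arcS D e \ range D.pos := by
  by_cases he : e ∈ G.edgeSet
  · induction e using Sym2.ind with
    | _ u v =>
      have h : G.Adj u v := he
      rw [edgeInt_eq h, arcS_eq h]
      ext x
      constructor
      · rintro ⟨h1, h2⟩
        refine ⟨h1, ?_⟩
        rintro ⟨n, rfl⟩
        rcases hg.1 n h h1 with rfl | rfl
        · exact h2 (Or.inl rfl)
        · exact h2 (Or.inr rfl)
      · rintro ⟨h1, h2⟩
        refine ⟨h1, ?_⟩
        rintro (rfl | rfl)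
        · exact h2 ⟨_, rfl⟩
        · exact h2 ⟨_, rfl⟩
  · ext x
    constructor
    · rintro ⟨u, v, h, rfl, -⟩
      exact absurd h he
    · rintro ⟨⟨u, v, h, rfl, -⟩, -⟩
      exact absurd h he

theorem Cross.symm' (h : D.Cross e f) : D.Cross f e := ⟨h.1.symm, by rw [inter_comm]; exact h.2⟩

/-- the drawing as plane-graph data -/
def pd (D : Drawing G) : PD V := ⟨D.pos, arcS D⟩

theorem pd_plane (hg : D.IsGood) {E : Set (Sym2 V)} (hE : E ⊆ G.edgeSet)
    (hc : ∀ e ∈ E, ∀ f ∈ E, ¬ D.Cross e f) : (pd D).IsPlane E := by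
  refine ⟨D.pos_inj, ?_, ?_, ?_⟩
  · intro u v huv
    have h : G.Adj u v := hE huv
    simp only [pd, arcS_eq h]
    exact arc_isArc' h
  · intro e he n hn
    induction e using Sym2.ind with
    | _ u v =>
      have h : G.Adj u v := hE he
      simp only [pd, arcS_eq h] at hn
      rw [Sym2.mem_iff]
      exact hg.1 n h hn
  · intro e he f hf hef x hx
    by_contra hxr
    refine hc e he f hf ⟨hef, x, ?_, ?_⟩
    · rw [edgeInt_good hg]; exact ⟨hx.1, hxr⟩
    · rw [edgeInt_good hg]; exact ⟨hx.2, hxr⟩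

theorem partA [Finite V] (hg : D.IsGood) (hn : 3 ≤ Nat.card V) :
    G.edgeSet.ncard + 6 ≤ 3 * Nat.card V + D.crNum := by
  classical
  obtain ⟨k, ⟨φ⟩⟩ := Finite.exists_equiv_fin (Sym2 V)
  let R : Set (Sym2 V) := {e | ∃ f, D.Cross e f ∧ φ e < φ f}
  have hpl : (pd D).IsPlane (G.edgeSet \ R) := by
    refine pd_plane hg sdiff_subset ?_
    intro e he f hf hc
    rcases lt_trichotomy (φ e) (φ f) with hh | hh | hh
    · exact he.2 ⟨f, hc, hh⟩
    · exact hc.1 (φ.injective hh)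
    · exact hf.2 ⟨e, Cross.symm' hc, hh⟩
  have h1 := hpl.le_3n hn
  have h2 : G.edgeSet.ncard ≤ (G.edgeSet \ R).ncard + R.ncard := by
    have := ncard_le_ncard_sdiff_add_ncard G.edgeSet R
    exact this
  have h3 : R.ncard ≤ D.crNum := by
    rw [Drawing.crNum, Nat.le_div_iff_mul_le (by norm_num)]
    choose! g hg1 hg2 using fun (e : Sym2 V) (he : e ∈ R) => he
    set A : Set (Sym2 V × Sym2 V) := (fun e => (e, g e)) '' R with hA
    set B : Set (Sym2 V × Sym2 V) := (fun e => (g e, e)) '' R with hB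
    have hAc : A.ncard = R.ncard := ncard_image_of_injective _ fun x y hxy => (Prod.ext_iff.1 hxy).1
    have hBc : B.ncard = R.ncard := ncard_image_of_injective _ fun x y hxy => (Prod.ext_iff.1 hxy).2
    have hd : Disjoint A B := by
      rw [disjoint_left]
      rintro _ ⟨x, hx, rfl⟩ ⟨y, hy, hxy⟩
      have e1 := (Prod.ext_iff.1 hxy).1
      have e2 := (Prod.ext_iff.1 hxy).2
      simp only at e1 e2
      have l1 := hg2 x hx
      have l2 := hg2 y hy
      rw [← e2, ← e1] at l1
      exact lt_asymm l1 l2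
    have hu : (A ∪ B).ncard = R.ncard * 2 := by
      rw [ncard_union_eq hd (toFinite _) (toFinite _), hAc, hBc]; ring
    rw [← hu]
    apply ncard_le_ncard _ (toFinite _)
    rintro _ (⟨x, hx, rfl⟩ | ⟨x, hx, rfl⟩)
    · exact hg1 x hx
    · exact Cross.symm' (hg1 x hx)
  omega

end
end PT

namespace PT
open Topology

section
variable {V : Type} {G : SimpleGraph V} {D : Drawing G} {u v w : V} {e f : Sym2 V}

open Classical in
/-- replace (or add) the arc of `s(u, v)` -/
noncomputable def newArc (D : Drawing G) (u v : V) (S : Set Pl) (e : Sym2 V) : Set Pl :=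
  if e = s(u, v) then S else arcS D e

noncomputable def newD (D : Drawing G) (H : SimpleGraph V) (u v : V) (S : Set Pl)
    (hS : IsArc S (D.pos u) (D.pos v)) (hH : ∀ g, g ≠ s(u, v) → (g ∈ H.edgeSet → g ∈ G.edgeSet)) :
    Drawing H where
  pos := D.pos
  pos_inj := D.pos_inj
  arc := fun x y _ => newArc D u v S s(x, y)
  arc_symm := fun x y _ => by rw [Sym2.eq_swap]
  arc_isArc := fun x y h => by
    by_cases hxy : s(x, y) = s(u, v)
    · have hS' : IsArc S (D.pos x) (D.pos y) := by
        rw [Sym2.eq_iff] at hxy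
        rcases hxy with ⟨rfl, rfl⟩ | ⟨rfl, rfl⟩
        · exact hS
        · exact hS.symm
      obtain ⟨γ, h1, h2, h3, h4, h5⟩ := hS'
      exact ⟨γ, h1, h2, h3, h4, by rw [newArc, if_pos hxy, h5]⟩
    · have hG : G.Adj x y := hH _ hxy h
      obtain ⟨γ, h1, h2, h3, h4, h5⟩ := arc_isArc' (D := D) hG
      exact ⟨γ, h1, h2, h3, h4, by rw [newArc, if_neg hxy, arcS_eq hG, h5]⟩

variable {H : SimpleGraph V} {S : Set Pl} {hS : IsArc S (D.pos u) (D.pos v)}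
  {hH : ∀ g, g ≠ s(u, v) → (g ∈ H.edgeSet → g ∈ G.edgeSet)}

theorem newD_edgeInt_new (huv : H.Adj u v) :
    (newD D H u v S hS hH).edgeInt s(u, v) = S \ {D.pos u, D.pos v} := by
  rw [edgeInt_eq huv]
  simp [newD, newArc]

theorem newD_edgeInt_old {g : Sym2 V} (hg : g ≠ s(u, v)) (hHg : g ∈ G.edgeSet → g ∈ H.edgeSet) :
    (newD D H u v S hS hH).edgeInt g = D.edgeInt g := by
  induction g using Sym2.ind with
  | _ x y =>
    by_cases hxy : G.Adj x y
    · have hxy' : H.Adj x y := hHg hxy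
      rw [edgeInt_eq hxy, edgeInt_eq hxy']
      simp only [newD, newArc, if_neg hg, arcS_eq hxy]
    · have h1 : ¬ (D.edgeInt s(x, y)).Nonempty := fun hh => hxy (edgeInt_mem hh)
      have h2 : ¬ ((newD D H u v S hS hH).edgeInt s(x, y)).Nonempty :=
        fun hh => hxy (hH _ hg (edgeInt_mem hh))
      rw [not_nonempty_iff_eq_empty] at h1 h2
      rw [h1, h2]

theorem edgeInt_pos (hg : D.IsGood) : D.pos w ∉ D.edgeInt e := by
  rw [edgeInt_good hg]
  exact fun hh => hh.2 ⟨_, rfl⟩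

theorem newD_good (hg : D.IsGood) (ho : D.IsOnePlanar) (huv : H.Adj u v)
    (hH' : ∀ g, g ≠ s(u, v) → g ∈ G.edgeSet → g ∈ H.edgeSet)
    (c1 : ∀ w, D.pos w ∈ S → w = u ∨ w = v)
    (c2 : ∀ g, g ≠ s(u, v) → (S ∩ D.edgeInt g).Subsingleton)
    (c3 : ∀ g, g ≠ s(u, v) → (u ∈ g ∨ v ∈ g) → S ∩ D.edgeInt g = ∅)
    (c4 : ∀ g g', g ≠ s(u, v) → g' ≠ s(u, v) → (S ∩ D.edgeInt g).Nonempty → (S ∩ D.edgeInt g').Nonempty → g = g')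
    (c5 : ∀ g, g ≠ s(u, v) → (S ∩ D.edgeInt g).Nonempty → ∀ f, f ≠ s(u, v) → ¬ D.Cross g f) :
    (newD D H u v S hS hH).IsGood ∧ (newD D H u v S hS hH).IsOnePlanar := by
  set D' := newD D H u v S hS hH with hD'
  have hnew : D'.edgeInt s(u, v) = S \ {D.pos u, D.pos v} := newD_edgeInt_new huv
  have hnew' : D'.edgeInt s(u, v) ⊆ S := hnew ▸ sdiff_subset
  have hold : ∀ g, g ≠ s(u, v) → D'.edgeInt g = D.edgeInt g := fun g hg => newD_edgeInt_old hg (hH' g hg)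
  refine ⟨⟨?_, ?_, ?_⟩, ?_⟩
  · intro w x y h hw
    by_cases hxy : s(x, y) = s(u, v)
    · have hw' : D.pos w ∈ S := by
        simpa [hD', newD, newArc, hxy] using hw
      rcases c1 w hw' with rfl | rfl
      · have : w ∈ s(x, y) := by rw [hxy]; simp
        simpa using this
      · have : w ∈ s(x, y) := by rw [hxy]; simp
        simpa using this
    · have hG : G.Adj x y := hH _ hxy h
      refine hg.1 w hG ?_
      simpa [hD', newD, newArc, hxy, arcS_eq hG] using hw
  · intro g g' hgg
    by_cases h1 : g = s(u, v)
    · subst h1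
      rw [hold g' hgg.symm]
      exact (c2 g' hgg.symm).anti (inter_subset_inter_left _ hnew')
    · by_cases h2 : g' = s(u, v)
      · subst h2
        rw [hold g hgg, inter_comm]
        exact (c2 g hgg).anti (inter_subset_inter_left _ hnew')
      · rw [hold g h1, hold g' h2]
        exact hg.2.1 g g' hgg
  · intro x y z h1 h2 hyz
    have e1 : D'.arcInt h1 = D'.edgeInt s(x, y) := (edgeInt_eq h1).symm
    have e2 : D'.arcInt h2 = D'.edgeInt s(x, z) := (edgeInt_eq h2).symm
    rw [e1, e2]
    have hne : s(x, y) ≠ s(x, z) := by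
      intro hh
      rw [Sym2.congr_right] at hh
      exact hyz hh
    by_cases hh1 : s(x, y) = s(u, v)
    · have hx : x = u ∨ x = v := by
        have : x ∈ s(u, v) := by rw [← hh1]; simp
        simpa using this
      have hh2 : s(x, z) ≠ s(u, v) := fun hh => hne (hh1.trans hh.symm)
      rw [hh1, hold _ hh2]
      have := c3 _ hh2 (by rcases hx with rfl | rfl <;> simp)
      exact subset_empty_iff.1 (this ▸ inter_subset_inter_left _ hnew')
    · by_cases hh2 : s(x, z) = s(u, v)
      · have hx : x = u ∨ x = v := by
          have : x ∈ s(u, v) := by rw [← hh2]; simp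
          simpa using this
        rw [hh2, hold _ hh1, inter_comm]
        have := c3 _ hh1 (by rcases hx with rfl | rfl <;> simp)
        exact subset_empty_iff.1 (this ▸ inter_subset_inter_left _ hnew')
      · rw [hold _ hh1, hold _ hh2, edgeInt_eq (hH _ hh1 h1 : G.Adj x y), edgeInt_eq (hH _ hh2 h2 : G.Adj x z)]
        exact hg.2.2 (hH _ hh1 h1) (hH _ hh2 h2) hyz
  · intro g f hf f' hf'
    have hx : ∀ g', g' ≠ s(u, v) → D'.Cross s(u, v) g' → (S ∩ D.edgeInt g').Nonempty := by
      rintro g' hg' ⟨-, x, hx1, hx2⟩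
      rw [hold g' hg'] at hx2
      exact ⟨x, hnew' hx1, hx2⟩
    have hy : ∀ g g', g ≠ s(u, v) → g' ≠ s(u, v) → D'.Cross g g' → D.Cross g g' := by
      rintro g g' h1 h2 ⟨hne, x, hx1, hx2⟩
      rw [hold _ h1] at hx1
      rw [hold _ h2] at hx2
      exact ⟨hne, x, hx1, hx2⟩
    by_cases h1 : g = s(u, v)
    · subst h1
      exact c4 _ _ hf.1.symm hf'.1.symm (hx _ hf.1.symm hf) (hx _ hf'.1.symm hf')
    · have key : ∀ a b, D'.Cross g a → D'.Cross g b → a = s(u, v) → b = s(u, v) := by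
        rintro a b ha hb rfl
        by_contra hb'
        exact c5 g h1 (hx g h1 (Cross.symm' ha)) b hb' (hy _ _ h1 hb' hb)
      by_cases h2 : f = s(u, v)
      · rw [h2, key f f' hf hf' h2]
      · by_cases h3 : f' = s(u, v)
        · exact absurd (key f' f hf' hf h3) h2
        · exact ho g (hy _ _ h1 h2 hf) (hy _ _ h1 h3 hf')

theorem add_edge (hmax : D.IsMaximalOnePlane) (huv : u ≠ v) (hS : IsArc S (D.pos u) (D.pos v))
    (c1 : ∀ w, D.pos w ∈ S → w = u ∨ w = v)
    (c2 : ∀ g, (S ∩ D.edgeInt g).Subsingleton)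
    (c3 : ∀ g, (u ∈ g ∨ v ∈ g) → S ∩ D.edgeInt g = ∅)
    (c4 : ∀ g g', (S ∩ D.edgeInt g).Nonempty → (S ∩ D.edgeInt g').Nonempty → g = g')
    (c5 : ∀ g, (S ∩ D.edgeInt g).Nonempty → ∀ f, ¬ D.Cross g f) : G.Adj u v := by
  by_contra hadj
  set H := G ⊔ SimpleGraph.fromEdgeSet {s(u, v)} with hHdef
  have hH : ∀ g, g ≠ s(u, v) → (g ∈ H.edgeSet → g ∈ G.edgeSet) := by
    intro g hg hgH
    rw [hHdef, SimpleGraph.edgeSet_sup] at hgH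
    rcases hgH with hh | hh
    · exact hh
    · simp at hh; exact absurd hh.1 hg
  have hHuv : H.Adj u v := by
    rw [hHdef, SimpleGraph.sup_adj, SimpleGraph.fromEdgeSet_adj]
    exact Or.inr ⟨rfl, huv⟩
  refine hmax.2.2 u v huv hadj (newD D H u v S hS hH) rfl ?_ ?_
  · intro x y h
    have hne : s(x, y) ≠ s(u, v) := by
      intro hh
      have h' : s(x, y) ∈ G.edgeSet := h
      rw [hh] at h'
      exact hadj h'
    simp only [newD, newArc, if_neg hne, arcS_eq h]
  · refine newD_good hmax.1 hmax.2.1 hHuv (fun g _ hg => ?_) c1 (fun g _ => c2 g) (fun g _ => c3 g)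
      (fun g g' _ _ => c4 g g') (fun g _ hg f _ => c5 g hg f)
    rw [SimpleGraph.edgeSet_sup]
    exact Or.inl hg

theorem redraw [Finite V] (hmax : D.IsMaximalOnePlane) (himm : D.Immovable) (huv : G.Adj u v)
    (hS : IsArc S (D.pos u) (D.pos v))
    (c1 : ∀ w, D.pos w ∈ S → w = u ∨ w = v)
    (c2 : ∀ g, g ≠ s(u, v) → S ∩ D.edgeInt g = ∅) : ¬ D.Cross s(u, v) f := by
  intro hf
  have hH : ∀ g, g ≠ s(u, v) → (g ∈ G.edgeSet → g ∈ G.edgeSet) := fun _ _ => id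
  have hno : ∀ g, g ≠ s(u, v) → ¬ (S ∩ D.edgeInt g).Nonempty := fun g hg => by
    rw [c2 g hg]; exact not_nonempty_empty
  have hgood := newD_good (hS := hS) (hH := hH) hmax.1 hmax.2.1 huv hH c1
    (fun g hg => by rw [c2 g hg]; exact subsingleton_empty) (fun g hg _ => c2 g hg)
    (fun g g' h1 h2 h3 => absurd h3 (hno g h1)) (fun g hg h3 => absurd h3 (hno g hg))
  have := himm _ hgood.1 hgood.2 rfl ⟨u, v, huv, by
    intro x y h hne
    simp only [newD, newArc, if_neg hne, arcS_eq h]⟩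
  set D' := newD D G u v S hS hH with hD'
  have hnew : D'.edgeInt s(u, v) = S \ {D.pos u, D.pos v} := newD_edgeInt_new huv
  have hold : ∀ g, g ≠ s(u, v) → D'.edgeInt g = D.edgeInt g := fun g hg => newD_edgeInt_old hg id
  have hc0 : ∀ g, ¬ D'.Cross s(u, v) g := by
    rintro g ⟨hne, x, hx1, hx2⟩
    rw [hold g hne.symm] at hx2
    rw [hnew] at hx1
    exact hno g hne.symm ⟨x, hx1.1, hx2⟩
  have hsub : insert (s(u, v), f) (insert (f, s(u, v)) {p : Sym2 V × Sym2 V | D'.Cross p.1 p.2}) ⊆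
      {p : Sym2 V × Sym2 V | D.Cross p.1 p.2} := by
    rintro ⟨g, g'⟩ (hh | hh | hh)
    · rw [hh]; exact hf
    · rw [hh]; exact Cross.symm' hf
    · have hh' : D'.Cross g g' := hh
      have h1 : g ≠ s(u, v) := by rintro rfl; exact hc0 _ hh'
      have h2 : g' ≠ s(u, v) := by rintro rfl; exact hc0 _ (Cross.symm' hh')
      obtain ⟨hne, x, hx1, hx2⟩ := hh'
      rw [hold _ h1] at hx1
      rw [hold _ h2] at hx2
      exact ⟨hne, x, hx1, hx2⟩
  have hcard := ncard_le_ncard hsub (toFinite _)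
  rw [ncard_insert_of_notMem _ (toFinite _), ncard_insert_of_notMem _ (toFinite _)] at hcard
  · rw [Drawing.crNum, Drawing.crNum] at this
    omega
  · exact fun hh => hc0 _ (Cross.symm' hh)
  · rintro (hh | hh)
    · exact hf.1 (Prod.ext_iff.1 hh).1
    · exact hc0 _ hh

theorem principleP [Finite V] (hmax : D.IsMaximalOnePlane) (himm : D.Immovable) (huv : u ≠ v)
    (hS : IsArc S (D.pos u) (D.pos v))
    (c1 : ∀ w, D.pos w ∈ S → w = u ∨ w = v) (c2 : ∀ g, S ∩ D.edgeInt g = ∅) :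
    G.Adj u v ∧ ∀ f, ¬ D.Cross s(u, v) f := by
  have hno : ∀ g, ¬ (S ∩ D.edgeInt g).Nonempty := fun g => by
    rw [c2 g]; exact not_nonempty_empty
  have h : G.Adj u v := add_edge hmax huv hS c1 (fun g => by rw [c2 g]; exact subsingleton_empty)
    (fun g _ => c2 g) (fun g g' h => absurd h (hno g)) (fun g h => absurd h (hno g))
  exact ⟨h, fun f => redraw hmax himm h hS c1 fun g _ => c2 g⟩

end
end PT

namespace PT
open Topology

/-- In an arc cut at `x`, the component of the start point. -/
theorem IsArc.comp_eq {S S₁ S₂ : Set Pl} {a b x : Pl} (h1 : IsArc S₁ a x) (h2 : IsArc S₂ x b)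
    (hu : S₁ ∪ S₂ = S) (hi : S₁ ∩ S₂ = {x}) :
    insert x (connectedComponentIn (S \ {x}) a) = S₁ := by
  have hax : a ≠ x := h1.ne
  have hsub : S₁ \ {x} ⊆ S \ {x} := sdiff_subset_sdiff_left (hu ▸ subset_union_left)
  have hpre : IsPreconnected (S₁ \ {x}) := by
    refine h1.int_conn.subset_closure (sdiff_subset_sdiff_right (by simp)) ?_
    intro y hy
    rw [mem_closure_iff_nhds]
    intro U hU
    obtain ⟨z, hz, hzU⟩ := h1.int_dense hy.1 hU
    exact ⟨z, hzU, hz⟩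
  have haS : a ∈ S₁ \ {x} := ⟨h1.left_mem, hax⟩
  have h3 : S₁ \ {x} ⊆ connectedComponentIn (S \ {x}) a := hpre.subset_connectedComponentIn haS hsub
  have h4 : connectedComponentIn (S \ {x}) a ⊆ S₁ := by
    have hc := connectedComponentIn_subset (S \ {x}) a
    have hcov : connectedComponentIn (S \ {x}) a ⊆ S₂ᶜ ∪ S₁ᶜ := by
      intro y hy
      by_contra hh
      simp only [mem_union, mem_compl_iff, not_or, not_not] at hh
      have : y ∈ S₁ ∩ S₂ := ⟨hh.2, hh.1⟩
      rw [hi] at this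
      exact (hc hy).2 this
    have hdis : connectedComponentIn (S \ {x}) a ∩ (S₂ᶜ ∩ S₁ᶜ) = ∅ := by
      apply eq_empty_of_forall_notMem
      rintro y ⟨hy, hy2, hy1⟩
      have := (hc hy).1
      rw [← hu] at this
      rcases this with hh | hh
      · exact hy1 hh
      · exact hy2 hh
    have haC : a ∈ connectedComponentIn (S \ {x}) a := h3 haS
    have ha2 : a ∉ S₂ := fun hh => hax (by
      have : a ∈ S₁ ∩ S₂ := ⟨h1.left_mem, hh⟩
      rw [hi] at this; exact this)
    intro y hy
    by_contra hy1
    have := (isPreconnected_connectedComponentIn (F := S \ {x}) (x := a)) S₂ᶜ S₁ᶜ h2.isClosed.isOpen_compl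
      h1.isClosed.isOpen_compl hcov ⟨a, haC, ha2⟩ ⟨y, hy, hy1⟩
    rw [hdis] at this
    exact not_nonempty_empty this
  apply Subset.antisymm
  · exact insert_subset h1.right_mem h4
  · intro y hy
    by_cases hyx : y = x
    · exact Or.inl hyx
    · exact Or.inr (h3 ⟨hy, hyx⟩)

section
variable {V : Type} {G : SimpleGraph V} {D : Drawing G} {u v w : V} {e f : Sym2 V}

theorem partner {x : Pl} (hx : x ∈ D.crossingSet) (he : x ∈ D.edgeInt e) :
    ∃ f, e ≠ f ∧ x ∈ D.edgeInt f ∧ D.Cross e f := by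
  obtain ⟨f, f', hne, h1, h2⟩ := hx
  by_cases h : e = f
  · subst h
    exact ⟨f', hne, h2, hne, x, he, h2⟩
  · exact ⟨f, h, h1, h, x, he, h1⟩

theorem one_pt (hg : D.IsGood) (ho : D.IsOnePlanar) {x y : Pl} (hx : x ∈ D.crossingSet)
    (hy : y ∈ D.crossingSet) (hxe : x ∈ D.edgeInt e) (hye : y ∈ D.edgeInt e) : x = y := by
  obtain ⟨f, hf, hxf, hc⟩ := partner hx hxe
  obtain ⟨f', hf', hyf', hc'⟩ := partner hy hye
  have : f = f' := ho e hc hc'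
  subst this
  exact hg.2.1 e f hf ⟨hxe, hxf⟩ ⟨hye, hyf'⟩

theorem adj_unique (hg : D.IsGood) {x : Pl} {v w w' : V} (h : G.Adj v w) (h' : G.Adj v w')
    (hx : x ∈ D.edgeInt s(v, w)) (hx' : x ∈ D.edgeInt s(v, w')) : w = w' := by
  by_contra hne
  have := hg.2.2 h h' hne
  have h2 : x ∈ D.arcInt h ∩ D.arcInt h' := by
    rw [edgeInt_eq h] at hx
    rw [edgeInt_eq h'] at hx'
    exact ⟨hx, hx'⟩
  rw [this] at h2
  exact h2

/-- the half-edge from the vertex `v` to the crossing point `x` -/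
def half (D : Drawing G) (v : V) (x : Pl) : Set Pl :=
  {p | ∃ w, G.Adj v w ∧ x ∈ D.edgeInt s(v, w) ∧
    p ∈ insert x (connectedComponentIn (arcS D s(v, w) \ {x}) (D.pos v))}

theorem half_eq (hg : D.IsGood) {x : Pl} (h : G.Adj v w) (hx : x ∈ D.edgeInt s(v, w)) :
    half D v x = insert x (connectedComponentIn (arcS D s(v, w) \ {x}) (D.pos v)) := by
  ext p
  constructor
  · rintro ⟨w', h', hx', hp⟩
    rwa [adj_unique hg h h' hx hx']
  · intro hp
    exact ⟨w, h, hx, hp⟩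

theorem half_spec (hg : D.IsGood) {x : Pl} (h : G.Adj v w) (hx : x ∈ D.edgeInt s(v, w)) :
    IsArc (half D v x) (D.pos v) x ∧ IsArc (half D w x) (D.pos w) x ∧
      half D v x ∪ half D w x = arcS D s(v, w) ∧ half D v x ∩ half D w x = {x} := by
  have hx' := hx
  rw [edgeInt_eq h] at hx
  have hxv : x ≠ D.pos v := fun hh => hx.2 (Or.inl hh)
  have hxw : x ≠ D.pos w := fun hh => hx.2 (Or.inr hh)
  obtain ⟨S₁, S₂, h1, h2, hu, hi⟩ := (arc_isArc' (D := D) h).split hx.1 hxv hxw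
  have e1 : half D v x = S₁ := by
    rw [half_eq hg h hx', arcS_eq h]
    exact h1.comp_eq h2 hu hi
  have e2 : half D w x = S₂ := by
    rw [half_eq hg h.symm (by rw [Sym2.eq_swap]; exact hx'), Sym2.eq_swap, arcS_eq h]
    exact h2.symm.comp_eq h1.symm (by rw [union_comm]; exact hu) (by rw [inter_comm]; exact hi)
  rw [e1, e2, arcS_eq h]
  exact ⟨h1, h2.symm, hu, hi⟩

theorem crossing_finite [Finite V] (hg : D.IsGood) : D.crossingSet.Finite := by
  have : D.crossingSet ⊆ ⋃ p ∈ {p : Sym2 V × Sym2 V | p.1 ≠ p.2}, (D.edgeInt p.1 ∩ D.edgeInt p.2) := by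
    rintro x ⟨e, f, hef, h1, h2⟩
    exact mem_biUnion (x := (e, f)) hef ⟨h1, h2⟩
  refine Finite.subset ?_ this
  exact (toFinite _).biUnion fun p hp => (hg.2.1 p.1 p.2 hp).finite

/-- nodes of the planarization -/
abbrev Nd (D : Drawing G) := V ⊕ D.crossingSet

/-- The planarization. -/
def pz (D : Drawing G) : PD (Nd D) where
  pos := Sum.elim D.pos Subtype.val
  arc := fun e => {p | (∃ u v, e = s(Sum.inl u, Sum.inl v) ∧ p ∈ arcS D s(u, v)) ∨
    ∃ v x, e = s(Sum.inl v, Sum.inr x) ∧ p ∈ half D v x.1}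

def Unc (D : Drawing G) (u v : V) : Prop := G.Adj u v ∧ ∀ f, ¬ D.Cross s(u, v) f

def HalfAdj (D : Drawing G) (v : V) (x : D.crossingSet) : Prop := ∃ w, G.Adj v w ∧ x.1 ∈ D.edgeInt s(v, w)

/-- true edges -/
def PU (D : Drawing G) : Set (Sym2 (Nd D)) := {e | ∃ u v, e = s(Sum.inl u, Sum.inl v) ∧ Unc D u v}
/-- half edges -/
def PH (D : Drawing G) : Set (Sym2 (Nd D)) := {e | ∃ v x, e = s(Sum.inl v, Sum.inr x) ∧ HalfAdj D v x}

def PE (D : Drawing G) : Set (Sym2 (Nd D)) := PU D ∪ PH D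

theorem Unc.symm (h : Unc D u v) : Unc D v u := ⟨h.1.symm, by rw [Sym2.eq_swap]; exact h.2⟩

theorem mem_PE_vv : s(Sum.inl u, Sum.inl v) ∈ PE D ↔ Unc D u v := by
  constructor
  · rintro (⟨u', v', hh, h⟩ | ⟨v', x, hh, h⟩)
    · rw [Sym2.eq_iff] at hh
      simp only [Sum.inl.injEq] at hh
      rcases hh with ⟨rfl, rfl⟩ | ⟨rfl, rfl⟩
      · exact h
      · exact h.symm
    · simp [Sym2.eq_iff] at hh
  · intro h
    exact Or.inl ⟨u, v, rfl, h⟩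

theorem mem_PE_vx {x : D.crossingSet} : s(Sum.inl v, Sum.inr x) ∈ PE D ↔ HalfAdj D v x := by
  constructor
  · rintro (⟨u', v', hh, h⟩ | ⟨v', x', hh, h⟩)
    · simp [Sym2.eq_iff] at hh
    · simp only [Sym2.eq_iff, Sum.inl.injEq, Sum.inr.injEq, reduceCtorEq, and_false, or_false] at hh
      obtain ⟨rfl, rfl⟩ := hh
      exact h
  · intro h
    exact Or.inr ⟨v, x, rfl, h⟩

theorem not_mem_PE_xx {x y : D.crossingSet} : s(Sum.inr x, Sum.inr y) ∉ PE D := by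
  rintro (⟨u', v', hh, h⟩ | ⟨v', x', hh, h⟩)
  · simp [Sym2.eq_iff] at hh
  · simp [Sym2.eq_iff] at hh

theorem pz_arc_vv : (pz D).arc s(Sum.inl u, Sum.inl v) = arcS D s(u, v) := by
  ext p
  constructor
  · rintro (⟨u', v', hh, h⟩ | ⟨v', x, hh, h⟩)
    · rw [Sym2.eq_iff] at hh
      simp only [Sum.inl.injEq] at hh
      rcases hh with ⟨rfl, rfl⟩ | ⟨rfl, rfl⟩
      · exact h
      · rw [Sym2.eq_swap]; exact h
    · simp [Sym2.eq_iff] at hh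
  · intro h
    exact Or.inl ⟨u, v, rfl, h⟩

theorem pz_arc_vx {x : D.crossingSet} : (pz D).arc s(Sum.inl v, Sum.inr x) = half D v x.1 := by
  ext p
  constructor
  · rintro (⟨u', v', hh, h⟩ | ⟨v', x', hh, h⟩)
    · simp [Sym2.eq_iff] at hh
    · simp only [Sym2.eq_iff, Sum.inl.injEq, Sum.inr.injEq, reduceCtorEq, and_false, or_false] at hh
      obtain ⟨rfl, rfl⟩ := hh
      exact h
  · intro h
    exact Or.inr ⟨v, x, rfl, h⟩

theorem pz_pos_inl : (pz D).pos (Sum.inl v) = D.pos v := rfl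
theorem pz_pos_inr {x : D.crossingSet} : (pz D).pos (Sum.inr x) = x.1 := rfl

theorem crossing_not_pos (hg : D.IsGood) (x : D.crossingSet) : D.pos v ≠ x.1 := by
  intro hh
  obtain ⟨e, f, -, h1, -⟩ := x.2
  rw [← hh] at h1
  exact edgeInt_pos hg h1

theorem unc_notMem (hg : D.IsGood) (h : Unc D u v) (x : D.crossingSet) : x.1 ∉ arcS D s(u, v) := by
  intro hx
  have : x.1 ∈ D.edgeInt s(u, v) := by
    rw [edgeInt_good hg]
    refine ⟨hx, ?_⟩
    rintro ⟨w, hw⟩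
    exact crossing_not_pos hg x hw
  obtain ⟨f, -, -, hc⟩ := partner x.2 this
  exact h.2 f hc

theorem mem_edgeInt_of_arcS (hg : D.IsGood) {x : D.crossingSet} (hx : x.1 ∈ arcS D e) : x.1 ∈ D.edgeInt e := by
  rw [edgeInt_good hg]
  refine ⟨hx, ?_⟩
  rintro ⟨w, hw⟩
  exact crossing_not_pos hg x hw

theorem pz_plane (hg : D.IsGood) (ho : D.IsOnePlanar) : (pz D).IsPlane (PE D) := by
  refine ⟨?_, ?_, ?_, ?_⟩
  · exact D.pos_inj.sumElim Subtype.val_injective fun v x => crossing_not_pos hg x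
  · rintro (u | x) (v | y) huv
    · have h := mem_PE_vv.1 huv
      rw [pz_arc_vv, arcS_eq h.1]
      exact arc_isArc' h.1
    · obtain ⟨w, h, hx⟩ := mem_PE_vx.1 huv
      rw [pz_arc_vx]
      exact (half_spec hg h hx).1
    · rw [Sym2.eq_swap] at huv ⊢
      obtain ⟨w, h, hx⟩ := mem_PE_vx.1 huv
      rw [pz_arc_vx]
      exact (half_spec hg h hx).1.symm
    · exact absurd huv not_mem_PE_xx
  · rintro e (⟨u, v, rfl, h⟩ | ⟨v, x, rfl, h⟩) n hn
    · rw [pz_arc_vv] at hn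
      rcases n with n | y
      · rw [arcS_eq h.1] at hn
        rcases hg.1 n h.1 hn with rfl | rfl <;> simp
      · exact absurd hn (unc_notMem hg h y)
    · rw [pz_arc_vx] at hn
      obtain ⟨w, h, hx⟩ := h
      obtain ⟨a1, a2, a3, a4⟩ := half_spec hg h hx
      rcases n with n | y
      · have hn' : D.pos n ∈ D.arc h := by rw [← arcS_eq h, ← a3]; exact Or.inl hn
        rcases hg.1 n h hn' with rfl | rfl
        · simp
        · have : D.pos n ∈ half D v x.1 ∩ half D n x.1 := ⟨hn, a2.left_mem⟩
          rw [a4] at this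
          exact absurd this (crossing_not_pos hg x)
      · have hn' : y.1 ∈ arcS D s(v, w) := by rw [← a3]; exact Or.inl hn
        have hy := mem_edgeInt_of_arcS hg hn'
        have : x = y := Subtype.ext (one_pt hg ho x.2 y.2 hx hy)
        subst this
        simp
  · -- underlying edges
    have hund : ∀ e ∈ PE D, ∃ g, (pz D).arc e ⊆ arcS D g := by
      rintro e (⟨u, v, rfl, h⟩ | ⟨v, x, rfl, h⟩)
      · exact ⟨_, pz_arc_vv.subset⟩
      · obtain ⟨w, h, hx⟩ := h
        obtain ⟨a1, a2, a3, a4⟩ := half_spec hg h hx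
        exact ⟨s(v, w), by rw [pz_arc_vx, ← a3]; exact subset_union_left⟩
    have hrange : ∀ p, p ∈ range D.pos → p ∈ range (pz D).pos := by
      rintro _ ⟨w, rfl⟩
      exact ⟨Sum.inl w, rfl⟩
    have key : ∀ p g g', p ∈ arcS D g → p ∈ arcS D g' → p ∉ range (pz D).pos → g = g' := by
      intro p g g' h1 h2 h3
      by_contra hne
      have h3' : p ∉ range D.pos := fun hh => h3 (hrange p hh)
      refine h3 ⟨Sum.inr ⟨p, g, g', hne, ?_, ?_⟩, rfl⟩
      · rw [edgeInt_good hg]; exact ⟨h1, h3'⟩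
      · rw [edgeInt_good hg]; exact ⟨h2, h3'⟩
    rintro e he f hf hef p ⟨hp1, hp2⟩
    by_contra hpr
    apply hef
    rcases he with ⟨u, v, rfl, h⟩ | ⟨v, x, rfl, h⟩
    · rw [pz_arc_vv] at hp1
      rcases hf with ⟨u', v', rfl, h'⟩ | ⟨v', x', rfl, h'⟩
      · rw [pz_arc_vv] at hp2
        have := key p _ _ hp1 hp2 hpr
        rw [Sym2.eq_iff] at this ⊢
        simpa using this
      · rw [pz_arc_vx] at hp2
        obtain ⟨w, h', hx⟩ := h'
        obtain ⟨a1, a2, a3, a4⟩ := half_spec hg h' hx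
        have := key p _ _ hp1 (by rw [← a3]; exact Or.inl hp2) hpr
        exfalso
        apply unc_notMem hg h x'
        rw [this, ← a3]
        exact Or.inl a1.right_mem
    · rw [pz_arc_vx] at hp1
      obtain ⟨w, h, hx⟩ := h
      obtain ⟨a1, a2, a3, a4⟩ := half_spec hg h hx
      rcases hf with ⟨u', v', rfl, h'⟩ | ⟨v', x', rfl, h'⟩
      · rw [pz_arc_vv] at hp2
        have := key p _ _ hp2 (by rw [← a3]; exact Or.inl hp1) hpr
        exfalso
        apply unc_notMem hg h' x
        rw [this, ← a3]
        exact Or.inl a1.right_mem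
      · rw [pz_arc_vx] at hp2
        obtain ⟨w', h', hx'⟩ := h'
        obtain ⟨b1, b2, b3, b4⟩ := half_spec hg h' hx'
        have := key p _ _ (by rw [← a3]; exact Or.inl hp1) (by rw [← b3]; exact Or.inl hp2) hpr
        have hxx : x = x' := Subtype.ext (one_pt hg ho x.2 x'.2 hx (this ▸ hx'))
        subst hxx
        rw [Sym2.eq_iff] at this
        rcases this with ⟨rfl, rfl⟩ | ⟨rfl, rfl⟩
        · rfl
        · exfalso
          have : p ∈ half D v x.1 ∩ half D w x.1 := ⟨hp1, hp2⟩
          rw [a4] at this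
          exact hpr ⟨Sum.inr x, this.symm⟩

/-- the planarization covers the drawing -/
theorem arcS_sub_K (hg : D.IsGood) : arcS D e ⊆ (pz D).K (PE D) := by
  by_cases he : e ∈ G.edgeSet
  · induction e using Sym2.ind with
    | _ u v =>
      have h : G.Adj u v := he
      by_cases hc : ∀ f, ¬ D.Cross s(u, v) f
      · rw [← pz_arc_vv (D := D)]
        exact PD.arc_sub_K (mem_PE_vv.2 ⟨h, hc⟩)
      · push Not at hc
        obtain ⟨f, hne, x, hx1, hx2⟩ := hc
        have hxc : x ∈ D.crossingSet := ⟨_, _, hne, hx1, hx2⟩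
        obtain ⟨a1, a2, a3, a4⟩ := half_spec hg h hx1
        rw [← a3]
        apply union_subset
        · rw [← pz_arc_vx (D := D) (x := ⟨x, hxc⟩)]
          exact PD.arc_sub_K (mem_PE_vx.2 ⟨v, h, hx1⟩)
        · rw [← pz_arc_vx (D := D) (x := ⟨x, hxc⟩)]
          exact PD.arc_sub_K (mem_PE_vx.2 ⟨u, h.symm, by rw [Sym2.eq_swap]; exact hx1⟩)
  · rintro p ⟨u, v, h, rfl, -⟩
    exact absurd h he

end
end PT

namespace PT
open Topology

section
variable {V : Type} {G : SimpleGraph V} {D : Drawing G} {u v w a b c : V} {e f : Sym2 V} {F : Set Pl}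

/-- The standing assumptions. -/
structure Hyp (D : Drawing G) : Prop where
  max : D.IsMaximalOnePlane
  conn : KConnected G 3
  imm : D.Immovable
  card : 5 ≤ Nat.card V

theorem Hyp.good (H : Hyp D) : D.IsGood := H.max.1
theorem Hyp.op (H : Hyp D) : D.IsOnePlanar := H.max.2.1
theorem Hyp.plane (H : Hyp D) : (pz D).IsPlane (PE D) := pz_plane H.good H.op

theorem Hyp.conn_ind (H : Hyp D) (a b : V) {C : V → Prop} (hua : u ≠ a) (hub : u ≠ b) (hu : C u)
    (step : ∀ x y, x ≠ a → x ≠ b → y ≠ a → y ≠ b → C x → G.Adj x y → C y) :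
    ∀ w, w ≠ a → w ≠ b → C w := by
  intro w hwa hwb
  have h2 : ({a, b} : Set V).ncard < 3 := lt_of_le_of_lt (ncard_insert_le _ _) (by simp)
  have hc := (H.conn {a, b} h2).preconnected ⟨u, by simp [hua, hub]⟩ ⟨w, by simp [hwa, hwb]⟩
  obtain ⟨p⟩ := hc
  have key : ∀ (x y : (({a, b} : Set V)ᶜ : Set V)), (G.induce ({a, b} : Set V)ᶜ).Walk x y → C x.1 → C y.1 := by
    intro x y p
    induction p with
    | nil => exact id
    | @cons x y z h p ih =>
      intro hx
      apply ih
      have h1 := x.2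
      have h2 := y.2
      simp only [mem_compl_iff, mem_insert_iff, mem_singleton_iff, not_or] at h1 h2
      exact step x y h1.1 h1.2 h2.1 h2.2 hx h
  exact key _ _ p hu

theorem Hyp.exists_ne [Finite V] (H : Hyp D) (l : List V) (hl : l.length ≤ 4) : ∃ w, w ∉ l := by
  classical
  have := Fintype.ofFinite V
  have h5 := H.card
  rw [Nat.card_eq_fintype_card] at h5
  have : l.toFinset.card < Fintype.card V := lt_of_le_of_lt (l.toFinset_card_le) (by omega)
  obtain ⟨w, hw⟩ := Finset.exists_mem_notMem_of_card_lt_card (s := l.toFinset) (t := Finset.univ) (by simpa using this)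
  exact ⟨w, by simpa using hw⟩

theorem Hyp.conn_all [Finite V] (H : Hyp D) {C : V → Prop} (hu : C u)
    (step : ∀ x y, C x → G.Adj x y → C y) (w : V) : C w := by
  obtain ⟨z, hz⟩ := H.exists_ne [u, w] (by simp)
  simp only [List.mem_cons, List.not_mem_nil, or_false, not_or] at hz
  exact H.conn_ind z z (Ne.symm hz.1) (Ne.symm hz.1) hu (fun x y _ _ _ _ => step x y) w (Ne.symm hz.2) (Ne.symm hz.2)

theorem Hyp.exists_adj [Finite V] (H : Hyp D) (v : V) : ∃ w, G.Adj v w := by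
  by_contra hcon
  push Not at hcon
  obtain ⟨z, hz⟩ := H.exists_ne [v] (by simp)
  apply hz
  have := H.conn_all (u := v) (C := fun x => x = v) rfl (fun x y hx hxy => by subst hx; exact absurd hxy (hcon y)) z
  simp [this]

theorem adj_cases (h : G.Adj a b) : Unc D a b ∨ ∃ x : D.crossingSet, x.1 ∈ D.edgeInt s(a, b) := by
  by_cases hc : ∀ f, ¬ D.Cross s(a, b) f
  · exact Or.inl ⟨h, hc⟩
  · push Not at hc
    obtain ⟨f, hne, x, hx1, hx2⟩ := hc
    exact Or.inr ⟨⟨x, _, _, hne, hx1, hx2⟩, hx1⟩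

theorem swap_mem {x : Pl} (hx : x ∈ D.edgeInt s(a, b)) : x ∈ D.edgeInt s(b, a) := by
  rw [Sym2.eq_swap]; exact hx

theorem half_mem_left {x : D.crossingSet} (h : G.Adj a b) (hx : x.1 ∈ D.edgeInt s(a, b)) :
    s(Sum.inl a, Sum.inr x) ∈ PE D := mem_PE_vx.2 ⟨b, h, hx⟩
theorem half_mem_right {x : D.crossingSet} (h : G.Adj a b) (hx : x.1 ∈ D.edgeInt s(a, b)) :
    s(Sum.inl b, Sum.inr x) ∈ PE D := mem_PE_vx.2 ⟨a, h.symm, swap_mem hx⟩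

theorem reach_edge {N : Type*} {E : Set (Sym2 N)} {a b : N} (h : s(a, b) ∈ E) :
    (SimpleGraph.fromEdgeSet E).Reachable a b := by
  by_cases hab : a = b
  · rw [hab]
  · exact SimpleGraph.Adj.reachable ((SimpleGraph.fromEdgeSet_adj _).2 ⟨h, hab⟩)

theorem lift_reach {e : Sym2 (Nd D)} (h : G.Adj a b) (h1 : e ≠ s(Sum.inl a, Sum.inl b))
    (h2 : ∀ x : D.crossingSet, x.1 ∈ D.edgeInt s(a, b) → e ≠ s(Sum.inl a, Sum.inr x) ∧ e ≠ s(Sum.inl b, Sum.inr x)) :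
    (SimpleGraph.fromEdgeSet (PE D \ {e})).Reachable (Sum.inl a) (Sum.inl b) := by
  rcases adj_cases (D := D) h with hu | ⟨x, hx⟩
  · exact reach_edge ⟨mem_PE_vv.2 hu, h1.symm⟩
  · have r1 := reach_edge (E := PE D \ {e}) ⟨half_mem_left h hx, (h2 x hx).1.symm⟩
    have r2 := reach_edge (E := PE D \ {e}) ⟨half_mem_right h hx, (h2 x hx).2.symm⟩
    exact r1.trans r2.symm

theorem Hyp.bf [Finite V] (H : Hyp D) : PD.BF (PE D) := by
  have main : ∀ a (m : Nd D), s(Sum.inl a, m) ∈ PE D → PD.NonBridge (PE D) (Sum.inl a) m := by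
    rintro u (v | x) huv
    · have hne : u ≠ v := fun h => H.plane.ne huv (by rw [h])
      obtain ⟨z, hz⟩ := H.exists_ne [u, v] (by simp)
      simp only [List.mem_cons, List.not_mem_nil, or_false, not_or] at hz
      unfold PD.NonBridge
      have r1 := H.conn_ind v v (u := u)
        (C := fun y => (SimpleGraph.fromEdgeSet (PE D \ {s(Sum.inl u, Sum.inl v)})).Reachable (Sum.inl u) (Sum.inl y))
        hne hne (SimpleGraph.Reachable.refl _) (by
          intro x y hx _ hy _ hr hxy
          refine hr.trans (lift_reach hxy ?_ ?_)
          · simp only [ne_eq, Sym2.eq_iff, Sum.inl.injEq]; grind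
          · intro x _; simp [Sym2.eq_iff]) z hz.2 hz.2
      refine r1.trans ?_
      exact H.conn_ind u u (u := z)
        (C := fun y => (SimpleGraph.fromEdgeSet (PE D \ {s(Sum.inl u, Sum.inl v)})).Reachable (Sum.inl z) (Sum.inl y))
        hz.1 hz.1 (SimpleGraph.Reachable.refl _) (by
          intro x y hx _ hy _ hr hxy
          refine hr.trans (lift_reach hxy ?_ ?_)
          · simp only [ne_eq, Sym2.eq_iff, Sum.inl.injEq]; grind
          · intro x _; simp [Sym2.eq_iff]) v hne.symm hne.symm
    · obtain ⟨v, huv', hx⟩ := mem_PE_vx.1 huv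
      have hne : u ≠ v := huv'.ne
      obtain ⟨z, hz⟩ := H.exists_ne [u, v] (by simp)
      simp only [List.mem_cons, List.not_mem_nil, or_false, not_or] at hz
      unfold PD.NonBridge
      have r1 := H.conn_ind v v (u := u)
        (C := fun y => (SimpleGraph.fromEdgeSet (PE D \ {s(Sum.inl u, Sum.inr x)})).Reachable (Sum.inl u) (Sum.inl y))
        hne hne (SimpleGraph.Reachable.refl _) (by
          intro p q hp _ hq _ hr hxy
          refine hr.trans (lift_reach hxy (by simp [Sym2.eq_iff]) ?_)
          intro y hy
          simp only [ne_eq, Sym2.eq_iff, Sum.inl.injEq, Sum.inr.injEq, reduceCtorEq, and_false, or_false]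
          constructor
          · rintro ⟨rfl, rfl⟩
            exact hq (adj_unique H.good huv' hxy hx hy).symm
          · rintro ⟨rfl, rfl⟩
            exact hp (adj_unique H.good huv' hxy.symm hx (swap_mem hy)).symm) z hz.2 hz.2
      refine r1.trans ?_
      have r2 := H.conn_ind u u (u := z)
        (C := fun y => (SimpleGraph.fromEdgeSet (PE D \ {s(Sum.inl u, Sum.inr x)})).Reachable (Sum.inl z) (Sum.inl y))
        hz.1 hz.1 (SimpleGraph.Reachable.refl _) (by
          intro p q hp _ hq _ hr hxy
          refine hr.trans (lift_reach hxy (by simp [Sym2.eq_iff]) ?_)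
          intro y hy
          simp only [ne_eq, Sym2.eq_iff, Sum.inl.injEq, Sum.inr.injEq, reduceCtorEq, and_false, or_false]
          grind) v hne.symm hne.symm
      refine r2.trans (reach_edge ⟨half_mem_right huv' hx, ?_⟩)
      simp only [mem_singleton_iff, Sym2.eq_iff, Sum.inl.injEq, reduceCtorEq, and_false, or_false, and_true]
      exact hne.symm
  rintro (a | x) (b | y) hab
  · exact main _ _ hab
  · exact main _ _ hab
  · have := main b _ (by rw [Sym2.eq_swap]; exact hab)
    unfold PD.NonBridge at this ⊢
    rw [Sym2.eq_swap]
    exact this.symm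
  · exact absurd hab not_mem_PE_xx

theorem exists_half (x : D.crossingSet) : ∃ a b, G.Adj a b ∧ x.1 ∈ D.edgeInt s(a, b) := by
  obtain ⟨e, f, hef, h1, h2⟩ := x.2
  obtain ⟨u, v, h, rfl, hx⟩ := id h1
  exact ⟨u, v, h, h1⟩

theorem Hyp.pconn [Finite V] (H : Hyp D) : (SimpleGraph.fromEdgeSet (PE D)).Connected := by
  obtain ⟨z, -⟩ := H.exists_ne [] (by simp)
  have key : ∀ y : Nd D, (SimpleGraph.fromEdgeSet (PE D)).Reachable (Sum.inl z) y := by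
    have h1 : ∀ y : V, (SimpleGraph.fromEdgeSet (PE D)).Reachable (Sum.inl z) (Sum.inl y) := by
      apply H.conn_all (u := z) (C := fun y => (SimpleGraph.fromEdgeSet (PE D)).Reachable (Sum.inl z) (Sum.inl y)) (SimpleGraph.Reachable.refl _)
      intro p q hr hpq
      refine hr.trans ?_
      rcases adj_cases (D := D) hpq with hu | ⟨x, hx⟩
      · exact reach_edge (mem_PE_vv.2 hu)
      · exact (reach_edge (half_mem_left hpq hx)).trans (reach_edge (half_mem_right hpq hx)).symm
    rintro (y | x)
    · exact h1 y
    · obtain ⟨a, b, hab, hx⟩ := exists_half x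
      exact (h1 a).trans (reach_edge (half_mem_left hab hx))
  haveI : Nonempty (Nd D) := ⟨Sum.inl z⟩
  exact ⟨fun p q => (key p).symm.trans (key q)⟩

/-- structure of a crossing -/
theorem Hyp.cross_struct (H : Hyp D) {x : D.crossingSet} (h : G.Adj a b) (hx : x.1 ∈ D.edgeInt s(a, b)) :
    ∃ c d, G.Adj c d ∧ x.1 ∈ D.edgeInt s(c, d) ∧ a ≠ c ∧ a ≠ d ∧ b ≠ c ∧ b ≠ d ∧
      ∀ u v, G.Adj u v → x.1 ∈ D.edgeInt s(u, v) → s(u, v) = s(a, b) ∨ s(u, v) = s(c, d) := by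
  obtain ⟨f, hne, hxf, hc⟩ := partner x.2 hx
  obtain ⟨c, d, hcd, rfl, -⟩ := id hxf
  refine ⟨c, d, hcd, hxf, ?_, ?_, ?_, ?_, ?_⟩
  · rintro rfl
    exact hne (by rw [adj_unique H.good h hcd hx hxf])
  · rintro rfl
    exact hne (by rw [adj_unique H.good h hcd.symm hx (swap_mem hxf), Sym2.eq_swap])
  · rintro rfl
    exact hne (by rw [Sym2.eq_swap, adj_unique H.good h.symm hcd (swap_mem hx) hxf])
  · rintro rfl
    exact hne (by rw [adj_unique H.good h.symm hcd.symm (swap_mem hx) (swap_mem hxf)])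
  · intro u v huv hxu
    by_cases hh : s(u, v) = s(a, b)
    · exact Or.inl hh
    · right
      exact H.op s(a, b) ⟨fun h' => hh h'.symm, x.1, hx, hxu⟩ hc

theorem unc_not_half (h : Unc D u v) (x : D.crossingSet) : x.1 ∉ D.edgeInt s(u, v) := by
  intro hx
  obtain ⟨f, -, -, hc⟩ := partner x.2 hx
  exact h.2 f hc

theorem edgeInt_sub_K (hg : D.IsGood) : D.edgeInt e ⊆ (pz D).K (PE D) := by
  rw [edgeInt_good hg]
  exact sdiff_subset.trans (arcS_sub_K hg)

variable [Finite V] [Finite (Nd D)]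

theorem Hyp.lf (H : Hyp D) (n : Nd D) : LF ((pz D).K (PE D)) ((pz D).pos n) := by
  rcases n with v | x
  · obtain ⟨w, hw⟩ := H.exists_adj v
    rcases adj_cases (D := D) hw with hu | ⟨x, hx⟩
    · exact H.plane.lf_node (mem_PE_vv.2 hu) (by simp)
    · exact H.plane.lf_node (half_mem_left hw hx) (by simp)
  · obtain ⟨a, b, hab, hx⟩ := exists_half x
    exact H.plane.lf_node (half_mem_left hab hx) (by simp)

/-- vertices on a common face are joined by an uncrossed edge -/
theorem Hyp.pp (H : Hyp D) (hF : F ∈ (pz D).fc (PE D)) (huv : u ≠ v) (hu : D.pos u ∈ closure F)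
    (hv : D.pos v ∈ closure F) : Unc D u v := by
  obtain ⟨S, hS, hSF⟩ := H.plane.join hF (H.lf (Sum.inl u)) (H.lf (Sum.inl v)) PD.pos_mem_K PD.pos_mem_K
    (fun h => huv (D.pos_inj h)) hu hv
  rw [pz_pos_inl, pz_pos_inl] at hSF hS
  apply principleP H.max H.imm huv hS
  · intro w hw
    rcases hSF hw with h | h | h
    · exact Or.inl (D.pos_inj h)
    · exact Or.inr (D.pos_inj h)
    · exact absurd (PD.pos_mem_K (n := Sum.inl w)) (face_sub hF h)
  · intro g
    rw [eq_empty_iff_forall_notMem]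
    rintro y ⟨hy, hyg⟩
    rcases hSF hy with rfl | h | h
    · exact edgeInt_pos H.good hyg
    · rw [mem_singleton_iff.1 h] at hyg
      exact edgeInt_pos H.good hyg
    · exact face_sub hF h (edgeInt_sub_K H.good hyg)

end
end PT

namespace PT
open Topology

theorem IsArc.conn_sdiff {S : Set Pl} {a x : Pl} (h1 : IsArc S a x) : IsPreconnected (S \ {x}) := by
  refine h1.int_conn.subset_closure (sdiff_subset_sdiff_right (by simp)) ?_
  intro y hy
  rw [mem_closure_iff_nhds]
  intro U hU
  obtain ⟨z, hz, hzU⟩ := h1.int_dense hy.1 hU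
  exact ⟨z, hzU, hz⟩

namespace PD
variable {N : Type*} {P : PD N} {E : Set (Sym2 N)} [Finite N]

/-- A 3-cycle whose complement is connected bounds a face. -/
theorem IsPlane.tri (h : P.IsPlane E) (hb : BF E) {φ : Fin 3 → N} (hφ : Function.Injective φ)
    (hE : ∀ i j, i ≠ j → s(φ i, φ j) ∈ E) {n₀ : N} (hn₀ : n₀ ∉ range φ)
    (hc : ∀ C : N → Prop, C n₀ → (∀ m n, m ∉ range φ → n ∉ range φ → s(m, n) ∈ E → C m → C n) →
      ∀ n, n ∉ range φ → C n) :
    ∃ S ∈ P.fc E, P.bd E S = {s(φ 0, φ 1), s(φ 1, φ 2), s(φ 0, φ 2)} := by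
  set E' : Set (Sym2 (Fin 3)) := {e | ¬ e.IsDiag} with hE'
  have hm : ∀ e ∈ E', e.map φ ∈ E := by
    intro e he
    induction e using Sym2.ind with
    | _ i j => exact hE i j (by simpa [hE'] using he)
  have hQ : (P.comap φ).IsPlane E' := h.comap hφ hm
  set J := (P.comap φ).K E' with hJ
  have hposJ : ∀ i, P.pos (φ i) ∈ J := fun i => Or.inl ⟨i, rfl⟩
  have hJK : J ⊆ P.K E := by
    rintro p (⟨i, rfl⟩ | hp)
    · exact pos_mem_K
    · simp only [mem_iUnion] at hp
      obtain ⟨e, he, hp⟩ := hp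
      exact arc_sub_K (hm e he) hp
  have hmeet : ∀ g ∈ E, (∀ e ∈ E', e.map φ ≠ g) → ∀ p ∈ P.arc g, p ∈ J → ∃ i, p = P.pos (φ i) ∧ φ i ∈ g := by
    rintro g hg hgT p hp (⟨i, rfl⟩ | hpJ)
    · exact ⟨i, rfl, h.inc g hg _ hp⟩
    · simp only [mem_iUnion] at hpJ
      obtain ⟨e, he, hpe⟩ := hpJ
      obtain ⟨n, rfl⟩ := h.disj _ (hm e he) g hg (hgT e he) ⟨hpe, hp⟩
      have := h.inc _ (hm e he) n hpe
      rw [Sym2.mem_map] at this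
      obtain ⟨i, -, rfl⟩ := this
      exact ⟨i, rfl, h.inc g hg _ hp⟩
  have hnodeJ : ∀ n, n ∉ range φ → P.pos n ∉ J := by
    rintro n hn (⟨i, hi⟩ | hpJ)
    · exact hn ⟨i, h.inj hi⟩
    · simp only [mem_iUnion] at hpJ
      obtain ⟨e, he, hpe⟩ := hpJ
      have := h.inc _ (hm e he) n hpe
      rw [Sym2.mem_map] at this
      obtain ⟨i, -, rfl⟩ := this
      exact hn ⟨i, rfl⟩
  have hout : ∀ n g, n ∉ range φ → n ∈ g → ∀ e ∈ E', e.map φ ≠ g := by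
    rintro n g hn hng e he rfl
    rw [Sym2.mem_map] at hng
    obtain ⟨i, -, rfl⟩ := hng
    exact hn ⟨i, rfl⟩
  have hin : ∀ m n, s(m, n) ∈ E → (∀ e ∈ E', e.map φ ≠ s(m, n)) → m ∉ range φ ∨ n ∉ range φ := by
    intro m n hmn hT
    by_contra hcon
    push Not at hcon
    obtain ⟨⟨i, rfl⟩, ⟨j, rfl⟩⟩ := hcon
    refine hT s(i, j) ?_ rfl
    have := h.ne hmn
    simp only [hE', mem_ofPred_eq, Sym2.mk_isDiag_iff]
    exact fun hij => this (by rw [hij])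
  obtain ⟨Φ, hΦ, h0⟩ := exists_face (hnodeJ n₀ hn₀)
  replace hΦ : Φ ∈ (P.comap φ).fc E' := hΦ
  have hΦarc : ∀ m n, s(m, n) ∈ E → n ∉ range φ → P.pos n ∈ Φ → P.arc s(m, n) \ {P.pos m} ⊆ Φ := by
    intro m n hmn hn hnΦ
    have ha := h.isArc m n hmn
    refine face_max hΦ ha.symm.conn_sdiff ?_ ⟨_, ⟨ha.right_mem, fun hh => h.ne hmn (h.inj hh).symm⟩, hnΦ⟩
    rintro p ⟨hp, hpm⟩ hpJ
    obtain ⟨i, rfl, hi⟩ := hmeet _ hmn (hout n _ hn (by simp)) p hp hpJ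
    rw [Sym2.mem_iff] at hi
    rcases hi with rfl | rfl
    · exact hpm rfl
    · exact hn ⟨i, rfl⟩
  have hall : ∀ n, n ∉ range φ → P.pos n ∈ Φ := by
    refine hc (fun n => P.pos n ∈ Φ) h0 ?_
    intro m n hmr hnr hmn hmΦ
    have ha := h.isArc m n hmn
    have : P.arc s(m, n) ⊆ Φ := by
      obtain ⟨γ, h1, h2, h3, h4, h5⟩ := ha
      refine face_max hΦ (h5 ▸ isPreconnected_Icc.image _ h1) ?_ ⟨_, (h.isArc m n hmn).left_mem, hmΦ⟩
      intro p hp hpJ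
      obtain ⟨i, rfl, hi⟩ := hmeet _ hmn (hout n _ hnr (by simp)) p hp hpJ
      rw [Sym2.mem_iff] at hi
      rcases hi with rfl | rfl
      · exact hmr ⟨i, rfl⟩
      · exact hnr ⟨i, rfl⟩
    exact this ha.right_mem
  -- every point of an edge outside the triangle
  have hpt : ∀ g ∈ E, (∀ e ∈ E', e.map φ ≠ g) → ∀ p ∈ P.arc g, p ∈ Φ ∨ p ∈ range P.pos := by
    intro g hg hT p hp
    induction g using Sym2.ind with
    | _ m n =>
      by_cases hpm : p ∈ range P.pos
      · exact Or.inr hpm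
      · left
        rcases hin m n hg hT with hh | hh
        · rw [Sym2.eq_swap] at hg hp
          exact hΦarc n m hg hh (hall _ hh) ⟨hp, fun h' => hpm ⟨_, h'.symm⟩⟩
        · exact hΦarc m n hg hh (hall _ hh) ⟨hp, fun h' => hpm ⟨_, h'.symm⟩⟩
  have hnb : NonBridge E' (0 : Fin 3) 1 := by
    refine (reach_edge (b := 2) ?_).trans (reach_edge ?_) <;> simp [hE', Sym2.eq_iff]
  have h01 : s((0 : Fin 3), 1) ∈ E' := by simp [hE']
  obtain ⟨S, hS, hSΦ⟩ : ∃ S ∈ (P.comap φ).adjF E' s(0, 1), S ≠ Φ := by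
    obtain ⟨F₁, F₂, hne, h2⟩ := hQ.adj_two h01 hnb
    by_cases hh : F₁ = Φ
    · exact ⟨F₂, by rw [h2]; simp, fun h' => hne (hh.trans h'.symm)⟩
    · exact ⟨F₁, by rw [h2]; simp, hh⟩
  have hdis : ∀ p ∈ S, p ∉ Φ := fun p hp hp' => hSΦ (face_eq hS.1 hΦ hp hp')
  have hSK : S ⊆ (P.K E)ᶜ := by
    have hnode : ∀ n, P.pos n ∉ S := by
      intro n hn
      by_cases hr : n ∈ range φ
      · obtain ⟨i, rfl⟩ := hr
        exact face_sub hS.1 hn (hposJ i)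
      · exact hdis _ hn (hall n hr)
    rintro p hp (⟨n, rfl⟩ | hpK)
    · exact hnode n hp
    · simp only [mem_iUnion] at hpK
      obtain ⟨g, hg, hpg⟩ := hpK
      by_cases hT : ∀ e ∈ E', e.map φ ≠ g
      · rcases hpt g hg hT p hpg with hh | ⟨n, rfl⟩
        · exact hdis _ hp hh
        · exact hnode n hp
      · push Not at hT
        obtain ⟨e, he, rfl⟩ := hT
        exact face_sub hS.1 hp (arc_sub_K (P := P.comap φ) he hpg)
  have hSf : S ∈ P.fc E := by
    obtain ⟨s, hs⟩ := face_nonempty hS.1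
    obtain ⟨F', hF', hsF⟩ := exists_face (hSK hs)
    have h1 : S ⊆ F' := face_max hF' (face_conn hS.1) hSK ⟨s, hs, hsF⟩
    have h2 : F' ⊆ S := face_max hS.1 (face_conn hF') ((face_sub hF').trans (compl_subset_compl.2 hJK)) ⟨s, hsF, hs⟩
    rw [h1.antisymm h2]
    exact hF'
  have hbdT : ∀ g ∈ P.bd E S, ∃ e ∈ E', e.map φ = g := by
    rintro g ⟨hg, y, hy, hyS⟩
    by_contra hT
    push Not at hT
    rcases hpt g hg hT y hy.1 with hh | hh
    · obtain ⟨z, hz, hzS⟩ := mem_closure_iff.1 hyS Φ (face_open hQ.closed hΦ) hh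
      exact hdis z hzS hz
    · exact hy.2 hh
  have hmk : ∀ m n, s(m, n) ∈ P.bd E S → ∃ i j, m = φ i ∧ n = φ j ∧ i ≠ j := by
    intro m n hmn
    obtain ⟨e, he, hee⟩ := hbdT _ hmn
    induction e using Sym2.ind with
    | _ i j =>
      have hij : i ≠ j := by simpa [hE'] using he
      rw [Sym2.map_mk, Sym2.eq_iff] at hee
      rcases hee with ⟨h1, h2⟩ | ⟨h1, h2⟩
      · exact ⟨i, j, h1.symm, h2.symm, hij⟩
      · exact ⟨j, i, h2.symm, h1.symm, hij.symm⟩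
  have b01 : s(φ 0, φ 1) ∈ P.bd E S := by
    refine ⟨hE 0 1 (by decide), ?_⟩
    obtain ⟨y, hy, hyS⟩ := hS.2
    refine ⟨y, ⟨hy.1, ?_⟩, hyS⟩
    rintro ⟨n, rfl⟩
    have := h.inc _ (hE 0 1 (by decide)) n hy.1
    rw [Sym2.mem_iff] at this
    rcases this with rfl | rfl
    · exact hy.2 ⟨0, rfl⟩
    · exact hy.2 ⟨1, rfl⟩
  have b02 : s(φ 0, φ 2) ∈ P.bd E S := by
    obtain ⟨c, hc1, hcb⟩ := h.D2 hSf b01 (hb _ _ b01.1)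
    obtain ⟨i, j, hi, rfl, hij⟩ := hmk _ _ hcb
    have := hφ hi
    subst this
    have : j = 2 := by
      have : j ≠ 1 := fun hh => hc1 (by rw [hh])
      omega
    rwa [this] at hcb
  have b12 : s(φ 1, φ 2) ∈ P.bd E S := by
    have b10 : s(φ 1, φ 0) ∈ P.bd E S := by rw [Sym2.eq_swap]; exact b01
    obtain ⟨c, hc1, hcb⟩ := h.D2 hSf b10 (hb _ _ b10.1)
    obtain ⟨i, j, hi, rfl, hij⟩ := hmk _ _ hcb
    have := hφ hi
    subst this
    have : j = 2 := by
      have : j ≠ 0 := fun hh => hc1 (by rw [hh])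
      omega
    rwa [this] at hcb
  refine ⟨S, hSf, ?_⟩
  apply Subset.antisymm
  · intro g hg
    induction g using Sym2.ind with
    | _ m n =>
      obtain ⟨i, j, rfl, rfl, hij⟩ := hmk m n hg
      fin_cases i <;> fin_cases j <;> first | exact absurd rfl hij | simp [Sym2.eq_iff]
  · rintro g (rfl | rfl | rfl)
    · exact b01
    · exact b12
    · exact b02

end PD
end PT

namespace PT
open Topology
section
variable {V : Type} {G : SimpleGraph V} {D : Drawing G} {u v w a b c : V} {e f : Sym2 V} {F : Set Pl}
variable [Finite V] [Finite (Nd D)]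

/-- Structure of the false faces. -/
theorem Hyp.false_face (H : Hyp D) (hF : F ∈ (pz D).fc (PE D)) {x : D.crossingSet}
    (he : s(Sum.inl a, Sum.inr x) ∈ (pz D).bd (PE D) F) :
    ∃ b, b ≠ a ∧ Unc D a b ∧ (pz D).bd (PE D) F =
      {s(Sum.inl a, Sum.inr x), s(Sum.inr x, Sum.inl b), s(Sum.inl a, Sum.inl b)} := by
  have hP := H.plane
  have hbf := H.bf
  obtain ⟨a', haa', hxa⟩ := mem_PE_vx.1 he.1
  have he' : s(Sum.inr x, Sum.inl a) ∈ (pz D).bd (PE D) F := by rw [Sym2.eq_swap]; exact he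
  have hacl : D.pos a ∈ closure F := hP.bd_pos hF he
  obtain ⟨c, hc, hcb⟩ := hP.D2 hF he' (hbf _ _ he'.1)
  rcases c with b | y
  swap
  · exact absurd hcb.1 not_mem_PE_xx
  have hba : b ≠ a := fun h => hc (by rw [h])
  have hcb' : s(Sum.inl b, Sum.inr x) ∈ (pz D).bd (PE D) F := by rw [Sym2.eq_swap]; exact hcb
  obtain ⟨b', hbb', hxb⟩ := mem_PE_vx.1 hcb'.1
  have hbcl : D.pos b ∈ closure F := hP.bd_pos hF hcb'
  have hab : Unc D a b := H.pp hF hba.symm hacl hbcl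
  obtain ⟨c, d, hcd, hxc, h1, h2, h3, h4, hall⟩ := H.cross_struct haa' hxa
  have hbcd : s(b, b') = s(c, d) := by
    rcases hall b b' hbb' hxb with hh | hh
    · exfalso
      rw [Sym2.eq_iff] at hh
      rcases hh with ⟨hh, -⟩ | ⟨hh, -⟩
      · exact hba hh
      · subst hh
        exact unc_not_half hab x hxa
    · exact hh
  have hall' : ∀ v, HalfAdj D v x → v = a ∨ v = a' ∨ v = b ∨ v = b' := by
    rintro v ⟨w, hvw, hx⟩
    have := hall v w hvw hx
    rw [← hbcd] at this
    simp only [Sym2.eq_iff] at this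
    tauto
  have hd : a ≠ b ∧ a ≠ b' ∧ a' ≠ b ∧ a' ≠ b' := by
    rw [Sym2.eq_iff] at hbcd
    rcases hbcd with ⟨rfl, rfl⟩ | ⟨rfl, rfl⟩ <;> tauto
  have hna : s(Sum.inl a', Sum.inr x) ∉ (pz D).bd (PE D) F := by
    intro hh
    have : D.pos a' ∈ closure F := hP.bd_pos hF hh
    exact unc_not_half (H.pp hF haa'.ne hacl this) x hxa
  have hnb : s(Sum.inl b', Sum.inr x) ∉ (pz D).bd (PE D) F := by
    intro hh
    have : D.pos b' ∈ closure F := hP.bd_pos hF hh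
    exact unc_not_half (H.pp hF hbb'.ne hbcl this) x hxb
  refine ⟨b, hba, hab, ?_⟩
  -- the triangle
  let φ : Fin 3 → Nd D := ![Sum.inl a, Sum.inr x, Sum.inl b]
  have hφ : Function.Injective φ := by
    intro i j hij
    fin_cases i <;> fin_cases j <;> simp [φ, hba, hba.symm] at hij ⊢
  have hE : ∀ i j, i ≠ j → s(φ i, φ j) ∈ PE D := by
    intro i j hij
    fin_cases i <;> fin_cases j <;> first | exact absurd rfl hij | skip
    · exact he.1
    · exact mem_PE_vv.2 hab
    · exact he'.1
    · exact hcb.1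
    · exact mem_PE_vv.2 hab.symm
    · exact hcb'.1
  have hr : ∀ v, Sum.inl v ∉ range φ ↔ v ≠ a ∧ v ≠ b := by
    intro v
    simp only [φ, mem_range, Fin.exists_fin_succ]
    simp
    tauto
  have hrx : ∀ y, Sum.inr y ∉ range φ ↔ y ≠ x := by
    intro v
    simp only [φ, mem_range, Fin.exists_fin_succ]
    simp
    tauto
  obtain ⟨z, hz⟩ := H.exists_ne [a, b] (by simp)
  simp only [List.mem_cons, List.not_mem_nil, or_false, not_or] at hz
  obtain ⟨S, hS, hbd⟩ := hP.tri hbf hφ hE (n₀ := Sum.inl z) ((hr z).2 hz) (by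
    intro C hC step
    have hv : ∀ w, w ≠ a → w ≠ b → C (Sum.inl w) := by
      refine H.conn_ind a b hz.1 hz.2 hC ?_
      intro p q hpa hpb hqa hqb hCp hpq
      rcases adj_cases (D := D) hpq with hu | ⟨y, hy⟩
      · exact step _ _ ((hr p).2 ⟨hpa, hpb⟩) ((hr q).2 ⟨hqa, hqb⟩) (mem_PE_vv.2 hu) hCp
      · have hyx : y ≠ x := by
          rintro rfl
          have := hall p q hpq hy
          rw [← hbcd] at this
          simp only [Sym2.eq_iff] at this
          grind
        have hh := step _ _ ((hr p).2 ⟨hpa, hpb⟩) ((hrx y).2 hyx) (half_mem_left hpq hy) hCp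
        exact step _ _ ((hrx y).2 hyx) ((hr q).2 ⟨hqa, hqb⟩) (by rw [Sym2.eq_swap]; exact half_mem_right hpq hy) hh
    rintro (w | y) hn
    · exact hv w ((hr w).1 hn).1 ((hr w).1 hn).2
    · obtain ⟨p, p', hpp, hp⟩ := exists_half y
      obtain ⟨q, q', hqq, hq, k1, k2, k3, k4, -⟩ := H.cross_struct hpp hp
      obtain ⟨w, hwa, hwb, hw⟩ : ∃ w, w ≠ a ∧ w ≠ b ∧ s(Sum.inl w, Sum.inr y) ∈ PE D := by
        have i1 := half_mem_left hpp hp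
        have i2 := half_mem_right hpp hp
        have i3 := half_mem_left hqq hq
        have i4 := hpp.ne
        by_cases j1 : p = a ∨ p = b
        · by_cases j2 : p' = a ∨ p' = b
          · refine ⟨q, ?_, ?_, i3⟩
            · rintro rfl; clear * - k1 k3 j1 j2 i4; grind
            · rintro rfl; clear * - k1 k3 j1 j2 i4; grind
          · exact ⟨p', fun h => j2 (Or.inl h), fun h => j2 (Or.inr h), i2⟩
        · exact ⟨p, fun h => j1 (Or.inl h), fun h => j1 (Or.inr h), i1⟩
      exact step _ _ ((hr w).2 ⟨hwa, hwb⟩) hn hw (hv w hwa hwb))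
  have hφ0 : φ 0 = Sum.inl a := rfl
  have hφ1 : φ 1 = Sum.inr x := rfl
  have hφ2 : φ 2 = Sum.inl b := rfl
  rw [hφ0, hφ1, hφ2] at hbd
  suffices F = S by rw [this, hbd]
  by_contra hFS
  have hsa : s(Sum.inl a', Sum.inr x) ∉ (pz D).bd (PE D) S := by
    rw [hbd]
    simp only [mem_insert_iff, mem_singleton_iff, Sym2.eq_iff, Sum.inl.injEq, reduceCtorEq, and_false, or_false, and_true, false_and, false_or]
    exact not_or.2 ⟨haa'.ne.symm, hd.2.2.1⟩
  have hsb : s(Sum.inl b', Sum.inr x) ∉ (pz D).bd (PE D) S := by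
    rw [hbd]
    simp only [mem_insert_iff, mem_singleton_iff, Sym2.eq_iff, Sum.inl.injEq, reduceCtorEq, and_false, or_false, and_true, false_and, false_or]
    exact not_or.2 ⟨hd.2.1.symm, hbb'.ne.symm⟩
  have hxcl : (pz D).pos (Sum.inr x) ∈ closure S := by
    have : s(Sum.inr x, Sum.inl b) ∈ (pz D).bd (PE D) S := by rw [hbd]; simp
    exact hP.bd_pos hS this
  have two : ∀ v, s(Sum.inl v, Sum.inr x) ∈ (pz D).bd (PE D) F → s(Sum.inl v, Sum.inr x) ∈ (pz D).bd (PE D) S →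
      (pz D).adjF (PE D) s(Sum.inl v, Sum.inr x) ⊆ {S, F} := by
    intro v h1 h2
    obtain ⟨F₁, F₂, hne, hadj⟩ := hP.adj_two h1.1 (hbf _ _ h1.1)
    have i1 : F ∈ (pz D).adjF (PE D) s(Sum.inl v, Sum.inr x) := ⟨hF, h1.2⟩
    have i2 : S ∈ (pz D).adjF (PE D) s(Sum.inl v, Sum.inr x) := ⟨hS, h2.2⟩
    rw [hadj] at i1 i2 ⊢
    simp only [mem_insert_iff, mem_singleton_iff] at i1 i2
    intro Z hZ
    simp only [mem_insert_iff, mem_singleton_iff] at hZ ⊢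
    grind
  have disj : ∀ v, s(Sum.inl v, Sum.inr x) ∈ PE D → s(Sum.inl v, Sum.inr x) ∉ (pz D).bd (PE D) F → s(Sum.inl v, Sum.inr x) ∉ (pz D).bd (PE D) S →
      Disjoint ((pz D).adjF (PE D) s(Sum.inl v, Sum.inr x)) {S, F} := by
    intro v hv h1 h2
    rw [disjoint_right]
    rintro Z (rfl | rfl) hZ
    · exact h2 ⟨hv, hZ.2⟩
    · exact h1 ⟨hv, hZ.2⟩
  have ha'E : s(Sum.inl a', Sum.inr x) ∈ PE D := half_mem_right haa' hxa
  have key := hP.corner (n := Sum.inr x) (𝓕 := {S, F}) (F := S) (e := s(Sum.inl a', Sum.inr x)) (by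
      rintro Z (rfl | rfl)
      · exact hS
      · exact hF) (by
      intro e he1 hxe
      obtain ⟨m, rfl⟩ := hxe
      rcases m with v | y
      · rw [Sym2.eq_swap] at he1 ⊢
        rcases hall' v (mem_PE_vx.1 he1) with rfl | rfl | rfl | rfl
        · exact Or.inl (two _ he (by rw [hbd]; simp))
        · exact Or.inr (disj _ he1 hna hsa)
        · exact Or.inl (two _ hcb' (by rw [hbd]; simp [Sym2.eq_swap]))
        · exact Or.inr (disj _ he1 hnb hsb)
      · exact absurd he1 not_mem_PE_xx) (by simp) hxcl ha'E (by simp)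
  obtain ⟨Z, hZ⟩ := hP.adj_nonempty ha'E
  exact disjoint_left.1 (disj _ ha'E hna hsa) hZ (key hZ)

end
end PT

namespace PT
open Topology
section
variable {V : Type} {G : SimpleGraph V} {D : Drawing G} {u v w a b c d : V} {e f : Sym2 V} {F F' : Set Pl}

/-- a true triangular face -/
structure Tri (D : Drawing G) (F : Set Pl) (a b c : V) : Prop where
  mem : F ∈ (pz D).fc (PE D)
  ab : a ≠ b
  bc : b ≠ c
  ac : a ≠ c
  bd : (pz D).bd (PE D) F = {s(Sum.inl a, Sum.inl b), s(Sum.inl b, Sum.inl c), s(Sum.inl a, Sum.inl c)}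

theorem Tri.rot (h : Tri D F a b c) : Tri D F b c a := by
  refine ⟨h.mem, h.bc, h.ac.symm, h.ab.symm, ?_⟩
  rw [h.bd, Sym2.eq_swap (a := (Sum.inl c : Nd D)), Sym2.eq_swap (a := (Sum.inl b : Nd D)) (b := Sum.inl a)]
  ext g; simp only [mem_insert_iff, mem_singleton_iff]; tauto

theorem Tri.swap (h : Tri D F a b c) : Tri D F b a c := by
  refine ⟨h.mem, h.ab.symm, h.ac, h.bc, ?_⟩
  rw [h.bd, Sym2.eq_swap (a := (Sum.inl b : Nd D)) (b := Sum.inl a)]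
  ext g; simp only [mem_insert_iff, mem_singleton_iff]; tauto

theorem Tri.eab (h : Tri D F a b c) : s(Sum.inl a, Sum.inl b) ∈ (pz D).bd (PE D) F := by rw [h.bd]; simp
theorem Tri.uab (h : Tri D F a b c) : Unc D a b := mem_PE_vv.1 h.eab.1
theorem Tri.ubc (h : Tri D F a b c) : Unc D b c := h.rot.uab
theorem Tri.uca (h : Tri D F a b c) : Unc D c a := h.rot.rot.uab

theorem Tri.edge (h : Tri D F a b c) {m : Nd D} (hm : s(Sum.inl a, m) ∈ (pz D).bd (PE D) F) :
    m = Sum.inl b ∨ m = Sum.inl c := by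
  rw [h.bd] at hm
  simp only [mem_insert_iff, mem_singleton_iff, Sym2.eq_iff, Sum.inl.injEq] at hm
  have := h.ab
  have := h.ac
  tauto

theorem Tri.opp (h : Tri D F a b c) (h' : Tri D F a b d) : c = d := by
  have h1 := h.rot.rot.swap.eab
  rcases h'.edge h1 with hh | hh
  · exact absurd (Sum.inl.inj hh) h.bc.symm
  · exact Sum.inl.inj hh

theorem Tri.third {p q r : V} (h : Tri D F p q r) (he : s(Sum.inl a, Sum.inl b) ∈ (pz D).bd (PE D) F) :
    ∃ d, Tri D F a b d := by
  rw [h.bd] at he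
  simp only [mem_insert_iff, mem_singleton_iff, Sym2.eq_iff, Sum.inl.injEq] at he
  rcases he with (⟨rfl, rfl⟩ | ⟨rfl, rfl⟩) | (⟨rfl, rfl⟩ | ⟨rfl, rfl⟩) | (⟨rfl, rfl⟩ | ⟨rfl, rfl⟩)
  · exact ⟨_, h⟩
  · exact ⟨_, h.swap⟩
  · exact ⟨_, h.rot⟩
  · exact ⟨_, h.rot.swap⟩
  · exact ⟨_, h.rot.rot.swap⟩
  · exact ⟨_, h.rot.rot⟩

variable [Finite V] [Finite (Nd D)]

theorem Tri.cl (h : Tri D F a b c) (H : Hyp D) : D.pos a ∈ closure F := H.plane.bd_pos h.mem h.eab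

theorem Hyp.four (H : Hyp D) (hF : F ∈ (pz D).fc (PE D)) (hab : a ≠ b) (hac : a ≠ c) (had : a ≠ d)
    (hbc : b ≠ c) (hbd : b ≠ d) (hcd : c ≠ d) (ha : D.pos a ∈ closure F) (hb : D.pos b ∈ closure F)
    (hc : D.pos c ∈ closure F) (hd : D.pos d ∈ closure F) : False := by
  let ψ : Fin 4 → V := ![a, b, c, d]
  have hψ : Function.Injective ψ := by
    intro i j hij
    fin_cases i <;> fin_cases j <;> simp [ψ, hab, hac, had, hbc, hbd, hcd, hab.symm, hac.symm, had.symm, hbc.symm, hbd.symm, hcd.symm] at hij ⊢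
  have hcl : ∀ i, D.pos (ψ i) ∈ closure F := by
    intro i; fin_cases i <;> assumption
  exact H.plane.no_K4 (φ := fun i => Sum.inl (ψ i)) (fun i j hij => hψ (Sum.inl.inj hij))
    (fun i j hij => mem_PE_vv.2 (H.pp hF (fun h => hij (hψ h)) (hcl i) (hcl j))) hF hcl

theorem Hyp.two_faces (H : Hyp D) : 2 ≤ ((pz D).fc (PE D)).ncard := by
  obtain ⟨z, -⟩ := H.exists_ne [] (by simp)
  obtain ⟨w, hw⟩ := H.exists_adj z
  have : ∃ m : Nd D, s(Sum.inl z, m) ∈ PE D := by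
    rcases adj_cases (D := D) hw with hu | ⟨x, hx⟩
    · exact ⟨_, mem_PE_vv.2 hu⟩
    · exact ⟨_, half_mem_left hw hx⟩
  obtain ⟨m, hm⟩ := this
  obtain ⟨F₁, F₂, hne, h2⟩ := H.plane.adj_two hm (H.bf _ _ hm)
  rw [← ncard_pair hne, ← h2]
  exact ncard_le_ncard (sep_subset _ _) H.plane.faces_finite

theorem Hyp.true_face (H : Hyp D) (hF : F ∈ (pz D).fc (PE D))
    (ht : ∀ v x, s(Sum.inl v, Sum.inr x) ∉ (pz D).bd (PE D) F) : ∃ a b c, Tri D F a b c := by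
  have hP := H.plane
  obtain ⟨⟨e, he⟩, hd⟩ := hP.bd_minDeg H.bf hF H.two_faces
  have hvv : ∀ m n, s(m, n) ∈ (pz D).bd (PE D) F → ∃ u v, m = Sum.inl u ∧ n = Sum.inl v ∧ u ≠ v ∧
      D.pos u ∈ closure F ∧ D.pos v ∈ closure F := by
    rintro (u | x) (v | y) hh
    · exact ⟨u, v, rfl, rfl, fun h => hP.ne hh.1 (by rw [h]), hP.bd_pos hF hh,
        hP.bd_pos (a := Sum.inl v) (b := Sum.inl u) hF (by rw [Sym2.eq_swap]; exact hh)⟩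
    · exact absurd hh (ht u y)
    · rw [Sym2.eq_swap] at hh
      exact absurd hh (ht v x)
    · exact absurd hh.1 not_mem_PE_xx
  induction e using Sym2.ind with
  | _ m n =>
    obtain ⟨a, b, rfl, rfl, hab, ha, hb⟩ := hvv _ _ he
    obtain ⟨m, hm, hac⟩ := hd _ _ he
    obtain ⟨_, c, h0, rfl, hac', -, hc⟩ := hvv _ _ hac
    obtain rfl := Sum.inl.inj h0
    have hcb : c ≠ b := fun h => hm (by rw [h])
    have he' : s(Sum.inl b, Sum.inl a) ∈ (pz D).bd (PE D) F := by rw [Sym2.eq_swap]; exact he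
    obtain ⟨m, hm', hbd⟩ := hd _ _ he'
    obtain ⟨_, d, h0, rfl, hbd', -, hdc⟩ := hvv _ _ hbd
    obtain rfl := Sum.inl.inj h0
    have hda : d ≠ a := fun h => hm' (by rw [h])
    have hcd : c = d := by
      by_contra hcd
      exact H.four hF hab hac' hda.symm hcb.symm hbd' hcd ha hb hc hdc
    subst hcd
    refine ⟨a, b, c, hF, hab, hbd', hac', ?_⟩
    apply Subset.antisymm
    · intro g hg
      have mem : ∀ w, D.pos w ∈ closure F → w = a ∨ w = b ∨ w = c := by
        intro w hw
        by_contra hcon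
        push Not at hcon
        exact H.four hF hab hac' hcon.1.symm hbd' hcon.2.1.symm hcon.2.2.symm ha hb hc hw
      induction g using Sym2.ind with
      | _ m n =>
        obtain ⟨p, q, rfl, rfl, hpq, hp, hq⟩ := hvv _ _ hg
        rcases mem p hp with rfl | rfl | rfl <;> rcases mem q hq with rfl | rfl | rfl <;>
          first | exact absurd rfl hpq | simp [Sym2.eq_iff]
    · rintro g (rfl | rfl | rfl)
      · exact he
      · exact hbd
      · exact hac

theorem Hyp.adj_pair (H : Hyp D) {e : Sym2 (Nd D)} (hF : F ∈ (pz D).fc (PE D)) (hF' : F' ∈ (pz D).fc (PE D))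
    (hne : F ≠ F') (h1 : e ∈ (pz D).bd (PE D) F) (h2 : e ∈ (pz D).bd (PE D) F') :
    (pz D).adjF (PE D) e = {F, F'} := by
  induction e using Sym2.ind with
  | _ m n =>
    obtain ⟨F₁, F₂, hne', hadj⟩ := H.plane.adj_two h1.1 (H.bf _ _ h1.1)
    have i1 : F ∈ (pz D).adjF (PE D) s(m, n) := ⟨hF, h1.2⟩
    have i2 : F' ∈ (pz D).adjF (PE D) s(m, n) := ⟨hF', h2.2⟩
    rw [hadj] at i1 i2 ⊢
    simp only [mem_insert_iff, mem_singleton_iff] at i1 i2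
    ext Z
    simp only [mem_insert_iff, mem_singleton_iff]
    grind

/-- a closed system of faces around a vertex determines the neighbours -/
theorem Hyp.nbrs (H : Hyp D) {𝓕 : Set (Set Pl)} (h𝓕 : 𝓕 ⊆ (pz D).fc (PE D)) (hF : F ∈ 𝓕) (ha : D.pos a ∈ closure F)
    (hvv : ∀ Z ∈ 𝓕, ∀ m, s(Sum.inl a, m) ∈ (pz D).bd (PE D) Z → ∃ w, m = Sum.inl w)
    (hcl : ∀ Z ∈ 𝓕, ∀ m, s(Sum.inl a, m) ∈ (pz D).bd (PE D) Z → (pz D).adjF (PE D) s(Sum.inl a, m) ⊆ 𝓕)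
    (hw : G.Adj a w) : ∃ Z ∈ 𝓕, s(Sum.inl a, Sum.inl w) ∈ (pz D).bd (PE D) Z := by
  have key : ∀ m, s(Sum.inl a, m) ∈ PE D → ∃ Z ∈ 𝓕, s(Sum.inl a, m) ∈ (pz D).bd (PE D) Z := by
    intro m hm
    obtain ⟨Z, hZ⟩ := H.plane.adj_nonempty hm
    have := H.plane.corner (n := Sum.inl a) h𝓕 (by
      intro e he hae
      obtain ⟨m, rfl⟩ := hae
      by_cases hh : ∃ Z ∈ 𝓕, s(Sum.inl a, m) ∈ (pz D).bd (PE D) Z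
      · obtain ⟨Z, hZ, hh⟩ := hh
        exact Or.inl (hcl Z hZ m hh)
      · right
        rw [disjoint_left]
        intro Z hZ1 hZ2
        exact hh ⟨Z, hZ2, he, hZ1.2⟩) hF ha hm (by simp)
    exact ⟨Z, this hZ, hm, hZ.2⟩
  rcases adj_cases (D := D) hw with hu | ⟨x, hx⟩
  · exact key _ (mem_PE_vv.2 hu)
  · obtain ⟨Z, hZ, hh⟩ := key _ (half_mem_left hw hx)
    obtain ⟨w, hw⟩ := hvv Z hZ _ hh
    simp at hw

/-- two different true faces on an edge have different apexes -/
theorem Hyp.apex (H : Hyp D) (h : Tri D F a b c) (h' : Tri D F' a b c) : F = F' := by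
  by_contra hne
  have hN : ∀ w, G.Adj a w → w = b ∨ w = c := by
    intro w hw
    obtain ⟨Z, hZ, hh⟩ := H.nbrs (𝓕 := {F, F'}) (F := F) (by
      rintro Z (rfl | rfl)
      · exact h.mem
      · exact h'.mem) (by simp) (h.cl H) (by
      rintro Z (rfl | rfl) m hm
      · rcases h.edge hm with rfl | rfl <;> exact ⟨_, rfl⟩
      · rcases h'.edge hm with rfl | rfl <;> exact ⟨_, rfl⟩) (by
      have e1 := (H.adj_pair h.mem h'.mem hne h.eab h'.eab).subset
      have e2 := (H.adj_pair h.mem h'.mem hne h.rot.rot.swap.eab h'.rot.rot.swap.eab).subset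
      rintro Z (rfl | rfl) m hm
      · rcases h.edge hm with rfl | rfl
        · exact e1
        · exact e2
      · rcases h'.edge hm with rfl | rfl
        · exact e1
        · exact e2) hw
    rcases hZ with rfl | rfl
    · rcases h.edge hh with h0 | h0
      · exact Or.inl (Sum.inl.inj h0)
      · exact Or.inr (Sum.inl.inj h0)
    · rcases h'.edge hh with h0 | h0
      · exact Or.inl (Sum.inl.inj h0)
      · exact Or.inr (Sum.inl.inj h0)
  obtain ⟨z, hz⟩ := H.exists_ne [a, b, c] (by simp)
  simp only [List.mem_cons, List.not_mem_nil, or_false, not_or] at hz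
  apply hz.1
  refine H.conn_ind b c (u := a) (C := fun y => y = a) h.ab h.ac rfl ?_ z hz.2.1 hz.2.2
  intro x y _ _ hyb hyc hxa hxy
  subst hxa
  rcases hN y hxy with rfl | rfl
  · exact absurd rfl hyb
  · exact absurd rfl hyc

/-- the arc from the apex of one face to the apex of the other one, crossing the common edge -/
theorem Hyp.qarc (H : Hyp D) (h : Tri D F a b c) (h' : Tri D F' a b d) (hne : F ≠ F') :
    ∃ S y, IsArc S (D.pos c) (D.pos d) ∧ y ∈ D.edgeInt s(a, b) ∧
      ∀ p ∈ S, p = D.pos c ∨ p = y ∨ p = D.pos d ∨ p ∉ (pz D).K (PE D) := by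
  have hP := H.plane
  obtain ⟨y, hy⟩ := hP.int_nonempty h.eab.1
  have hy1 : y ∈ closure F := hP.spread h.eab.1 h.mem h.eab.2 hy.1
  have hy2 : y ∈ closure F' := hP.spread h'.eab.1 h'.mem h'.eab.2 hy.1
  have hyK : y ∈ (pz D).K (PE D) := PD.arc_sub_K h.eab.1 hy.1
  have hlf := hP.lf_int h.eab.1 hy
  have hcd : c ≠ d := by
    rintro rfl
    exact hne (H.apex h h')
  have hyn : ∀ w, D.pos w ≠ y := fun w hw => hy.2 ⟨Sum.inl w, hw⟩
  obtain ⟨S, hS, hSF⟩ := hP.join h.mem (H.lf (Sum.inl c)) hlf PD.pos_mem_K hyK (hyn c) (h.rot.rot.cl H) hy1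
  obtain ⟨S', hS', hSF'⟩ := hP.join h'.mem hlf (H.lf (Sum.inl d)) hyK PD.pos_mem_K (hyn d).symm hy2 (h'.rot.rot.cl H)
  refine ⟨S ∪ S', y, hS.concat hS' ?_, ?_, ?_⟩
  · rintro p ⟨hp, hp'⟩
    rcases hSF hp with rfl | hh | hh
    · rcases hSF' hp' with hh | hh | hh
      · exact absurd hh (hyn _)
      · exact absurd (D.pos_inj hh) hcd
      · exact absurd PD.pos_mem_K (face_sub h'.mem hh)
    · exact hh
    · rcases hSF' hp' with rfl | h2 | h2
      · rfl
      · rw [mem_singleton_iff.1 h2] at hh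
        exact absurd PD.pos_mem_K (face_sub h.mem hh)
      · exact absurd (face_eq h.mem h'.mem hh h2) hne
  · rw [edgeInt_good H.good]
    refine ⟨by have := hy.1; rwa [pz_arc_vv] at this, ?_⟩
    rintro ⟨w, hw⟩
    exact hyn w hw
  · rintro p (hp | hp)
    · rcases hSF hp with hh | hh | hh
      · exact Or.inl hh
      · exact Or.inr (Or.inl hh)
      · exact Or.inr (Or.inr (Or.inr (face_sub h.mem hh)))
    · rcases hSF' hp with hh | hh | hh
      · exact Or.inr (Or.inl hh)
      · exact Or.inr (Or.inr (Or.inl hh))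
      · exact Or.inr (Or.inr (Or.inr (face_sub h'.mem hh)))

theorem unc_unique {y : Pl} (h : Unc D a b) (hy : y ∈ D.edgeInt s(a, b)) (hy' : y ∈ D.edgeInt e) : e = s(a, b) := by
  by_contra hne
  exact h.2 e ⟨fun h => hne h.symm, y, hy, hy'⟩

theorem Hyp.qp (H : Hyp D) (h : Tri D F a b c) (h' : Tri D F' a b d) (hne : F ≠ F') : G.Adj c d := by
  obtain ⟨S, y, hS, hy, hall⟩ := H.qarc h h' hne
  have hcd : c ≠ d := by
    rintro rfl
    exact hne (H.apex h h')
  have key : ∀ g p, p ∈ S → p ∈ D.edgeInt g → p = y ∧ g = s(a, b) := by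
    intro g p hp hpg
    rcases hall p hp with rfl | rfl | rfl | hh
    · exact absurd hpg (edgeInt_pos H.good)
    · exact ⟨rfl, unc_unique h.uab hy hpg⟩
    · exact absurd hpg (edgeInt_pos H.good)
    · exact absurd (edgeInt_sub_K H.good hpg) hh
  apply add_edge H.max hcd hS
  · intro w hw
    rcases hall _ hw with hh | hh | hh | hh
    · exact Or.inl (D.pos_inj hh)
    · rw [← hh] at hy
      exact absurd hy (edgeInt_pos H.good)
    · exact Or.inr (D.pos_inj hh)
    · exact absurd (PD.pos_mem_K (n := Sum.inl w)) hh
  · rintro g p ⟨hp, hpg⟩ q ⟨hq, hqg⟩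
    rw [(key g p hp hpg).1, (key g q hq hqg).1]
  · intro g hg
    rw [eq_empty_iff_forall_notMem]
    rintro p ⟨hp, hpg⟩
    obtain ⟨-, rfl⟩ := key g p hp hpg
    simp only [Sym2.mem_iff] at hg
    have := h.bc
    have := h.ac
    have := h'.bc
    have := h'.ac
    grind
  · rintro g g' ⟨p, hp, hpg⟩ ⟨q, hq, hqg⟩
    rw [(key g p hp hpg).2, (key g' q hq hqg).2]
  · rintro g ⟨p, hp, hpg⟩
    rw [(key g p hp hpg).2]
    exact h.uab.2

end
end PT

namespace PT
open Topology
section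
variable {V : Type} {G : SimpleGraph V} {D : Drawing G} {u v w a b c d e f : V} {T G1 G2 G3 : Set Pl}
variable [Finite V] [Finite (Nd D)]

/-- three true faces around `b` -/
theorem Hyp.around (H : Hyp D) (h0 : Tri D T a b c) (h1 : Tri D G1 a b d) (h2 : Tri D G2 b c d)
    (n1 : T ≠ G1) (n2 : T ≠ G2) (hw : G.Adj b w) : w = a ∨ w = c ∨ w = d := by
  have hcd : c ≠ d := h2.bc
  have n12 : G1 ≠ G2 := by
    rintro rfl
    rcases h2.edge h1.swap.eab with hh | hh
    · exact h0.ac (Sum.inl.inj hh)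
    · exact h1.ac (Sum.inl.inj hh)
  have k0 := h0.swap
  have k1 := h1.swap
  have p1 := (H.adj_pair h0.mem h1.mem n1 k0.eab k1.eab).subset
  have p2 := (H.adj_pair h0.mem h2.mem n2 h0.rot.eab h2.eab).subset
  have p3 := (H.adj_pair h1.mem h2.mem n12 h1.rot.eab h2.rot.rot.swap.eab).subset
  obtain ⟨Z, hZ, hh⟩ := H.nbrs (𝓕 := {T, G1, G2}) (F := T) (a := b) (by
      rintro Z (rfl | rfl | rfl)
      · exact h0.mem
      · exact h1.mem
      · exact h2.mem) (by simp) (k0.cl H) (by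
      rintro Z (rfl | rfl | rfl) m hm
      · rcases k0.edge hm with rfl | rfl <;> exact ⟨_, rfl⟩
      · rcases k1.edge hm with rfl | rfl <;> exact ⟨_, rfl⟩
      · rcases h2.edge hm with rfl | rfl <;> exact ⟨_, rfl⟩) (by
      have q1 : ({T, G1} : Set (Set Pl)) ⊆ {T, G1, G2} := by intro z hz; simp at hz ⊢; tauto
      have q2 : ({T, G2} : Set (Set Pl)) ⊆ {T, G1, G2} := by intro z hz; simp at hz ⊢; tauto
      have q3 : ({G1, G2} : Set (Set Pl)) ⊆ {T, G1, G2} := by intro z hz; simp at hz ⊢; tauto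
      rintro Z (rfl | rfl | rfl) m hm
      · rcases k0.edge hm with rfl | rfl
        · exact p1.trans q1
        · exact p2.trans q2
      · rcases k1.edge hm with rfl | rfl
        · exact p1.trans q1
        · exact p3.trans q3
      · rcases h2.edge hm with rfl | rfl
        · exact p2.trans q2
        · exact p3.trans q3) hw
  rcases hZ with rfl | rfl | rfl
  · rcases k0.edge hh with h0 | h0 <;> have := Sum.inl.inj h0 <;> tauto
  · rcases k1.edge hh with h0 | h0 <;> have := Sum.inl.inj h0 <;> tauto
  · rcases h2.edge hh with h0 | h0 <;> have := Sum.inl.inj h0 <;> tauto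

theorem Hyp.deq (H : Hyp D) (h0 : Tri D T a b c) (h1 : Tri D G1 a b d) (h2 : Tri D G2 b c d)
    (h3 : Tri D G3 c a f) (n1 : T ≠ G1) (n2 : T ≠ G2) (n3 : T ≠ G3) : False := by
  have hbf : G.Adj b f := H.qp h0.rot.rot h3 n3
  have hfd : f = d := by
    rcases H.around h0 h1 h2 n1 n2 hbf with rfl | rfl | rfl
    · exact absurd rfl h3.bc
    · exact absurd rfl h3.ac
    · rfl
  subst hfd
  have Nb := fun w (hw : G.Adj b w) => H.around h0 h1 h2 n1 n2 hw
  have Nc := fun w (hw : G.Adj c w) => H.around h0.rot h2 h3 n2 n3 hw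
  have Na := fun w (hw : G.Adj a w) => H.around h0.rot.rot h3 h1 n3 n1 hw
  obtain ⟨z, hz⟩ := H.exists_ne [a, b, c, f] (by simp)
  simp only [List.mem_cons, List.not_mem_nil, or_false, not_or] at hz
  have := H.conn_ind f f (u := a) (C := fun y => y = a ∨ y = b ∨ y = c) h1.ac h1.ac (by simp) (by
    rintro x y _ _ hy _ (rfl | rfl | rfl) hxy
    · have := Na y hxy; tauto
    · have := Nb y hxy; tauto
    · have := Nc y hxy; tauto) z hz.2.2.2 hz.2.2.2
  tauto

theorem Hyp.k33 (H : Hyp D) (h0 : Tri D T a b c) (h1 : Tri D G1 a b d) (h2 : Tri D G2 b c e)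
    (h3 : Tri D G3 c a f) (n1 : T ≠ G1) (n2 : T ≠ G2) (n3 : T ≠ G3) (hde : d ≠ e) (hdf : d ≠ f) (hef : e ≠ f) :
    D.Cross s(c, d) s(a, e) := by
  by_contra hcr
  have hdc : d ≠ c := by rintro rfl; exact n1 (H.apex h0 h1)
  have hea : e ≠ a := by rintro rfl; exact n2 (H.apex h0.rot h2)
  have hfb : f ≠ b := by rintro rfl; exact n3 (H.apex h0.rot.rot h3)
  have hcd : G.Adj c d := H.qp h0 h1 n1
  have hae : G.Adj a e := H.qp h0.rot h2 n2
  obtain ⟨S, y, hS, hy, hall⟩ := H.qarc h0.rot.rot h3 n3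
  let p : Fin 3 → V := ![a, b, c]
  let q : Fin 3 → V := ![d, e, f]
  have hp : Function.Injective p := by
    intro i j hij
    fin_cases i <;> fin_cases j <;> simp [p, h0.ab, h0.bc, h0.ac, h0.ab.symm, h0.bc.symm, h0.ac.symm] at hij ⊢
  have hq : Function.Injective q := by
    intro i j hij
    fin_cases i <;> fin_cases j <;> simp [q, hde, hdf, hef, hde.symm, hdf.symm, hef.symm] at hij ⊢
  have hpq : ∀ i j, p i ≠ q j := by
    intro i j
    fin_cases i <;> fin_cases j
    · exact h1.ac
    · exact hea.symm
    · exact h3.bc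
    · exact h1.bc
    · exact h2.ac
    · exact hfb.symm
    · exact hdc.symm
    · exact h2.bc
    · exact h3.ac
  have hadj : ∀ i j, (i, j) ≠ (1, 2) → G.Adj (p i) (q j) := by
    intro i j hij
    fin_cases i <;> fin_cases j <;> first | exact absurd rfl hij | skip
    · exact h1.uca.symm.1
    · exact hae
    · exact h3.ubc.1
    · exact h1.ubc.1
    · exact h2.uca.symm.1
    · exact hcd
    · exact h2.ubc.1
    · exact h3.uca.symm.1
  have hunc : ∀ i j, (i, j) ≠ (1, 2) → (i, j) ≠ (0, 1) → (i, j) ≠ (2, 0) → Unc D (p i) (q j) := by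
    intro i j hij hij2 hij3
    fin_cases i <;> fin_cases j <;> first | exact absurd rfl hij | exact absurd rfl hij2 | exact absurd rfl hij3 | skip
    · exact h1.uca.symm
    · exact h3.ubc
    · exact h1.ubc
    · exact h2.uca.symm
    · exact h2.ubc
    · exact h3.uca.symm
  have hncr : ∀ i j i' j', (i, j) ≠ (1, 2) → (i', j') ≠ (1, 2) → ¬ D.Cross s(p i, q j) s(p i', q j') := by
    intro i j i' j' h h' hc
    by_cases k1 : (i, j) ≠ (0, 1) ∧ (i, j) ≠ (2, 0)
    · exact (hunc i j h k1.1 k1.2).2 _ hc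
    by_cases k2 : (i', j') ≠ (0, 1) ∧ (i', j') ≠ (2, 0)
    · exact (hunc i' j' h' k2.1 k2.2).2 _ (Cross.symm' hc)
    have k1' : (i, j) = (0, 1) ∨ (i, j) = (2, 0) := by tauto
    have k2' : (i', j') = (0, 1) ∨ (i', j') = (2, 0) := by tauto
    simp only [Prod.mk.injEq] at k1' k2'
    rcases k1' with ⟨rfl, rfl⟩ | ⟨rfl, rfl⟩ <;> rcases k2' with ⟨rfl, rfl⟩ | ⟨rfl, rfl⟩
    · exact hc.1 rfl
    · exact hcr (Cross.symm' hc)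
    · exact hcr hc
    · exact hc.1 rfl
  have hne : ∀ i j, s(p i, q j) ≠ s(c, a) := by
    intro i j hh
    rw [Sym2.eq_iff] at hh
    rcases hh with ⟨-, hh⟩ | ⟨-, hh⟩
    · exact hpq 0 j hh.symm
    · exact hpq 2 j hh.symm
  classical
  let A : Fin 3 → Fin 3 → Set Pl := fun i j => if (i, j) = (1, 2) then S else arcS D s(p i, q j)
  have hA12 : A 1 2 = S := if_pos rfl
  have hAn : ∀ i j, (i, j) ≠ (1, 2) → A i j = arcS D s(p i, q j) := fun i j h => if_neg h
  have hpos : ∀ w i j, D.pos w ∈ A i j → w = p i ∨ w = q j := by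
    intro w i j hw
    by_cases h : (i, j) = (1, 2)
    · obtain ⟨rfl, rfl⟩ := Prod.mk.inj h
      rw [hA12] at hw
      rcases hall _ hw with hh | hh | hh | hh
      · exact Or.inl (D.pos_inj hh)
      · rw [← hh] at hy
        exact absurd hy (edgeInt_pos H.good)
      · exact Or.inr (D.pos_inj hh)
      · exact absurd (PD.pos_mem_K (n := Sum.inl w)) hh
    · rw [hAn i j h, arcS_eq (hadj i j h)] at hw
      exact H.good.1 w (hadj i j h) hw
  have hinter : ∀ i j x, (i, j) ≠ (1, 2) → x ∈ A i j → x ∉ range D.pos → x ∈ D.edgeInt s(p i, q j) := by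
    intro i j x h hx hxr
    rw [edgeInt_good H.good, ← hAn i j h]
    exact ⟨hx, hxr⟩
  have hSx : ∀ i j x, (i, j) ≠ (1, 2) → x ∈ A i j → x ∉ range D.pos → x ∉ S := by
    intro i j x h hx hxr hxS
    have hi := hinter i j x h hx hxr
    rcases hall _ hxS with hh | hh | hh | hh
    · exact hxr ⟨_, hh.symm⟩
    · rw [hh] at hi
      exact hne i j (unc_unique h0.uca hy hi)
    · exact hxr ⟨_, hh.symm⟩
    · exact hh (edgeInt_sub_K H.good hi)
  refine no_K33 (p := fun i => D.pos (p i)) (q := fun j => D.pos (q j)) (A := A) ?_ ?_ ?_ ?_ ?_ ?_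
  · intro i j
    by_cases h : (i, j) = (1, 2)
    · obtain ⟨rfl, rfl⟩ := Prod.mk.inj h
      rw [hA12]
      exact hS
    · rw [hAn i j h, arcS_eq (hadj i j h)]
      exact arc_isArc' _
  · exact D.pos_inj.comp hp
  · exact D.pos_inj.comp hq
  · intro k i j hk
    rcases hpos _ i j hk with hh | hh
    · exact hp hh
    · exact absurd hh (hpq k j)
  · intro k i j hk
    rcases hpos _ i j hk with hh | hh
    · exact absurd hh.symm (hpq i k)
    · exact hq hh
  · rintro i j i' j' hij x ⟨hx, hx'⟩
    by_cases hxr : x ∈ range D.pos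
    · obtain ⟨w, rfl⟩ := hxr
      rcases hpos _ i j hx with rfl | rfl
      · exact Or.inl ⟨i, rfl⟩
      · exact Or.inr ⟨j, rfl⟩
    · exfalso
      by_cases h : (i, j) = (1, 2)
      · have h' : (i', j') ≠ (1, 2) := fun h' => hij (h.trans h'.symm)
        obtain ⟨rfl, rfl⟩ := Prod.mk.inj h
        rw [hA12] at hx
        exact hSx i' j' x h' hx' hxr hx
      · by_cases h' : (i', j') = (1, 2)
        · obtain ⟨rfl, rfl⟩ := Prod.mk.inj h'
          rw [hA12] at hx'
          exact hSx i j x h hx hxr hx'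
        · refine hncr i j i' j' h h' ⟨?_, x, hinter i j x h hx hxr, hinter i' j' x h' hx' hxr⟩
          intro hh
          rw [Sym2.eq_iff] at hh
          rcases hh with ⟨h1, h2⟩ | ⟨h1, h2⟩
          · exact hij (by rw [hp h1, hq h2])
          · exact hpq _ _ h1

theorem Hyp.no_true_nbhd (H : Hyp D) (h0 : Tri D T a b c) (h1 : Tri D G1 a b d) (h2 : Tri D G2 b c e)
    (h3 : Tri D G3 c a f) (n1 : T ≠ G1) (n2 : T ≠ G2) (n3 : T ≠ G3) : False := by
  have hde : d ≠ e := by rintro rfl; exact H.deq h0 h1 h2 h3 n1 n2 n3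
  have hef : e ≠ f := by rintro rfl; exact H.deq h0.rot h2 h3 h1 n2 n3 n1
  have hdf : d ≠ f := by rintro rfl; exact H.deq h0.rot.rot h3 h1 h2 n3 n1 n2
  have c1 := H.k33 h0 h1 h2 h3 n1 n2 n3 hde hdf hef
  have c2 := H.k33 h0.swap h1.swap h3.swap h2.swap n1 n3 n2 hdf hde hef.symm
  have := H.op _ c1 c2
  rw [Sym2.eq_iff] at this
  rcases this with ⟨hh, -⟩ | ⟨hh, -⟩
  · exact h0.ab hh
  · exact h3.bc hh

/-- each true face shares an uncrossed edge with a false face -/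
theorem Hyp.share (H : Hyp D) (h0 : Tri D T a b c) :
    ∃ F ∈ (pz D).fc (PE D), (∃ v x, s(Sum.inl v, Sum.inr x) ∈ (pz D).bd (PE D) F) ∧
      ∃ u v, s(Sum.inl u, Sum.inl v) ∈ (pz D).bd (PE D) T ∧ s(Sum.inl u, Sum.inl v) ∈ (pz D).bd (PE D) F := by
  by_contra hcon
  have key : ∀ {a b c : V}, Tri D T a b c → ∃ F d, T ≠ F ∧ Tri D F a b d := by
    intro a b c h0
    obtain ⟨F₁, F₂, hne, hadj⟩ := H.plane.adj_two h0.eab.1 (H.bf _ _ h0.eab.1)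
    obtain ⟨F, hFT, hF⟩ : ∃ F, T ≠ F ∧ F ∈ (pz D).adjF (PE D) s(Sum.inl a, Sum.inl b) := by
      by_cases hh : T = F₁
      · exact ⟨F₂, by rw [hh]; exact hne, by rw [hadj]; simp⟩
      · exact ⟨F₁, hh, by rw [hadj]; simp⟩
    obtain ⟨p, q, r, h⟩ := H.true_face hF.1 (by
      intro v x hvx
      exact hcon ⟨F, hF.1, ⟨v, x, hvx⟩, a, b, h0.eab, h0.eab.1, hF.2⟩)
    obtain ⟨d, hd⟩ := h.third ⟨h0.eab.1, hF.2⟩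
    exact ⟨F, d, hFT, hd⟩
  obtain ⟨G1, d, n1, h1⟩ := key h0
  obtain ⟨G2, e, n2, h2⟩ := key h0.rot
  obtain ⟨G3, f, n3, h3⟩ := key h0.rot.rot
  exact H.no_true_nbhd h0 h1 h2 h3 n1 n2 n3

end
end PT

namespace PT
open Topology
section
variable {V : Type} {G : SimpleGraph V} {D : Drawing G} {u v w a b c d e f : V} {F T : Set Pl}
variable [Finite V] [Finite (Nd D)]

theorem Hyp.four_ends (H : Hyp D) (x : D.crossingSet) :
    ∃ q : Fin 4 → V, ∀ v, HalfAdj D v x → ∃ i, v = q i := by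
  obtain ⟨a, b, h, hx⟩ := exists_half x
  obtain ⟨c, d, -, -, -, -, -, -, hall⟩ := H.cross_struct h hx
  refine ⟨![a, b, c, d], ?_⟩
  rintro v ⟨w, hvw, hxw⟩
  have hv : v ∈ s(v, w) := Sym2.mem_mk_left _ _
  rcases hall _ _ hvw hxw with h1 | h1
  · rw [h1, Sym2.mem_iff] at hv
    rcases hv with rfl | rfl
    · exact ⟨0, rfl⟩
    · exact ⟨1, rfl⟩
  · rw [h1, Sym2.mem_iff] at hv
    rcases hv with rfl | rfl
    · exact ⟨2, rfl⟩
    · exact ⟨3, rfl⟩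

theorem Hyp.card_PH (H : Hyp D) : (PH D).ncard ≤ 4 * Nat.card D.crossingSet := by
  haveI : Finite D.crossingSet := (crossing_finite H.good).to_subtype
  choose q hq using H.four_ends
  have hsub : PH D ⊆ (fun p : Fin 4 × D.crossingSet => (s(Sum.inl (q p.2 p.1), Sum.inr p.2) : Sym2 (Nd D))) '' univ := by
    rintro e ⟨v, x, rfl, hv⟩
    obtain ⟨i, rfl⟩ := hq x v hv
    exact ⟨(i, x), mem_univ _, rfl⟩
  refine (ncard_le_ncard hsub (toFinite _)).trans ((ncard_image_le (toFinite _)).trans ?_)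
  rw [ncard_univ, Nat.card_prod, Nat.card_fin]

theorem Hyp.card_PU (H : Hyp D) : (PU D).ncard + 2 * Nat.card D.crossingSet ≤ G.edgeSet.ncard := by
  haveI : Finite D.crossingSet := (crossing_finite H.good).to_subtype
  have hx : ∀ x : D.crossingSet, ∃ g : Fin 2 → Sym2 V, Function.Injective g ∧ ∀ i, x.1 ∈ D.edgeInt (g i) := by
    rintro ⟨x, e, f, hne, he, hf⟩
    refine ⟨![e, f], ?_, ?_⟩
    · intro i j hij
      fin_cases i <;> fin_cases j <;> simp_all
    · intro i
      fin_cases i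
      · exact he
      · exact hf
  choose g hgi hg using hx
  let φ : Fin 2 × D.crossingSet → Sym2 V := fun p => g p.2 p.1
  have hφ : Function.Injective φ := by
    rintro ⟨i, x⟩ ⟨j, y⟩ hij
    change g x i = g y j at hij
    have h1 := hg x i
    rw [hij] at h1
    have hxy : x = y := Subtype.ext (one_pt H.good H.op x.2 y.2 h1 (hg y j))
    subst hxy
    rw [hgi x hij]
  let U : Set (Sym2 V) := {e | ∃ u v, e = s(u, v) ∧ Unc D u v}
  have hU : PU D ⊆ (Sym2.map Sum.inl) '' U := by
    rintro e ⟨u, v, rfl, h⟩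
    exact ⟨s(u, v), ⟨u, v, rfl, h⟩, rfl⟩
  have h1 : (PU D).ncard ≤ U.ncard := (ncard_le_ncard hU (toFinite _)).trans (ncard_image_le (toFinite _))
  have h2 : (range φ).ncard = 2 * Nat.card D.crossingSet := by
    rw [← image_univ, ncard_image_of_injective _ hφ, ncard_univ, Nat.card_prod, Nat.card_fin]
  have hd : Disjoint U (range φ) := by
    rw [Set.disjoint_left]
    rintro _ ⟨u, v, rfl, h⟩ ⟨⟨i, x⟩, hix⟩
    have := hg x i
    change g x i = _ at hix
    rw [hix] at this
    exact unc_not_half h x this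
  have hs : U ∪ range φ ⊆ G.edgeSet := by
    rintro e (⟨u, v, rfl, h⟩ | ⟨⟨i, x⟩, rfl⟩)
    · exact h.1
    · exact edgeInt_mem ⟨_, hg x i⟩
  have h3 := ncard_le_ncard hs (toFinite _)
  rw [ncard_union_eq hd (toFinite _) (toFinite _)] at h3
  omega

/-- false faces -/
def FF (D : Drawing G) : Set (Set Pl) :=
  {F ∈ (pz D).fc (PE D) | ∃ v x, s(Sum.inl v, Sum.inr x) ∈ (pz D).bd (PE D) F}

theorem Hyp.bd_three (H : Hyp D) (hF : F ∈ (pz D).fc (PE D)) : ((pz D).bd (PE D) F).ncard = 3 := by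
  by_cases h : ∃ v x, s(Sum.inl v, Sum.inr x) ∈ (pz D).bd (PE D) F
  · obtain ⟨a, x, he⟩ := h
    obtain ⟨b, hba, -, hbd⟩ := H.false_face hF he
    rw [hbd, ncard_eq_three]
    refine ⟨_, _, _, ?_, ?_, ?_, rfl⟩ <;> simp [hba, hba.symm]
  · push Not at h
    obtain ⟨a, b, c, ht⟩ := H.true_face hF h
    rw [ht.bd, ncard_eq_three]
    have := ht.ab
    have := ht.bc
    have := ht.ac
    refine ⟨_, _, _, ?_, ?_, ?_, rfl⟩ <;> simp [*, Ne.symm, eq_comm] <;> grind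

theorem Hyp.face_count (H : Hyp D) : 3 * ((pz D).fc (PE D)).ncard = 2 * (PE D).ncard := by
  rw [← H.plane.double_eq H.bf, Finset.sum_const_nat (m := 3), mul_comm, ← ncard_eq_toFinset_card _ H.plane.faces_finite]
  intro F hF
  exact H.bd_three (by simpa using hF)

theorem Hyp.card_FF (H : Hyp D) : (FF D).ncard ≤ (PH D).ncard := by
  classical
  have hfin : (FF D).Finite := H.plane.faces_finite.subset (sep_subset _ _)
  have key := Finset.sum_card_bipartiteAbove_eq_sum_card_bipartiteBelow
    (s := hfin.toFinset) (t := (toFinite (PH D)).toFinset) (fun F e => (pz D).Inc e F)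
  have h1 : (FF D).ncard * 2 ≤ ∑ F ∈ hfin.toFinset, (Finset.bipartiteAbove (fun F e => (pz D).Inc e F) (toFinite (PH D)).toFinset F).card := by
    rw [ncard_eq_toFinset_card _ hfin, ← smul_eq_mul]
    refine Finset.card_nsmul_le_sum _ _ 2 ?_
    intro F hF
    rw [Finite.mem_toFinset] at hF
    obtain ⟨hF, a, x, he⟩ := hF
    obtain ⟨b, hba, -, hbd⟩ := H.false_face hF he
    have e2 : s(Sum.inl b, Sum.inr x) ∈ (pz D).bd (PE D) F := by
      rw [hbd, Sym2.eq_swap]; simp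
    rw [← Finset.card_pair (a := (s(Sum.inl a, Sum.inr x) : Sym2 (Nd D))) (b := s(Sum.inl b, Sum.inr x)) (by simp [hba.symm])]
    refine Finset.card_le_card ?_
    intro e hh
    rw [Finset.mem_insert, Finset.mem_singleton] at hh
    rw [Finset.mem_bipartiteAbove, Finite.mem_toFinset]
    rcases hh with rfl | rfl
    · exact ⟨⟨a, x, rfl, mem_PE_vx.1 he.1⟩, he.2⟩
    · exact ⟨⟨b, x, rfl, mem_PE_vx.1 e2.1⟩, e2.2⟩
  have h2 : ∑ e ∈ (toFinite (PH D)).toFinset, (Finset.bipartiteBelow (fun F e => (pz D).Inc e F) hfin.toFinset e).card ≤ (PH D).ncard * 2 := by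
    rw [ncard_eq_toFinset_card _ (toFinite (PH D)), ← smul_eq_mul]
    refine Finset.sum_le_card_nsmul _ _ 2 ?_
    intro e he
    rw [Finite.mem_toFinset] at he
    refine le_trans ?_ (H.plane.adj_card_le (e := e) (Or.inr he))
    rw [← ncard_coe_finset]
    refine ncard_le_ncard ?_ (H.plane.faces_finite.subset (sep_subset _ _))
    intro F hF
    rw [Finset.mem_coe, Finset.mem_bipartiteBelow, Finite.mem_toFinset] at hF
    exact ⟨hF.1.1, hF.2⟩
  omega

theorem Hyp.ff_edge (H : Hyp D) (hF : F ∈ FF D) {e e' : Sym2 V}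
    (h : e.map Sum.inl ∈ (pz D).bd (PE D) F) (h' : e'.map Sum.inl ∈ (pz D).bd (PE D) F) : e = e' := by
  obtain ⟨hF, a, x, he⟩ := hF
  obtain ⟨b, hba, -, hbd⟩ := H.false_face hF he
  rw [hbd] at h h'
  induction e using Sym2.ind with
  | _ p q =>
  induction e' using Sym2.ind with
  | _ r s =>
    simp at h h'
    simp
    grind

theorem Hyp.card_true (H : Hyp D) : ((pz D).fc (PE D) \ FF D).ncard ≤ (FF D).ncard := by
  have hfin : (FF D).Finite := H.plane.faces_finite.subset (sep_subset _ _)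
  have hs : ∀ T ∈ (pz D).fc (PE D) \ FF D, ∃ F, F ∈ FF D ∧ ∃ e : Sym2 V,
      e.map Sum.inl ∈ (pz D).bd (PE D) T ∧ e.map Sum.inl ∈ (pz D).bd (PE D) F := by
    rintro T ⟨hT, hn⟩
    obtain ⟨a, b, c, ht⟩ := H.true_face hT (fun v x hvx => hn ⟨hT, v, x, hvx⟩)
    obtain ⟨F, hF, hh, u, v, h1, h2⟩ := H.share ht
    exact ⟨F, ⟨hF, hh⟩, s(u, v), h1, h2⟩
  haveI : Nonempty (Sym2 V) := by
    obtain ⟨z, -⟩ := H.exists_ne [] (by simp)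
    exact ⟨s(z, z)⟩
  choose! g hg e he1 he2 using hs
  refine ncard_le_ncard_of_injOn g (fun T hT => hg T hT) ?_ hfin
  intro T hT T' hT' heq
  have hFF := hg T hT
  have hee : e T = e T' := H.ff_edge hFF (he2 T hT) (by rw [heq]; exact he2 T' hT')
  have hne : g T ≠ T := fun hh => hT.2 (hh ▸ hFF)
  have hne' : g T ≠ T' := fun hh => hT'.2 (hh ▸ hFF)
  have hp := H.adj_pair hFF.1 hT.1 hne (he2 T hT) (he1 T hT)
  have hm : T' ∈ (pz D).adjF (PE D) ((e T).map Sum.inl) := ⟨hT'.1, by rw [hee]; exact (he1 T' hT').2⟩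
  rw [hp] at hm
  rcases hm with hm | hm
  · exact absurd hm.symm hne'
  · exact hm.symm

theorem Hyp.count (H : Hyp D) : Nat.card V ≤ 3 * Nat.card D.crossingSet + 2 ∧
    3 * Nat.card V + Nat.card D.crossingSet ≤ G.edgeSet.ncard + 6 := by
  haveI : Finite D.crossingSet := (crossing_finite H.good).to_subtype
  have h1 := H.card_PH
  have h2 := H.card_PU
  have h3 := H.face_count
  have h4 := H.card_FF
  have h5 := H.card_true
  have h6 := H.plane.euler_eq H.pconn
  rw [Nat.card_sum] at h6
  have h7 : (PE D).ncard ≤ (PU D).ncard + (PH D).ncard := ncard_union_le _ _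
  have h8 := ncard_sdiff_add_ncard_of_subset (s := FF D) (t := (pz D).fc (PE D)) (sep_subset _ _) H.plane.faces_finite
  omega

end

theorem final {V : Type} [Finite V] {G : SimpleGraph V} {D : Drawing G} (H : Hyp D) :
    Nat.card V ≤ 3 * crossingNumber G + 2 := by
  haveI : Finite D.crossingSet := (crossing_finite H.good).to_subtype
  obtain ⟨h1, h2⟩ := H.count
  obtain ⟨D', hD', hc⟩ := Nat.sInf_mem (s := {n | ∃ D : Drawing G, D.IsGood ∧ D.crNum = n}) ⟨_, D, H.good, rfl⟩
  have h3 := partA hD' (by have := H.card; omega)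
  have : crossingNumber G = D'.crNum := hc.symm
  omega

end PT

/-- Every 3-connected immovable maximal 1-plane graph on `n ≥ 5` vertices
satisfies `cr(G) ≥ (n - 2)/3`. -/
theorem stmt_0 {V : Type} [Fintype V] {G : SimpleGraph V} (D : Drawing G)
    (hmax : D.IsMaximalOnePlane) (hconn : KConnected G 3) (himm : D.Immovable)
    (hn : 5 ≤ Fintype.card V) :
    ((Fintype.card V : ℝ) - 2) / 3 ≤ (crossingNumber G : ℝ) := by
  have H : PT.Hyp D := ⟨hmax, hconn, himm, by rw [Nat.card_eq_fintype_card]; exact hn⟩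
  have h := PT.final H
  rw [Nat.card_eq_fintype_card] at h
  have h2 : (Fintype.card V : ℝ) ≤ 3 * (crossingNumber G : ℝ) + 2 := by exact_mod_cast h
  linarith
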